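/- Let q ≥ 121 be an odd prime power and let E be an elliptic curve defined over F_q with j-invariant j(E) ≠ 0. Then the 5-elliptic code associated to E is not 3-extendable: there is no [n+3, 5, d+3]_q code whose truncation on the first n coordinates equals the 5-elliptic code of length n and minimum distance d. -/

import Mathlib

set_option linter.unusedSectionVars false

namespace NMDS

open WeierstrassCurve

variable {F : Type} [Field F] [Fintype F] [DecidableEq F]

/-- `ψ_i(X,Y)`: `Y^s` if `i = 3s` (`s ≥ 1`), `X·Y^s` if `i = 3s+2` (`s ≥ 0`),
`X²·Y^s` if `i = 3s+4` (`s ≥ 0`). -/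
def psi (i : ℕ) (X Y : F) : F :=
  if i % 3 = 0 then Y ^ (i / 3)
  else if i % 3 = 2 then X * Y ^ (i / 3)
  else X ^ 2 * Y ^ ((i - 4) / 3)

/-- The coordinate vector of `φ_k(P)`: `(1, ψ₂(P), …, ψ_k(P))` for an affine point `P`,
and `(0, …, 0, 1)` for the point at infinity. -/
def phiVec (W : WeierstrassCurve F) (k : ℕ) : W.toAffine.Point → (Fin k → F)
  | .zero => fun j => if (j : ℕ) = k - 1 then 1 else 0
  | .some (x := x) (y := y) _ => fun j => if (j : ℕ) = 0 then 1 else psi ((j : ℕ) + 1) x y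

lemma phiVec_ne_zero (W : WeierstrassCurve F) {k : ℕ} (hk : 0 < k)
    (P : W.toAffine.Point) : phiVec W k P ≠ 0 := by
  cases P with
  | zero =>
    intro h
    have := congrFun h ⟨k - 1, by omega⟩
    simp [phiVec] at this
  | some h' =>
    intro h
    have := congrFun h ⟨0, hk⟩
    simp [phiVec] at this

/-- The image of a rational point of `E` in `P^{k-1}(F_q)` under `φ_k`. -/
noncomputable def phiProj (W : WeierstrassCurve F) {k : ℕ} (hk : 0 < k)
    (P : W.toAffine.Point) : Projectivization F (Fin k → F) :=
  Projectivization.mk F (phiVec W k P) (phiVec_ne_zero W hk P)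

/-- The `k`-elliptic code associated to `E`, relative to an enumeration `e` of the `n`
rational points of `E`: the span of the rows of the `k × n` matrix whose `j`-th column
is `φ_k(P_j)`. -/
def ellipticCode (W : WeierstrassCurve F) (k : ℕ) {n : ℕ}
    (e : Fin n ≃ W.toAffine.Point) : Submodule F (Fin n → F) :=
  Submodule.span F (Set.range fun i : Fin k => fun j : Fin n => phiVec W k (e j) i)

/-- The minimum distance (= minimum weight) of a linear code. -/
noncomputable def minDist {n : ℕ} (C : Submodule F (Fin n → F)) : ℕ :=
  sInf {d | ∃ x ∈ C, x ≠ 0 ∧ hammingNorm x = d}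

/-- The standard inner product with `y` as a linear map. -/
def dotLin {n : ℕ} (y : Fin n → F) : (Fin n → F) →ₗ[F] F where
  toFun x := ∑ i, x i * y i
  map_add' a b := by simp [add_mul, Finset.sum_add_distrib]
  map_smul' c a := by simp [Finset.mul_sum, mul_assoc]

/-- The dual code: all vectors orthogonal to every codeword. -/
def dualCode {n : ℕ} (C : Submodule F (Fin n → F)) : Submodule F (Fin n → F) :=
  ⨅ y ∈ C, LinearMap.ker (dotLin y)

/-- The Singleton defect `s(C) = n - k + 1 - d` of a code of length `n`. -/
noncomputable def singletonDefect {n : ℕ} (C : Submodule F (Fin n → F)) : ℤ :=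
  (n : ℤ) + 1 - Module.finrank F C - minDist C

/-- A code is MDS if its Singleton defect is zero. -/
noncomputable def IsMDS {n : ℕ} (C : Submodule F (Fin n → F)) : Prop :=
  singletonDefect C = 0

/-- A code is near-MDS if both it and its dual have Singleton defect one. -/
noncomputable def IsNMDS {n : ℕ} (C : Submodule F (Fin n → F)) : Prop :=
  singletonDefect C = 1 ∧ singletonDefect (dualCode C) = 1

/-- An `[n,k,d]_q` code `C` is `h`-extendable if there is an `[n+h,k,d+h]_q` code `C'`
whose projection on the first `n` coordinates is `C`. -/
noncomputable def IsHExtendable {n : ℕ} (h : ℕ) (C : Submodule F (Fin n → F)) : Prop :=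
  ∃ C' : Submodule F (Fin (n + h) → F),
    Module.finrank F C' = Module.finrank F C ∧
    minDist C' = minDist C + h ∧
    Submodule.map (LinearMap.funLeft F F (Fin.castAdd h)) C' = C

/-- The point `p` of `P^{k-1}(F_q)` lies on the hyperplane with coefficient vector `a`. -/
def OnHyp {k : ℕ} (a : Fin k → F) (p : Projectivization F (Fin k → F)) : Prop :=
  ∑ i, a i * p.rep i = 0

/-- An `(·; k, k-2)`-set in `P^{k-1}(F_q)`: no `k+1` of its points lie on a common hyperplane,
i.e. every hyperplane contains at most `k` of its points. -/
def IsArcSet (k : ℕ) (S : Set (Projectivization F (Fin k → F))) : Prop :=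
  ∀ a : Fin k → F, a ≠ 0 → Set.ncard {p ∈ S | OnHyp a p} ≤ k

/-- A complete `(·; k, k-2)`-set: maximal with respect to set-theoretical inclusion. -/
def IsCompleteArcSet (k : ℕ) (S : Set (Projectivization F (Fin k → F))) : Prop :=
  IsArcSet k S ∧ ∀ T, IsArcSet k T → S ⊆ T → T = S

/-- Evaluation of the homogeneous cubic of a Weierstrass curve:
`Y²Z + a₁XYZ + a₃YZ² - X³ - a₂X²Z - a₄XZ² - a₆Z³`. -/
def cubicEval {R : Type*} [CommRing R] (W : WeierstrassCurve R) (x y z : R) : R :=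
  y ^ 2 * z + W.a₁ * x * y * z + W.a₃ * y * z ^ 2
    - (x ^ 3 + W.a₂ * x ^ 2 * z + W.a₄ * x * z ^ 2 + W.a₆ * z ^ 3)

/-- The gradient of the homogeneous cubic of a Weierstrass curve. -/
def gradEval {R : Type*} [CommRing R] (W : WeierstrassCurve R) (x y z : R) : Fin 3 → R :=
  ![W.a₁ * y * z - (3 * x ^ 2 + 2 * W.a₂ * x * z + W.a₄ * z ^ 2),
    2 * y * z + W.a₁ * x * z + W.a₃ * z ^ 2,
    y ^ 2 + W.a₁ * x * y + 2 * W.a₃ * y * z - (W.a₂ * x ^ 2 + 2 * W.a₄ * x * z + 3 * W.a₆ * z ^ 2)]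

/-- The point `p` of `P²(F_q)` lies on the plane cubic `E`. -/
def OnCurve (W : WeierstrassCurve F) (p : Projectivization F (Fin 3 → F)) : Prop :=
  cubicEval W (p.rep 0) (p.rep 1) (p.rep 2) = 0

/-- A line of `P²(F_q)`, given by its coefficient vector `l`, is a tangent of `E`:
it touches the curve at some point (over the algebraic closure) with multiplicity at
least two, i.e. it is the tangent line of the cubic at a contact point. -/
def IsTangentLine (W : WeierstrassCurve F) (l : Fin 3 → F) : Prop :=
  ∃ v : Fin 3 → AlgebraicClosure F, v ≠ 0 ∧
    cubicEval (W.baseChange (AlgebraicClosure F)) (v 0) (v 1) (v 2) = 0 ∧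
    (∑ i, algebraMap F (AlgebraicClosure F) (l i) * v i) = 0 ∧
    ∃ t : AlgebraicClosure F, t ≠ 0 ∧
      gradEval (W.baseChange (AlgebraicClosure F)) (v 0) (v 1) (v 2) =
        t • fun i => algebraMap F (AlgebraicClosure F) (l i)

/-- A line of `P²(F_q)` intersects `E` in three distinct `F_q`-rational points. -/
def IsThreeSecant (W : WeierstrassCurve F) (l : Fin 3 → F) : Prop :=
  ∃ u v w : Projectivization F (Fin 3 → F), u ≠ v ∧ u ≠ w ∧ v ≠ w ∧
    OnCurve W u ∧ OnCurve W v ∧ OnCurve W w ∧ OnHyp l u ∧ OnHyp l v ∧ OnHyp l w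


section Plane
open Configuration Finset
open scoped Classical

variable {P L : Type*} [Membership P L] [ProjectivePlane P L] [Fintype P] [Fintype L]

/-- The incidence number of a point and a line, as an integer. -/
noncomputable def inc (p : P) (l : L) : ℤ := if p ∈ l then 1 else 0

/-- The number of points of a finite set on a line, as an integer. -/
noncomputable def hits (S : Finset P) (l : L) : ℤ := ∑ p ∈ S, inc p l

lemma hits_def (S : Finset P) (l : L) : hits S l = ∑ p ∈ S, inc p l := rfl

lemma inc_mul_self (p : P) (l : L) : inc p l * inc p l = inc p l := by
  unfold inc; split_ifs <;> simp

lemma inc_nonneg (p : P) (l : L) : 0 ≤ inc p l := by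
  unfold inc; split_ifs <;> simp

lemma hits_nonneg (S : Finset P) (l : L) : 0 ≤ hits S l :=
  sum_nonneg fun p _ => inc_nonneg p l

lemma hits_eq_card (S : Finset P) (l : L) : hits S l = #{p ∈ S | p ∈ l} := by
  simp [hits, inc]

lemma sum_inc (p : P) : ∑ l : L, inc p l = ProjectivePlane.order P L + 1 := by
  have h := ProjectivePlane.lineCount_eq L p
  rw [lineCount, Nat.card_eq_fintype_card, Fintype.card_subtype] at h
  simp only [inc, sum_boole]
  rw [h]; push_cast; rfl

lemma sum_inc_mul_inc {p p' : P} (h : p ≠ p') : ∑ l : L, inc p l * inc p' l = 1 := by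
  obtain ⟨l₀, ⟨h1, h2⟩, h3⟩ := HasLines.existsUnique_line P L p p' h
  rw [sum_eq_single l₀]
  · simp [inc, h1, h2]
  · intro l _ hl
    unfold inc
    split_ifs with a b <;> simp
    exact hl (h3 l ⟨a, b⟩)
  · simp

lemma sum_hits (S : Finset P) :
    ∑ l : L, hits S l = #S * (ProjectivePlane.order P L + 1) := by
  unfold hits
  rw [sum_comm]
  simp [sum_inc]

lemma sum_hits_sq (S : Finset P) :
    ∑ l : L, hits S l ^ 2 = #S * (#S + ProjectivePlane.order P L) := by
  have h1 : ∀ l : L, hits S l ^ 2 = ∑ p ∈ S, ∑ p' ∈ S, inc p l * inc p' l := by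
    intro l; rw [sq, hits, sum_mul_sum]
  simp_rw [h1]
  rw [sum_comm]
  have h2 : ∀ p ∈ S, ∑ l : L, ∑ p' ∈ S, inc p l * inc p' l
      = #S + ProjectivePlane.order P L := by
    intro p hp
    rw [sum_comm, ← add_sum_erase _ _ hp]
    simp_rw [inc_mul_self]
    rw [sum_inc, sum_congr rfl fun p' hp' => sum_inc_mul_inc (ne_of_mem_erase hp').symm]
    have : 0 < #S := card_pos.2 ⟨p, hp⟩
    simp [card_erase_of_mem hp, Nat.cast_sub this]
    ring
  rw [sum_congr rfl h2]
  simp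

/-- The number of points of `S` on `l`, but zero for the line `l₀`. -/
noncomputable def hitsOff (l₀ : L) (S : Finset P) (l : L) : ℤ := if l = l₀ then 0 else hits S l

lemma hitsOff_nonneg (l₀ : L) (S : Finset P) (l : L) : 0 ≤ hitsOff l₀ S l := by
  unfold hitsOff; split_ifs
  · rfl
  · exact hits_nonneg S l

lemma hitsOff_le_one {l₀ : L} {S : Finset P} (hS : ∀ p ∈ S, p ∈ l₀) (l : L) :
    hitsOff l₀ S l ≤ 1 := by
  unfold hitsOff
  split_ifs with h
  · simp
  · rw [hits_eq_card]
    have : #{p ∈ S | p ∈ l} ≤ 1 := by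
      rw [card_le_one]
      intro a ha b hb
      simp only [mem_filter] at ha hb
      exact (Nondegenerate.eq_or_eq (hS a ha.1) (hS b hb.1) ha.2 hb.2).resolve_right
        (fun e => h e.symm)
    exact_mod_cast this

lemma hitsOff_sq {l₀ : L} {S : Finset P} (hS : ∀ p ∈ S, p ∈ l₀) (l : L) :
    hitsOff l₀ S l ^ 2 = hitsOff l₀ S l := by
  have h1 := hitsOff_nonneg l₀ S l
  have h2 := hitsOff_le_one hS l
  have : hitsOff l₀ S l = 0 ∨ hitsOff l₀ S l = 1 := by omega
  rcases this with h | h <;> simp [h]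

lemma hits_of_subset {l₀ : L} {S : Finset P} (hS : ∀ p ∈ S, p ∈ l₀) : hits S l₀ = #S := by
  rw [hits_eq_card, filter_true_of_mem hS]

lemma hitsOff_eq (l₀ : L) (S : Finset P) (l : L) :
    hitsOff l₀ S l = hits S l - if l = l₀ then hits S l₀ else 0 := by
  unfold hitsOff; split_ifs with h
  · simp [h]
  · simp

lemma sum_hitsOff {l₀ : L} {S : Finset P} (hS : ∀ p ∈ S, p ∈ l₀) :
    ∑ l : L, hitsOff l₀ S l = #S * ProjectivePlane.order P L := by
  simp_rw [hitsOff_eq, sum_sub_distrib, sum_hits]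
  simp [hits_of_subset hS]; ring

lemma sum_hitsOff_mul_hits {l₀ : L} {S T : Finset P} (hS : ∀ p ∈ S, p ∈ l₀)
    (hST : Disjoint S T) :
    ∑ l : L, hitsOff l₀ S l * hits T l = #S * (#T - hits T l₀) := by
  simp_rw [hitsOff_eq, sub_mul, sum_sub_distrib]
  have h1 : ∑ l : L, hits S l * hits T l = #S * #T := by
    simp_rw [hits, sum_mul_sum]
    rw [sum_comm]
    have : ∀ p ∈ S, ∑ l : L, ∑ p' ∈ T, inc p l * inc p' l = #T := by
      intro p hp
      rw [sum_comm, sum_congr rfl fun p' hp' =>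
        sum_inc_mul_inc (disjoint_iff_ne.1 hST p hp p' hp')]
      simp
    rw [sum_congr rfl this]; simp
  rw [h1]
  simp [hits_of_subset hS]; ring

lemma sum_hitsOff_mul_hitsOff {l₁ l₂ : L} (hl : l₁ ≠ l₂) {S T : Finset P}
    (hS : ∀ p ∈ S, p ∈ l₁) (hT : ∀ p ∈ T, p ∈ l₂) :
    ∑ l : L, hitsOff l₁ S l * hitsOff l₂ T l
      ≤ #S * #T + max 0 ((ProjectivePlane.order P L : ℤ) - #S - #T) := by
  have key : ∀ S' T' : Finset P, (∀ p ∈ S', p ∈ l₁) → (∀ p ∈ T', p ∈ l₂) → Disjoint S' T' →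
      ∑ l : L, hitsOff l₁ S' l * hitsOff l₂ T' l ≤ #S' * #T' := by
    intro S' T' hS' hT' hd
    calc _ ≤ ∑ l : L, hitsOff l₁ S' l * hits T' l := by
          refine sum_le_sum fun l _ => mul_le_mul_of_nonneg_left ?_ (hitsOff_nonneg _ _ _)
          unfold hitsOff; split_ifs
          · exact hits_nonneg _ _
          · rfl
      _ = #S' * (#T' - hits T' l₁) := sum_hitsOff_mul_hits hS' hd
      _ ≤ _ := by
          have := hits_nonneg T' l₁
          have : (0:ℤ) ≤ #S' := by positivity
          nlinarith
  by_cases hd : Disjoint S T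
  · have := key S T hS hT hd
    have := le_max_left 0 ((ProjectivePlane.order P L : ℤ) - #S - #T)
    linarith
  · rw [not_disjoint_iff] at hd
    obtain ⟨p, hpS, hpT⟩ := hd
    have e : ∀ l : L, hitsOff l₁ S l * hitsOff l₂ T l
        ≤ hitsOff l₁ (S.erase p) l * hitsOff l₂ (T.erase p) l +
          (inc p l - (if l = l₁ then 1 else 0) - (if l = l₂ then 1 else 0)) := by
      intro l
      have a1 : hits S l = inc p l + hits (S.erase p) l := (add_sum_erase _ _ hpS).symm
      have a2 : hits T l = inc p l + hits (T.erase p) l := (add_sum_erase _ _ hpT).symm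
      have b1 := hitsOff_le_one hS l
      have b2 := hitsOff_le_one hT l
      have c1 := hits_nonneg (S.erase p) l
      have c2 := hits_nonneg (T.erase p) l
      have i0 : inc p l = 0 ∨ inc p l = 1 := by unfold inc; split_ifs <;> simp
      unfold hitsOff at *
      by_cases h1 : l = l₁
      · subst h1
        simp [hl, inc, hS p hpS]
      · by_cases h2 : l = l₂
        · subst h2
          simp [hl.symm, inc, hT p hpT]
        · simp only [h1, h2, if_false] at *
          rcases i0 with i | i
          · rw [a1, a2, i]; simp
          · have d1 : hits (S.erase p) l = 0 := by omega
            have d2 : hits (T.erase p) l = 0 := by omega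
            rw [a1, a2, i, d1, d2]; simp
    have hdis : Disjoint (S.erase p) (T.erase p) := by
      rw [disjoint_left]
      intro x hx hx'
      exact hl ((Nondegenerate.eq_or_eq (hS p hpS) (hS x (mem_of_mem_erase hx)) (hT p hpT)
        (hT x (mem_of_mem_erase hx'))).resolve_left (ne_of_mem_erase hx).symm)
    have k := key (S.erase p) (T.erase p) (fun x hx => hS x (mem_of_mem_erase hx))
      (fun x hx => hT x (mem_of_mem_erase hx)) hdis
    have s := sum_le_sum fun l (_ : l ∈ (univ : Finset L)) => e l
    rw [sum_add_distrib, sum_sub_distrib, sum_sub_distrib, sum_inc] at s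
    simp only [sum_ite_eq', mem_univ, if_true] at s
    have hS0 : 0 < #S := card_pos.2 ⟨p, hpS⟩
    have hT0 : 0 < #T := card_pos.2 ⟨p, hpT⟩
    rw [card_erase_of_mem hpS, card_erase_of_mem hpT, Nat.cast_sub hS0, Nat.cast_sub hT0] at k
    have := le_max_right 0 ((ProjectivePlane.order P L : ℤ) - #S - #T)
    push_cast at k
    linarith

/-- The numerical inequality behind the second moment bound. -/
lemma moment_numeric {q m n V S2 SXK : ℤ} (hq : 121 ≤ q) (hm0 : 0 ≤ m)
    (hmq : 5 * q ≤ 11 * m + 132) (hV : m * (4 * m + 4 - q) - 28 ≤ V)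
    (hsq : 0 ≤ (q ^ 2 + q + 1) ^ 2 * S2 - 2 * (q ^ 2 + q + 1) * (12 * (m * q)) * (12 * (m * q))
      + (q ^ 2 + q + 1) * (12 * (m * q)) ^ 2 + 24 * (q ^ 2 + q + 1) * V * SXK
      - 24 * (12 * (m * q)) * V * (n * (n + q) - 3 * (n * (q + 1)) + (q ^ 2 + q + 1))
      + (q ^ 2 + q + 1) * (144 * V ^ 2))
    (hS2 : S2 ≤ 12 * (m * q) + 132 * (m * m + max 0 (q - m - m)))
    (hSXK : SXK ≤ -(12 * V)) : False := by
  obtain ⟨s, rfl⟩ : ∃ s, q = 121 + s := ⟨q - 121, by ring⟩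
  have hs : 0 ≤ s := by linarith
  obtain ⟨u, hu⟩ : ∃ u, 11 * m = 5 * s + 473 + u := ⟨11 * m - 5 * s - 473, by ring⟩
  have hu0 : 0 ≤ u := by linarith
  have hm : 0 < m := by linarith
  set q := 121 + s with hqs
  set V₀ := m * (4 * m + 4 - q) - 28 with hV₀
  have hVm : 2 * m ≤ V₀ := by nlinarith
  have hVpos : 0 < V := by linarith
  set v := q ^ 2 + q + 1 with hv
  have hvpos : 0 < v := by positivity
  have h1 : 24 * v * V * SXK ≤ 24 * v * V * (-(12 * V)) :=
    mul_le_mul_of_nonneg_left hSXK (by positivity)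
  have h2 : -(2 * q + 2) ≤ n * (n + q) - 3 * (n * (q + 1)) + v := by
    nlinarith [sq_nonneg (2 * (n - q) - 3)]
  have h3 : 24 * (12 * (m * q)) * V * (-(2 * q + 2)) ≤
      24 * (12 * (m * q)) * V * (n * (n + q) - 3 * (n * (q + 1)) + v) :=
    mul_le_mul_of_nonneg_left h2 (by positivity)
  have h4 : 576 * m * V * (q * (q + 1)) ≤ 576 * m * V * v :=
    mul_le_mul_of_nonneg_left (by rw [hv]; nlinarith) (by positivity)
  have h5 : v ^ 2 * S2 ≤ v ^ 2 * (12 * (m * q) + 132 * (m * m + max 0 (q - m - m))) :=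
    mul_le_mul_of_nonneg_left hS2 (by positivity)
  have h6 : 0 ≤ v * (v * (m * q + 11 * (m * m + max 0 (q - m - m))) - 12 * (m * q) ^ 2
      - 12 * V ^ 2 + 48 * m * V) := by nlinarith
  have h7 := nonneg_of_mul_nonneg_right h6 hvpos
  have h8 : 12 * V₀ ^ 2 - 48 * m * V₀ ≤ 12 * V ^ 2 - 48 * m * V := by nlinarith
  have h9 : v * (m * q + 11 * (m * m + max 0 (q - m - m))) - 12 * (m * q) ^ 2
      - 12 * V₀ ^ 2 + 48 * m * V₀ < 0 := by
    have hs' : (0 : ℚ) ≤ s := by exact_mod_cast hs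
    have hu' : (0 : ℚ) ≤ u := by exact_mod_cast hu0
    have hm' : (m : ℚ) = (5 * s + 473 + u) / 11 := by
      field_simp; exact_mod_cast (by linarith)
    have mono : ∀ i j : ℕ, (0 : ℚ) ≤ (s : ℚ) ^ i * (u : ℚ) ^ j := fun i j => by positivity
    have key : ∀ D : ℤ, D = 0 ∨ D = q - m - m →
        v * (m * q + 11 * (m * m + D)) - 12 * (m * q) ^ 2 - 12 * V₀ ^ 2 + 48 * m * V₀ < 0 := by
      rintro D (rfl | rfl) <;> qify <;> simp only [hv, hV₀, hqs] <;> push_cast <;> rw [hm'] <;>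
      linarith [mono 1 0, mono 0 1, mono 2 0, mono 1 1, mono 0 2, mono 3 0, mono 2 1, mono 1 2,
        mono 0 3, mono 4 0, mono 3 1, mono 2 2, mono 1 3, mono 0 4]
    exact key _ (max_choice _ _)
  linarith

/-- A second moment bound in a projective plane: twelve lines cannot all carry many points that
lie on few trisecants of a cubic-like point set. -/
theorem trisecant_moment (E : Finset P) (hr : ∀ l : L, hits E l ≤ 3)
    (h2 : #{l : L | hits E l = 2} ≤ #E) (ℓ : Fin 12 → L) (hℓ : Function.Injective ℓ)
    (A : Fin 12 → Finset P) (hA : ∀ i, ∀ p ∈ A i, p ∈ ℓ i) (hAE : ∀ i, Disjoint (A i) E) (m : ℕ)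
    (hm : ∀ i, #(A i) = m)
    (h3 : ∀ i, ∀ p ∈ A i, #{l : L | p ∈ l ∧ hits E l = 3} ≤ 2)
    (hmn1 : 2 * m + 13 ≤ #E) (hmn2 : #E ≤ 2 * m + 14)
    (hq : 121 ≤ ProjectivePlane.order P L)
    (hmq : 5 * ProjectivePlane.order P L ≤ 11 * m + 132) : False := by
  set q : ℤ := (ProjectivePlane.order P L : ℤ) with hqdef
  set n : ℤ := (#E : ℤ) with hndef
  set K : L → ℤ := fun l => hits E l ^ 2 - 3 * hits E l + 1 with hK
  set X : L → ℤ := fun l => ∑ i, hitsOff (ℓ i) (A i) l with hX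
  have hv : (Fintype.card L : ℤ) = q ^ 2 + q + 1 := by
    rw [ProjectivePlane.card_lines P L]; push_cast; rfl
  have rcase : ∀ l : L, hits E l = 0 ∨ hits E l = 1 ∨ hits E l = 2 ∨ hits E l = 3 := by
    intro l; have := hr l; have := hits_nonneg E l; omega
  have K2 : ∀ l, K l ^ 2 = 1 := by
    intro l; rcases rcase l with h | h | h | h <;> simp [hK, h]
  have Kf : ∀ l, K l = 1 - 2 * hits E l + 2 * (if hits E l = 2 then 1 else 0)
      + 6 * (if hits E l = 3 then 1 else 0) := by
    intro l; rcases rcase l with h | h | h | h <;> simp [hK, h]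
  have SK : ∑ l, K l = n * (n + q) - 3 * (n * (q + 1)) + (q ^ 2 + q + 1) := by
    simp only [hK, sum_add_distrib, sum_sub_distrib, ← mul_sum, sum_hits, sum_hits_sq]
    simp [hv, ← hqdef, ← hndef]
  have SX : ∑ l, X l = 12 * (m * q) := by
    simp only [hX]
    rw [sum_comm]
    simp_rw [sum_hitsOff (hA _), hm]
    simp [← hqdef]
  have SX2 : ∑ l, X l ^ 2 ≤ 12 * (m * q) + 132 * (m * m + max 0 (q - m - m)) := by
    have : ∀ l, X l ^ 2 = ∑ i, ∑ j, hitsOff (ℓ i) (A i) l * hitsOff (ℓ j) (A j) l := by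
      intro l; simp only [hX]; rw [sq, sum_mul_sum]
    simp_rw [this]
    rw [sum_comm]
    have h1 : ∀ i : Fin 12, ∑ l, ∑ j, hitsOff (ℓ i) (A i) l * hitsOff (ℓ j) (A j) l
        ≤ m * q + 11 * (m * m + max 0 (q - m - m)) := by
      intro i
      rw [sum_comm, ← add_sum_erase _ _ (mem_univ i)]
      refine add_le_add ?_ ?_
      · simp_rw [← sq, hitsOff_sq (hA i)]
        rw [sum_hitsOff (hA i), hm]
      · have h2 := sum_le_sum fun j (hj : j ∈ univ.erase i) =>
          sum_hitsOff_mul_hitsOff (fun e => ne_of_mem_erase hj (hℓ e).symm) (hA i) (hA j)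
        refine h2.trans ?_
        simp_rw [hm]
        simp [card_erase_of_mem, ← hqdef]
    refine (sum_le_sum fun i _ => h1 i).trans ?_
    simp
    linarith
  have SXK : ∑ l, X l * K l ≤ - (12 * (m * (2 * n - q - 18) - 2 * n)) := by
    have h1 : ∀ i : Fin 12, ∑ l, hitsOff (ℓ i) (A i) l * K l
        ≤ - (m * (2 * n - q - 18) - 2 * n) := by
      intro i
      have e2 : ∑ l, hitsOff (ℓ i) (A i) l * (if hits E l = 2 then 1 else 0) ≤ n := by
        calc _ ≤ ∑ l : L, if hits E l = 2 then (1 : ℤ) else 0 := by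
              refine sum_le_sum fun l _ => ?_
              have := hitsOff_le_one (hA i) l
              split_ifs <;> simp [this]
          _ ≤ n := by
              rw [sum_boole, hndef]; exact_mod_cast h2
      have e3 : ∑ l, hitsOff (ℓ i) (A i) l * (if hits E l = 3 then 1 else 0) ≤ m * 2 := by
        calc _ ≤ ∑ l : L, hits (A i) l * if hits E l = 3 then (1 : ℤ) else 0 := by
              refine sum_le_sum fun l _ => mul_le_mul_of_nonneg_right ?_ (by split_ifs <;> simp)
              unfold hitsOff; split_ifs
              · exact hits_nonneg _ _
              · rfl
          _ = ∑ p ∈ A i, ((#{l : L | p ∈ l ∧ hits E l = 3} : ℕ) : ℤ) := by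
              simp_rw [hits_def (A i), sum_mul]
              rw [sum_comm]
              refine sum_congr rfl fun p _ => ?_
              rw [natCast_card_filter]
              refine sum_congr rfl fun l _ => ?_
              unfold inc
              split_ifs <;> simp_all
          _ ≤ ∑ p ∈ A i, 2 := sum_le_sum fun p hp => by exact_mod_cast h3 i p hp
          _ = m * 2 := by simp [hm]
      have e4 := sum_hitsOff_mul_hits (hA i) (hAE i)
      rw [hm] at e4
      have e5 := sum_hitsOff (hA i)
      rw [hm] at e5
      have e6 : ∑ l, hitsOff (ℓ i) (A i) l * K l
          = ∑ l, hitsOff (ℓ i) (A i) l - 2 * ∑ l, hitsOff (ℓ i) (A i) l * hits E l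
            + 2 * ∑ l, hitsOff (ℓ i) (A i) l * (if hits E l = 2 then 1 else 0)
            + 6 * ∑ l, hitsOff (ℓ i) (A i) l * (if hits E l = 3 then 1 else 0) := by
        simp_rw [Kf, mul_sum]
        rw [← sum_sub_distrib, ← sum_add_distrib, ← sum_add_distrib]
        exact sum_congr rfl fun l _ => by ring
      have e7 := mul_le_mul_of_nonneg_left (hr (ℓ i)) (Int.natCast_nonneg m)
      rw [e6, e4, e5]
      linarith
    simp only [hX, sum_mul]
    rw [sum_comm]
    refine (sum_le_sum fun i _ => h1 i).trans (le_of_eq ?_)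
    simp
    ring
  have hq' : (121 : ℤ) ≤ q := by rw [hqdef]; exact_mod_cast hq
  have hmq' : 5 * q ≤ 11 * m + 132 := by rw [hqdef]; exact_mod_cast hmq
  have hn1 : 2 * (m : ℤ) + 13 ≤ n := by rw [hndef]; exact_mod_cast hmn1
  have hn2 : n ≤ 2 * (m : ℤ) + 14 := by rw [hndef]; exact_mod_cast hmn2
  set v : ℤ := q ^ 2 + q + 1 with hvdef
  set S : ℤ := 12 * (m * q) with hSdef
  set V : ℤ := m * (2 * n - q - 18) - 2 * n with hVdef
  have hsq : 0 ≤ ∑ l, (v * X l - S + 12 * V * K l) ^ 2 := sum_nonneg fun l _ => sq_nonneg _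
  have hexp : ∑ l, (v * X l - S + 12 * V * K l) ^ 2 = v ^ 2 * ∑ l, X l ^ 2 - 2 * v * S * ∑ l, X l
      + v * S ^ 2 + 24 * v * V * ∑ l, X l * K l - 24 * S * V * ∑ l, K l + v * (144 * V ^ 2) := by
    have : ∀ l, (v * X l - S + 12 * V * K l) ^ 2 = v ^ 2 * X l ^ 2 - 2 * v * S * X l
      + S ^ 2 + 24 * v * V * (X l * K l) - 24 * S * V * K l + 144 * V ^ 2 := by
      intro l
      linear_combination 144 * V ^ 2 * K2 l
    simp_rw [this, sum_add_distrib, sum_sub_distrib, sum_add_distrib, sum_sub_distrib, ← mul_sum]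
    simp only [sum_const, card_univ, nsmul_eq_mul, hv]
    ring
  rw [hexp, SX, SK] at hsq
  clear hexp
  have hV : (m : ℤ) * (4 * m + 4 - q) - 28 ≤ V := by
    rw [hVdef]; nlinarith
  exact moment_numeric hq' (Int.natCast_nonneg m) hmq' hV hsq SX2 SXK
end Plane

section Zeros
open Polynomial Finset
variable {F : Type} [Field F] [Fintype F] [DecidableEq F]

lemma norm_ne_zero {A B g : F[X]} (hg : Odd g.natDegree) (h : A ≠ 0 ∨ B ≠ 0) :
    A ^ 2 - g * B ^ 2 ≠ 0 := by
  intro h0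
  have e : A ^ 2 = g * B ^ 2 := sub_eq_zero.1 h0
  have hg0 : g ≠ 0 := by rintro rfl; simp at hg
  have hB : B ≠ 0 := by
    rintro rfl
    simp at e h
    exact h e
  have := congrArg natDegree e
  rw [natDegree_mul hg0 (pow_ne_zero 2 hB), natDegree_pow, natDegree_pow] at this
  obtain ⟨k, hk⟩ := hg
  omega

/-- A function `A + B y` on the curve `y ^ 2 = g(x)` has at most as many zeros as the degree of its
norm. -/
lemma card_zeros_le {A B g : F[X]} (hg : Odd g.natDegree) (h : A ≠ 0 ∨ B ≠ 0) :
    #{p : F × F | p.2 ^ 2 = g.eval p.1 ∧ A.eval p.1 + B.eval p.1 * p.2 = 0}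
      ≤ (A ^ 2 - g * B ^ 2).natDegree := by
  set N := A ^ 2 - g * B ^ 2 with hN
  have hN0 : N ≠ 0 := norm_ne_zero hg h
  set Z : Finset (F × F) := {p : F × F | p.2 ^ 2 = g.eval p.1 ∧ A.eval p.1 + B.eval p.1 * p.2 = 0}
    with hZ
  have hmap : ∀ p ∈ Z, p.1 ∈ N.roots.toFinset := by
    intro p hp
    simp only [hZ, mem_filter, mem_univ, true_and] at hp
    rw [Multiset.mem_toFinset, mem_roots hN0, IsRoot, hN]
    simp only [eval_sub, eval_pow, eval_mul]
    linear_combination (A.eval p.1 - B.eval p.1 * p.2) * hp.2 + B.eval p.1 ^ 2 * hp.1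
  rw [card_eq_sum_card_fiberwise hmap]
  calc _ ≤ ∑ x ∈ N.roots.toFinset, N.roots.count x := by
        refine sum_le_sum fun x hx => ?_
        rw [count_roots]
        have hx1 : 1 ≤ N.rootMultiplicity x := by
          rw [Multiset.mem_toFinset, mem_roots hN0] at hx
          exact (rootMultiplicity_pos hN0).2 hx
        by_cases hc : #{p ∈ Z | p.1 = x} ≤ 1
        · omega
        · push Not at hc
          obtain ⟨p, hp, p', hp', hne⟩ := one_lt_card.1 hc
          simp only [hZ, mem_filter, mem_univ, true_and] at hp hp'
          obtain ⟨⟨h1, h2⟩, rfl⟩ := hp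
          obtain ⟨⟨h3, h4⟩, h5⟩ := hp'
          rw [h5] at h3 h4
          have hy : p.2 - p'.2 ≠ 0 := by
            intro e
            exact hne (Prod.ext h5.symm (sub_eq_zero.1 e))
          have hB : B.eval p.1 = 0 := by
            have : B.eval p.1 * (p.2 - p'.2) = 0 := by linear_combination h2 - h4
            exact (mul_eq_zero.1 this).resolve_right hy
          have hA : A.eval p.1 = 0 := by simpa [hB] using h2
          have h2N : 2 ≤ N.rootMultiplicity p.1 := by
            rw [le_rootMultiplicity_iff hN0]
            exact dvd_sub (pow_dvd_pow_of_dvd (dvd_iff_isRoot.2 hA) 2)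
              (dvd_mul_of_dvd_right (pow_dvd_pow_of_dvd (dvd_iff_isRoot.2 hB) 2) _)
          refine le_trans ?_ h2N
          have hsub : ({r ∈ Z | r.1 = p.1} : Finset (F × F)) ⊆ {(p.1, p.2), (p.1, -p.2)} := by
            intro r hr
            simp only [hZ, mem_filter, mem_univ, true_and] at hr
            obtain ⟨⟨h6, -⟩, h7⟩ := hr
            rw [h7, ← h1] at h6
            rcases sq_eq_sq_iff_eq_or_eq_neg.1 h6 with h8 | h8
            · simp [← h7, ← h8]
            · simp [← h7, ← h8]
          exact (card_le_card hsub).trans card_le_two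
    _ = Multiset.card N.roots := Multiset.toFinset_sum_count_eq _
    _ ≤ N.natDegree := card_roots' N
end Zeros

section Curve
open WeierstrassCurve
variable {K : Type*} [Field K] [DecidableEq K]

/-- The curve `y² = x³ + b₂ x² + b₄ x + b₆`. -/
abbrev shortCurve (b₂ b₄ b₆ : K) : WeierstrassCurve K := ⟨0, b₂, 0, b₄, b₆⟩

/-- The discriminant of the cubic `x³ + b₂ x² + b₄ x + b₆`. -/
def cubicDisc (b₂ b₄ b₆ : K) : K :=
  b₂ ^ 2 * b₄ ^ 2 - 4 * b₄ ^ 3 - 4 * b₂ ^ 3 * b₆ - 27 * b₆ ^ 2 + 18 * b₂ * b₄ * b₆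

lemma shortCurve_Δ (b₂ b₄ b₆ : K) : (shortCurve b₂ b₄ b₆).Δ = 16 * cubicDisc b₂ b₄ b₆ := by
  simp only [WeierstrassCurve.Δ, WeierstrassCurve.b₂, WeierstrassCurve.b₄, WeierstrassCurve.b₆,
    WeierstrassCurve.b₈, cubicDisc]
  ring

variable {b₂ b₄ b₆ : K}

lemma shortCurve_equation {x y : K} :
    (shortCurve b₂ b₄ b₆).toAffine.Equation x y ↔ y ^ 2 = x ^ 3 + b₂ * x ^ 2 + b₄ * x + b₆ := by
  rw [Affine.equation_iff]
  simp

lemma shortCurve_nonsingular (h2 : (2 : K) ≠ 0) (hd : cubicDisc b₂ b₄ b₆ ≠ 0) {x y : K} :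
    (shortCurve b₂ b₄ b₆).toAffine.Nonsingular x y ↔
      y ^ 2 = x ^ 3 + b₂ * x ^ 2 + b₄ * x + b₆ := by
  rw [← shortCurve_equation]
  refine (Affine.equation_iff_nonsingular_of_Δ_ne_zero ?_).symm
  rw [shortCurve_Δ]
  refine mul_ne_zero ?_ hd
  have : (16 : K) = 2 ^ 4 := by norm_num
  rw [this]
  exact pow_ne_zero 4 h2

lemma short_neg {x y : K} (h : (shortCurve b₂ b₄ b₆).toAffine.Nonsingular x y) :
    ∃ h', -(Affine.Point.some x y h) = Affine.Point.some x (-y) h' := by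
  have e : (shortCurve b₂ b₄ b₆).toAffine.negY x y = -y := by simp [Affine.negY]
  rw [Affine.Point.neg_some]
  have h1 : (shortCurve b₂ b₄ b₆).toAffine.Nonsingular x (-y) := e ▸ (Affine.nonsingular_neg x y).2 h
  exact ⟨h1, by simp only [e]⟩

lemma short_add {x₁ y₁ x₂ y₂ : K} (h₁ : (shortCurve b₂ b₄ b₆).toAffine.Nonsingular x₁ y₁)
    (h₂ : (shortCurve b₂ b₄ b₆).toAffine.Nonsingular x₂ y₂) (hx : x₁ ≠ x₂) (l x₃ y₃ : K)
    (hl : l = (y₁ - y₂) / (x₁ - x₂)) (hx₃ : x₃ = l ^ 2 - b₂ - x₁ - x₂)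
    (hy₃ : y₃ = -(l * (x₃ - x₁) + y₁)) :
    ∃ h', Affine.Point.some x₁ y₁ h₁ + Affine.Point.some x₂ y₂ h₂ =
      Affine.Point.some x₃ y₃ h' := by
  rw [Affine.Point.add_of_X_ne hx]
  have ex : (shortCurve b₂ b₄ b₆).toAffine.addX x₁ x₂
      ((shortCurve b₂ b₄ b₆).toAffine.slope x₁ x₂ y₁ y₂) = x₃ := by
    rw [Affine.slope_of_X_ne hx, ← hl]; simp [Affine.addX, hx₃]
  have ey : (shortCurve b₂ b₄ b₆).toAffine.addY x₁ x₂ y₁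
      ((shortCurve b₂ b₄ b₆).toAffine.slope x₁ x₂ y₁ y₂) = y₃ := by
    rw [Affine.addY, Affine.negAddY, ex, Affine.slope_of_X_ne hx, ← hl]
    simp [Affine.negY, hy₃]
  have h3 := Affine.nonsingular_add h₁ h₂ (fun hxy => hx hxy.left)
  rw [ex, ey] at h3
  exact ⟨h3, by simp only [ex, ey]⟩

lemma short_double (h2 : (2 : K) ≠ 0) {x₁ y₁ : K}
    (h₁ : (shortCurve b₂ b₄ b₆).toAffine.Nonsingular x₁ y₁) (hy : y₁ ≠ 0) (l x₃ y₃ : K)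
    (hl : l = (3 * x₁ ^ 2 + 2 * b₂ * x₁ + b₄) / (2 * y₁)) (hx₃ : x₃ = l ^ 2 - b₂ - x₁ - x₁)
    (hy₃ : y₃ = -(l * (x₃ - x₁) + y₁)) :
    ∃ h', Affine.Point.some x₁ y₁ h₁ + Affine.Point.some x₁ y₁ h₁ =
      Affine.Point.some x₃ y₃ h' := by
  have hne : y₁ ≠ (shortCurve b₂ b₄ b₆).toAffine.negY x₁ y₁ := by
    simp only [Affine.negY]
    intro e
    exact mul_ne_zero h2 hy (by linear_combination e)
  rw [Affine.Point.add_self_of_Y_ne hne]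
  have es : (shortCurve b₂ b₄ b₆).toAffine.slope x₁ x₁ y₁ y₁ = l := by
    rw [Affine.slope_of_Y_ne rfl hne, hl]; simp [Affine.negY]; ring
  have ex : (shortCurve b₂ b₄ b₆).toAffine.addX x₁ x₁
      ((shortCurve b₂ b₄ b₆).toAffine.slope x₁ x₁ y₁ y₁) = x₃ := by
    rw [es]; simp [Affine.addX, hx₃]
  have ey : (shortCurve b₂ b₄ b₆).toAffine.addY x₁ x₁ y₁
      ((shortCurve b₂ b₄ b₆).toAffine.slope x₁ x₁ y₁ y₁) = y₃ := by
    rw [Affine.addY, Affine.negAddY, ex, es]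
    simp [Affine.negY, hy₃]
  have h3 := Affine.nonsingular_add h₁ h₁ (fun hxy => hne hxy.right)
  rw [ex, ey] at h3
  exact ⟨h3, by simp only [ex, ey]⟩

lemma short_add_neg {x y₁ y₂ : K} (h₁ : (shortCurve b₂ b₄ b₆).toAffine.Nonsingular x y₁)
    (h₂ : (shortCurve b₂ b₄ b₆).toAffine.Nonsingular x y₂) (hy : y₁ = -y₂) :
    Affine.Point.some x y₁ h₁ + Affine.Point.some x y₂ h₂ = 0 :=
  Affine.Point.add_of_Y_eq rfl (by simp [Affine.negY, hy])

lemma short_eq_of_X_eq {x y₁ y₂ : K} (h₁ : (shortCurve b₂ b₄ b₆).toAffine.Nonsingular x y₁)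
    (h₂ : (shortCurve b₂ b₄ b₆).toAffine.Nonsingular x y₂) : y₁ = y₂ ∨ y₁ = -y₂ := by
  have e1 := shortCurve_equation.1 h₁.1
  have e2 := shortCurve_equation.1 h₂.1
  exact sq_eq_sq_iff_eq_or_eq_neg.1 (e1.trans e2.symm)

/-- The common denominator of the sum and the product of `x(P + Q)` and `x(P - Q)`, where
`x(P) = X / Z` and `x(Q) = t`. -/
def symZ {R : Type*} [CommRing R] (t X Z : R) : R := (X - t * Z) ^ 2

/-- The numerator of the sum of `x(P + Q)` and `x(P - Q)`. -/
def symXZ {R : Type*} [CommRing R] (b₂ b₄ b₆ t X Z : R) : R :=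
  2 * ((X * t + b₄ * Z) * (X + t * Z) + 2 * b₂ * X * t * Z + 2 * b₆ * Z ^ 2)

/-- The numerator of the product of `x(P + Q)` and `x(P - Q)`. -/
def symX {R : Type*} [CommRing R] (b₂ b₄ b₆ t X Z : R) : R :=
  (t * X - b₄ * Z) ^ 2 - 4 * b₆ * Z * (X + (t + b₂) * Z)

open Affine.Point in
/-- The `x`-coordinates of `P + Q` and `P - Q` as symmetric functions of those of `P` and `Q`. -/
lemma sym_add_sub (h2 : (2 : K) ≠ 0) (P : (shortCurve b₂ b₄ b₆).toAffine.Point) {t u : K}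
    (hQ : (shortCurve b₂ b₄ b₆).toAffine.Nonsingular t u) (hu : u ≠ 0) :
    ∃ κ : K, κ ≠ 0 ∧
      (P - some t u hQ).xRep 1 * (P + some t u hQ).xRep 1 = κ * symZ t (P.xRep 0) (P.xRep 1) ∧
      (P - some t u hQ).xRep 0 * (P + some t u hQ).xRep 1 +
        (P + some t u hQ).xRep 0 * (P - some t u hQ).xRep 1
          = κ * symXZ b₂ b₄ b₆ t (P.xRep 0) (P.xRep 1) ∧
      (P - some t u hQ).xRep 0 * (P + some t u hQ).xRep 0
        = κ * symX b₂ b₄ b₆ t (P.xRep 0) (P.xRep 1) := by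
  have eQ := shortCurve_equation.1 hQ.1
  have h4 : (4 : K) ≠ 0 := by
    have : (4 : K) = 2 * 2 := by norm_num
    rw [this]; exact mul_ne_zero h2 h2
  obtain ⟨hQ', enQ⟩ := short_neg hQ
  set Q : (shortCurve b₂ b₄ b₆).toAffine.Point := some t u hQ with hQdef
  have dbl : ∃ x₃ y₃ h', Q + Q = some x₃ y₃ h' ∧ symX b₂ b₄ b₆ t t 1 = 4 * u ^ 2 * x₃ := by
    obtain ⟨h', e⟩ := short_double h2 hQ hu _ _ _ rfl rfl rfl
    refine ⟨_, _, h', e, ?_⟩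
    simp only [symX]
    field_simp
    linear_combination (32 * t + 16 * b₂) * eQ
  have h1 : symXZ b₂ b₄ b₆ t t 1 = 4 * u ^ 2 := by
    simp only [symXZ]; linear_combination -4 * eQ
  have h0 : symZ t t 1 = 0 := by simp [symZ]
  have hu2 : 4 * u ^ 2 ≠ 0 := mul_ne_zero h4 (pow_ne_zero 2 hu)
  obtain ⟨x₃, y₃, h', ed, es⟩ := dbl
  rcases P with _ | ⟨x, y, hP⟩
  · refine ⟨1, one_ne_zero, ?_⟩
    rw [← zero_def, zero_sub, zero_add, xRep_neg, hQdef, xRep_some, xRep_zero]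
    simp [symZ, symXZ, symX]
    refine ⟨by ring, by ring⟩
  · by_cases hx : x = t
    · subst hx
      rcases short_eq_of_X_eq hP hQ with rfl | rfl
      · rw [← hQdef, sub_self, ed, xRep_zero, hQdef, xRep_some, xRep_some]
        refine ⟨(4 * y ^ 2)⁻¹, inv_ne_zero hu2, ?_⟩
        simp [h0, h1, es]
        field_simp
        simp
      · rw [← enQ, neg_add_cancel, sub_eq_add_neg, ← neg_add, ed, xRep_zero, xRep_neg, xRep_neg,
          hQdef, xRep_some, xRep_some]
        refine ⟨(4 * u ^ 2)⁻¹, inv_ne_zero hu2, ?_⟩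
        simp [h0, h1, es]
        field_simp
        simp
    · have eP := shortCurve_equation.1 hP.1
      have hx' : x - t ≠ 0 := sub_ne_zero.2 hx
      obtain ⟨h₁, e₁⟩ := short_add hP hQ hx _ _ _ rfl rfl rfl
      obtain ⟨h₂, e₂⟩ := short_add hP hQ' hx _ _ _ rfl rfl rfl
      rw [sub_eq_add_neg, enQ, e₁, e₂, xRep_some, xRep_some, xRep_some]
      refine ⟨((x - t) ^ 2)⁻¹, inv_ne_zero (pow_ne_zero 2 hx'), ?_, ?_, ?_⟩
      · simp [symZ, hx']
      · simp [symXZ]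
        field_simp
        linear_combination 2 * eP + 2 * eQ
      · simp [symX]
        field_simp
        linear_combination (y ^ 2 + (x ^ 3 + b₂ * x ^ 2 + b₄ * x + b₆) - 2 * u ^ 2
          - 2 * (b₂ + x + t) * (x - t) ^ 2) * eP + (u ^ 2 + (t ^ 3 + b₂ * t ^ 2 + b₄ * t + b₆)
          - 2 * (x ^ 3 + b₂ * x ^ 2 + b₄ * x + b₆) - 2 * (b₂ + x + t) * (x - t) ^ 2) * eQ
end Curve

section Poly
open Polynomial
variable {F : Type} [Field F]

lemma prime_not_dvd_sym (h2 : (2 : F) ≠ 0) {a₂ a₄ a₆ : F} (hd : cubicDisc a₂ a₄ a₆ ≠ 0)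
    {p r π : F[X]} (hpr : IsCoprime p r) (hπ : Prime π) (hA : π ∣ symZ X p r)
    (hB : π ∣ symXZ (C a₂) (C a₄) (C a₆) X p r) (hC : π ∣ symX (C a₂) (C a₄) (C a₆) X p r) :
    False := by
  have h1 : π ∣ p - X * r := hπ.dvd_of_dvd_pow hA
  have hr : ¬ π ∣ r := by
    intro h
    have : π ∣ p := by
      have := dvd_add h1 (dvd_mul_of_dvd_right h X)
      simpa using this
    exact hπ.not_isUnit (hpr.isUnit_of_dvd' this h)
  have hB' : π ∣ C 4 * (X ^ 3 + C a₂ * X ^ 2 + C a₄ * X + C a₆) * r ^ 2 := by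
    have := dvd_sub hB (dvd_mul_of_dvd_left h1
      (2 * (X * (p - X * r) + 3 * X ^ 2 * r + C a₄ * r + 2 * C a₂ * X * r)))
    convert! this using 1
    simp only [symXZ, map_ofNat]; ring
  have hC' : π ∣ ((X ^ 2 - C a₄) ^ 2 - C 4 * C a₆ * (2 * X + C a₂)) * r ^ 2 := by
    have := dvd_sub hC (dvd_mul_of_dvd_left h1
      (X * (X * (p + X * r) - 2 * C a₄ * r) - 4 * C a₆ * r))
    convert! this using 1
    simp only [symX, map_ofNat]; ring
  have hr2 : ¬ π ∣ r ^ 2 := fun h => hr (hπ.dvd_of_dvd_pow h)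
  have h4 : (4 : F) ≠ 0 := by
    have : (4 : F) = 2 * 2 := by norm_num
    rw [this]; exact mul_ne_zero h2 h2
  have hg := (hπ.dvd_or_dvd hB').resolve_right hr2
  have hh := (hπ.dvd_or_dvd hC').resolve_right hr2
  have hdisc : π ∣ C (4 * cubicDisc a₂ a₄ a₆) := by
    have := dvd_add
      (dvd_mul_of_dvd_left hg (3 * X ^ 3 - C a₂ * X ^ 2 - 5 * C a₄ * X + 2 * C a₂ * C a₄ - 27 * C a₆))
      (dvd_mul_of_dvd_left hh (-4 * (3 * X ^ 2 + 2 * C a₂ * X + 4 * C a₄ - C a₂ ^ 2)))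
    convert! this using 1
    simp only [cubicDisc, map_ofNat, map_add, map_sub, map_mul, map_pow]; ring
  exact hπ.not_isUnit (isUnit_of_dvd_unit hdisc (isUnit_C.2 (mul_ne_zero h4 hd).isUnit))

lemma prime_not_dvd_pair {p₁ r₁ p₂ r₂ π : F[X]} (h₁ : IsCoprime p₁ r₁) (h₂ : IsCoprime p₂ r₂)
    (hπ : Prime π) (hA : π ∣ r₁ * r₂) (hB : π ∣ p₁ * r₂ + p₂ * r₁) (hC : π ∣ p₁ * p₂) : False := by
  have n1 : π ∣ p₁ → π ∣ r₁ → False := fun a b => hπ.not_isUnit (h₁.isUnit_of_dvd' a b)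
  have n2 : π ∣ p₂ → π ∣ r₂ → False := fun a b => hπ.not_isUnit (h₂.isUnit_of_dvd' a b)
  rcases hπ.dvd_or_dvd hA with h | h
  · have := (dvd_add_left (dvd_mul_of_dvd_right h p₂)).1 hB
    rcases hπ.dvd_or_dvd this with h' | h'
    · exact n1 h' h
    · rcases hπ.dvd_or_dvd hC with h'' | h''
      · exact n1 h'' h
      · exact n2 h'' h'
  · have := (dvd_add_right (dvd_mul_of_dvd_right h p₁)).1 hB
    rcases hπ.dvd_or_dvd this with h' | h'
    · exact n2 h' h
    · rcases hπ.dvd_or_dvd hC with h'' | h''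
      · exact n1 h'' h'
      · exact n2 h'' h

/-- Proportional primitive triples of polynomials differ by a nonzero constant. -/
lemma triple_eq {A B D A' B' D' : F[X]} (h : ∀ π, Prime π → π ∣ A → π ∣ B → π ∣ D → False)
    (h' : ∀ π, Prime π → π ∣ A' → π ∣ B' → π ∣ D' → False) {κ : RatFunc F} (hκ : κ ≠ 0)
    (hA : algebraMap F[X] (RatFunc F) A = κ * algebraMap F[X] (RatFunc F) A')
    (hB : algebraMap F[X] (RatFunc F) B = κ * algebraMap F[X] (RatFunc F) B')
    (hD : algebraMap F[X] (RatFunc F) D = κ * algebraMap F[X] (RatFunc F) D') :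
    ∃ c : F, c ≠ 0 ∧ A = C c * A' ∧ B = C c * B' ∧ D = C c * D' := by
  have hden := RatFunc.denom_ne_zero κ
  have hnum : κ.num ≠ 0 := RatFunc.num_ne_zero hκ
  have hco := RatFunc.isCoprime_num_denom κ
  have clear : ∀ {a a' : F[X]}, algebraMap F[X] (RatFunc F) a = κ * algebraMap F[X] (RatFunc F) a' →
      κ.denom * a = κ.num * a' := by
    intro a a' e
    have hden' : algebraMap F[X] (RatFunc F) κ.denom ≠ 0 := by
      simpa using hden
    rw [← RatFunc.num_div_denom κ] at e
    apply RatFunc.algebraMap_injective F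
    rw [map_mul, map_mul, e, RatFunc.num_div_denom κ]
    nth_rewrite 2 [← RatFunc.num_div_denom κ]
    field_simp
  have cA := clear hA
  have cB := clear hB
  have cD := clear hD
  have uden : IsUnit κ.denom := by
    by_contra hu
    obtain ⟨π, hπ, hdv⟩ := WfDvdMonoid.exists_irreducible_factor hu hden
    have k : ∀ {a a' : F[X]}, κ.denom * a = κ.num * a' → π ∣ a' := fun {a a'} e =>
      hdv.trans ((hco.symm.dvd_of_dvd_mul_left) (Dvd.intro _ e))
    exact h' π hπ.prime (k cA) (k cB) (k cD)
  have unum : IsUnit κ.num := by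
    by_contra hu
    obtain ⟨π, hπ, hdv⟩ := WfDvdMonoid.exists_irreducible_factor hu hnum
    have k : ∀ {a a' : F[X]}, κ.denom * a = κ.num * a' → π ∣ a := fun {a a'} e =>
      hdv.trans ((hco.dvd_of_dvd_mul_left) (Dvd.intro _ e.symm))
    exact h π hπ.prime (k cA) (k cB) (k cD)
  have hden1 : κ.denom = 1 := (RatFunc.monic_denom κ).eq_one_of_isUnit uden
  obtain ⟨c, hc, hc'⟩ := isUnit_iff.1 unum
  refine ⟨c, hc.ne_zero, ?_, ?_, ?_⟩
  · simpa [hden1, ← hc'] using cA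
  · simpa [hden1, ← hc'] using cB
  · simpa [hden1, ← hc'] using cD

lemma sym_degree {a₂ a₄ a₆ : F} {p r : F[X]} (h : r.degree < p.degree) :
    (symZ X p r).natDegree ≤ 2 * p.natDegree ∧
    (symXZ (C a₂) (C a₄) (C a₆) X p r).natDegree ≤ 2 * p.natDegree + 1 ∧
    (symX (C a₂) (C a₄) (C a₆) X p r).natDegree = 2 * p.natDegree + 2 := by
  have hp : p ≠ 0 := by rintro rfl; simp at h
  by_cases hr : r = 0
  · subst hr
    simp only [symZ, symXZ, symX, mul_zero, sub_zero, add_zero, zero_mul, ne_eq, OfNat.ofNat_ne_zero,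
      not_false_eq_true, zero_pow]
    refine ⟨by simp, ?_, ?_⟩
    · have : (2 * (p * X * p) : F[X]) = C 2 * (p * X * p) := by rw [map_ofNat]
      rw [this]
      refine (natDegree_C_mul_le _ _).trans ?_
      rw [natDegree_mul (mul_ne_zero hp X_ne_zero) hp, natDegree_mul hp X_ne_zero, natDegree_X]
      omega
    · rw [natDegree_pow, natDegree_mul X_ne_zero hp, natDegree_X]; ring
  · have hd : r.natDegree + 1 ≤ p.natDegree := natDegree_lt_natDegree hr h
    obtain ⟨d, hd'⟩ : ∃ d, p.natDegree = d + 1 := ⟨p.natDegree - 1, by omega⟩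
    have hrd : r.natDegree ≤ d := by omega
    have hpd : p.natDegree ≤ d + 1 := by omega
    have hX : (X : F[X]).natDegree ≤ 1 := natDegree_X_le
    have hXr : (X * r).natDegree ≤ d + 1 := by
      have := natDegree_mul_le_of_le hX hrd; omega
    refine ⟨?_, ?_, ?_⟩
    · rw [symZ, hd']
      have := natDegree_pow_le_of_le 2 (natDegree_sub_le_of_le hpd hXr)
      simpa using this
    · have e : symXZ (C a₂) (C a₄) (C a₆) X p r
          = C 2 * ((p * X + C a₄ * r) * (p + X * r) + (C 2 * C a₂ * X * p + C 2 * C a₆ * r) * r) := by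
        simp only [symXZ, map_ofNat]; ring
      have h1 : (p * X + C a₄ * r).natDegree ≤ d + 2 := by compute_degree; omega
      have h2 : (p + X * r).natDegree ≤ d + 1 := natDegree_add_le_of_degree_le hpd hXr
      have h3 : (C 2 * C a₂ * X * p + C 2 * C a₆ * r).natDegree ≤ d + 2 := by
        compute_degree; omega
      rw [e, hd']
      refine (natDegree_C_mul_le _ _).trans (natDegree_add_le_of_degree_le ?_ ?_)
      · exact (natDegree_mul_le_of_le h1 h2).trans (by omega)
      · exact (natDegree_mul_le_of_le h3 hrd).trans (by omega)
    · have e : symX (C a₂) (C a₄) (C a₆) X p r = (X * p) ^ 2 +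
          r * (C (-2 * a₄) * X * p + C (a₄ ^ 2 - 4 * a₆ * a₂) * r + C (-4 * a₆) * p
            + C (-4 * a₆) * X * r) := by
        simp only [symX, map_ofNat, map_mul, map_sub, map_neg, map_pow]; ring
      have h1 : (C (-2 * a₄) * X * p + C (a₄ ^ 2 - 4 * a₆ * a₂) * r + C (-4 * a₆) * p
            + C (-4 * a₆) * X * r).natDegree ≤ d + 2 := by
        compute_degree; omega
      have h2 : ((X * p) ^ 2).natDegree = 2 * p.natDegree + 2 := by
        rw [natDegree_pow, natDegree_mul X_ne_zero hp, natDegree_X]; ring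
      rw [e, natDegree_add_eq_left_of_natDegree_lt, h2]
      rw [h2]
      exact (natDegree_mul_le_of_le hrd h1).trans_lt (by omega)

/-- The degree condition propagates along an arithmetic progression of points. -/
lemma degree_step {p₁ r₁ p₂ r₂ : F[X]} {d : ℕ} (hA : (r₁ * r₂).natDegree ≤ 2 * d)
    (hB : (p₁ * r₂ + p₂ * r₁).natDegree ≤ 2 * d + 1) (hC : (p₁ * p₂).natDegree = 2 * d + 2) :
    r₁.degree < p₁.degree ∧ r₂.degree < p₂.degree ∧
      p₁.natDegree + p₂.natDegree = 2 * d + 2 := by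
  have hne : p₁ * p₂ ≠ 0 := by intro h; simp [h] at hC
  have h1 : p₁ ≠ 0 := left_ne_zero_of_mul hne
  have h2 : p₂ ≠ 0 := right_ne_zero_of_mul hne
  rw [natDegree_mul h1 h2] at hC
  have key : ∀ {p₁ r₁ p₂ r₂ : F[X]}, p₁ ≠ 0 → p₂ ≠ 0 → (r₁ * r₂).natDegree ≤ 2 * d →
      (p₁ * r₂ + p₂ * r₁).natDegree ≤ 2 * d + 1 → p₁.natDegree + p₂.natDegree = 2 * d + 2 →
      r₁.degree < p₁.degree := by
    intro p₁ r₁ p₂ r₂ h1 h2 hA hB hC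
    by_contra hlt
    push Not at hlt
    have hr1 : r₁ ≠ 0 := by rintro rfl; simp at hlt; exact h1 hlt
    have hd1 : p₁.natDegree ≤ r₁.natDegree := natDegree_le_natDegree hlt
    by_cases hr2 : r₂ = 0
    · subst hr2
      rw [mul_zero, zero_add, natDegree_mul h2 hr1] at hB
      omega
    · rw [natDegree_mul hr1 hr2] at hA
      have : (p₁ * r₂).natDegree < (p₂ * r₁).natDegree := by
        rw [natDegree_mul h1 hr2, natDegree_mul h2 hr1]; omega
      rw [natDegree_add_eq_right_of_natDegree_lt this, natDegree_mul h2 hr1] at hB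
      omega
  exact ⟨key h1 h2 hA hB hC, key h2 h1 (by rwa [mul_comm]) (by rwa [add_comm]) (by omega), hC⟩
end Poly

section Twist
open Polynomial WeierstrassCurve
open scoped Classical
variable {F : Type} [Field F]

/-- The cubic `x³ + a₂ x² + a₄ x + a₆`. -/
noncomputable def cubicPoly (a₂ a₄ a₆ : F) : F[X] := X ^ 3 + C a₂ * X ^ 2 + C a₄ * X + C a₆

lemma cubicPoly_monic (a₂ a₄ a₆ : F) : (cubicPoly a₂ a₄ a₆).Monic := by
  unfold cubicPoly; monicity!

lemma cubicPoly_natDegree (a₂ a₄ a₆ : F) : (cubicPoly a₂ a₄ a₆).natDegree = 3 := by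
  unfold cubicPoly; compute_degree!

lemma cubicPoly_eval (a₂ a₄ a₆ x : F) :
    (cubicPoly a₂ a₄ a₆).eval x = x ^ 3 + a₂ * x ^ 2 + a₄ * x + a₆ := by
  simp [cubicPoly]

/-- The embedding of polynomials in rational functions. -/
noncomputable abbrev toRat (p : F[X]) : RatFunc F := algebraMap F[X] (RatFunc F) p

lemma toRat_ne_zero {p : F[X]} (hp : p ≠ 0) : toRat p ≠ 0 := by
  simpa [toRat] using hp

/-- The quadratic twist of `y² = g(x)` by `g(t)` over the rational function field. -/
noncomputable abbrev twist (a₂ a₄ a₆ : F) : WeierstrassCurve (RatFunc F) :=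
  shortCurve (toRat (C a₂) * toRat (cubicPoly a₂ a₄ a₆))
    (toRat (C a₄) * toRat (cubicPoly a₂ a₄ a₆) ^ 2) (toRat (C a₆) * toRat (cubicPoly a₂ a₄ a₆) ^ 3)

variable {a₂ a₄ a₆ : F}

lemma cubic_ne_zero : toRat (cubicPoly a₂ a₄ a₆) ≠ 0 :=
  toRat_ne_zero (cubicPoly_monic a₂ a₄ a₆).ne_zero

lemma two_ne_zero_ratFunc (h2 : (2 : F) ≠ 0) : (2 : RatFunc F) ≠ 0 := by
  have : (2 : RatFunc F) = toRat (C 2) := by rw [toRat, map_ofNat, map_ofNat]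
  rw [this]
  exact toRat_ne_zero (by simpa using h2)

lemma twist_nonsingular (h2 : (2 : F) ≠ 0) (hd : cubicDisc a₂ a₄ a₆ ≠ 0) {x y : F[X]}
    (h : y ^ 2 = x ^ 3 + C a₂ * cubicPoly a₂ a₄ a₆ * x ^ 2 + C a₄ * cubicPoly a₂ a₄ a₆ ^ 2 * x
      + C a₆ * cubicPoly a₂ a₄ a₆ ^ 3) :
    (twist a₂ a₄ a₆).toAffine.Nonsingular (toRat x) (toRat y) := by
  rw [shortCurve_nonsingular (two_ne_zero_ratFunc h2)]
  · have := congrArg toRat h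
    simpa [toRat] using this
  · have : cubicDisc (toRat (C a₂) * toRat (cubicPoly a₂ a₄ a₆))
        (toRat (C a₄) * toRat (cubicPoly a₂ a₄ a₆) ^ 2)
        (toRat (C a₆) * toRat (cubicPoly a₂ a₄ a₆) ^ 3)
        = toRat (C (cubicDisc a₂ a₄ a₆)) * toRat (cubicPoly a₂ a₄ a₆) ^ 6 := by
      generalize cubicPoly a₂ a₄ a₆ = g
      simp only [cubicDisc, toRat, map_sub, map_add, map_mul, map_pow, map_ofNat]
      ring
    rw [this]
    exact mul_ne_zero (toRat_ne_zero (by simpa using hd)) (pow_ne_zero 6 cubic_ne_zero)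

/-- Coprime numerator and denominator of the normalised `x`-coordinate. -/
noncomputable def ratPair : (twist a₂ a₄ a₆).toAffine.Point → F[X] × F[X]
  | .zero => (1, 0)
  | .some x _ _ => ((x / toRat (cubicPoly a₂ a₄ a₆)).num, (x / toRat (cubicPoly a₂ a₄ a₆)).denom)

lemma ratPair_coprime (P : (twist a₂ a₄ a₆).toAffine.Point) :
    IsCoprime (ratPair P).1 (ratPair P).2 := by
  rcases P with _ | ⟨x, y, h⟩
  · exact isCoprime_one_left
  · exact RatFunc.isCoprime_num_denom _

lemma ratPair_xRep (P : (twist a₂ a₄ a₆).toAffine.Point) :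
    ∃ c : RatFunc F, c ≠ 0 ∧ toRat (cubicPoly a₂ a₄ a₆) * toRat (ratPair P).1 = c * P.xRep 0 ∧
      toRat (ratPair P).2 = c * P.xRep 1 := by
  rcases P with _ | ⟨x, y, h⟩
  · exact ⟨_, cubic_ne_zero (a₂ := a₂) (a₄ := a₄) (a₆ := a₆), by simp [ratPair, Affine.Point.xRep, toRat]⟩
  · have hden := toRat_ne_zero (RatFunc.denom_ne_zero (x / toRat (cubicPoly a₂ a₄ a₆)))
    refine ⟨_, hden, ?_, ?_⟩
    · simp only [ratPair, Affine.Point.xRep_some]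
      have e := RatFunc.num_div_denom (x / toRat (cubicPoly a₂ a₄ a₆))
      have hg := cubic_ne_zero (a₂ := a₂) (a₄ := a₄) (a₆ := a₆)
      rw [div_eq_iff hden] at e
      change _ * algebraMap F[X] (RatFunc F) _ = _
      rw [e]
      simp only [Matrix.cons_val_zero]
      field_simp
    · simp [ratPair]

lemma ratPair_step (h2 : (2 : F) ≠ 0) (hd : cubicDisc a₂ a₄ a₆ ≠ 0)
    (P Q : (twist a₂ a₄ a₆).toAffine.Point)
    (hQ : ∃ h, Q = .some (toRat (cubicPoly a₂ a₄ a₆ * X)) (toRat (cubicPoly a₂ a₄ a₆ ^ 2)) h)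
    (hP : (ratPair P).2.degree < (ratPair P).1.degree) :
    (ratPair (P - Q)).2.degree < (ratPair (P - Q)).1.degree ∧
    (ratPair (P + Q)).2.degree < (ratPair (P + Q)).1.degree ∧
    (ratPair (P - Q)).1.natDegree + (ratPair (P + Q)).1.natDegree
      = 2 * (ratPair P).1.natDegree + 2 := by
  obtain ⟨hQn, hQe⟩ := hQ
  have hu : toRat (cubicPoly a₂ a₄ a₆ ^ 2) ≠ 0 :=
    toRat_ne_zero (pow_ne_zero 2 (cubicPoly_monic a₂ a₄ a₆).ne_zero)
  obtain ⟨κ, hκ, e1, e2, e3⟩ := sym_add_sub (two_ne_zero_ratFunc h2) P hQn hu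
  rw [← hQe] at e1 e2 e3
  obtain ⟨c, hc, c1, c2⟩ := ratPair_xRep P
  obtain ⟨m, hm, m1, m2⟩ := ratPair_xRep (P - Q)
  obtain ⟨s, hs, s1, s2⟩ := ratPair_xRep (P + Q)
  have hg := cubic_ne_zero (a₂ := a₂) (a₄ := a₄) (a₆ := a₆)
  have c1' : P.xRep 0 = toRat (cubicPoly a₂ a₄ a₆) * toRat (ratPair P).1 / c := by
    rw [c1]; field_simp
  have c2' : P.xRep 1 = toRat (ratPair P).2 / c := by rw [c2]; field_simp
  have m1' : toRat (ratPair (P - Q)).1 = m * (P - Q).xRep 0 / toRat (cubicPoly a₂ a₄ a₆) := by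
    rw [← m1]; field_simp
  have s1' : toRat (ratPair (P + Q)).1 = s * (P + Q).xRep 0 / toRat (cubicPoly a₂ a₄ a₆) := by
    rw [← s1]; field_simp
  rw [c1', c2'] at e1 e2 e3
  obtain ⟨k, hk, k1, k2, k3⟩ := triple_eq
    (κ := m * s * κ * toRat (cubicPoly a₂ a₄ a₆) ^ 2 / c ^ 2)
    (fun π => prime_not_dvd_pair (ratPair_coprime (P - Q)) (ratPair_coprime (P + Q)))
    (fun π => prime_not_dvd_sym h2 hd (ratPair_coprime P)) (by positivity)
    (by
      rw [map_mul]
      change toRat _ * toRat _ = _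
      rw [m2, s2]
      have : m * (P - Q).xRep 1 * (s * (P + Q).xRep 1)
        = m * s * ((P - Q).xRep 1 * (P + Q).xRep 1) := by ring
      rw [this, e1]
      simp only [symZ, toRat, map_mul, map_pow, map_sub]
      field_simp)
    (by
      rw [map_add, map_mul, map_mul]
      change toRat _ * toRat _ + toRat _ * toRat _ = _
      rw [m2, s2, m1', s1']
      have : m * (P - Q).xRep 0 / toRat (cubicPoly a₂ a₄ a₆) * (s * (P + Q).xRep 1) +
          s * (P + Q).xRep 0 / toRat (cubicPoly a₂ a₄ a₆) * (m * (P - Q).xRep 1)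
        = m * s * ((P - Q).xRep 0 * (P + Q).xRep 1 + (P + Q).xRep 0 * (P - Q).xRep 1)
          / toRat (cubicPoly a₂ a₄ a₆) := by field_simp
      rw [this, e2]
      simp only [symXZ, toRat, map_mul, map_pow, map_add, map_ofNat]
      field_simp)
    (by
      rw [map_mul]
      change toRat _ * toRat _ = _
      rw [m1', s1']
      have : m * (P - Q).xRep 0 / toRat (cubicPoly a₂ a₄ a₆) *
          (s * (P + Q).xRep 0 / toRat (cubicPoly a₂ a₄ a₆))
        = m * s * ((P - Q).xRep 0 * (P + Q).xRep 0) / toRat (cubicPoly a₂ a₄ a₆) ^ 2 := by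
        field_simp
      rw [this, e3]
      simp only [symX, toRat, map_mul, map_pow, map_add, map_sub, map_ofNat]
      field_simp)
  obtain ⟨d1, d2, d3⟩ := sym_degree (a₂ := a₂) (a₄ := a₄) (a₆ := a₆) hP
  refine degree_step ?_ ?_ ?_
  · rw [k1, natDegree_C_mul hk]; exact d1
  · rw [k2, natDegree_C_mul hk]; exact d2
  · rw [k3, natDegree_C_mul hk]; exact d3

/-- An integer sequence with constant second difference two. -/
lemma quadratic_of_second_diff {e : ℤ → ℤ} (h : ∀ k, e (k - 1) + e (k + 1) = 2 * e k + 2) (k : ℤ) :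
    e k = k ^ 2 + (e 0 + 1 - e (-1)) * k + e 0 := by
  have key : ∀ k : ℕ, (e k = k ^ 2 + (e 0 + 1 - e (-1)) * k + e 0) ∧
      e (k - 1) = (k - 1) ^ 2 + (e 0 + 1 - e (-1)) * (k - 1) + e 0 := by
    intro k
    induction k with
    | zero => simp; ring
    | succ k ih =>
      push_cast
      have := h k
      refine ⟨?_, ?_⟩
      · linear_combination this + 2 * ih.1 - ih.2
      · simpa using ih.1
  have key' : ∀ k : ℕ, (e (-k) = (-k) ^ 2 + (e 0 + 1 - e (-1)) * (-k) + e 0) ∧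
      e (-k - 1) = (-k - 1) ^ 2 + (e 0 + 1 - e (-1)) * (-k - 1) + e 0 := by
    intro k
    induction k with
    | zero => simp; ring
    | succ k ih =>
      push_cast
      have := h (-k - 1)
      rw [sub_add_cancel] at this
      have h3 : (-((k : ℤ) + 1)) = -k - 1 := by ring
      rw [h3]
      refine ⟨ih.2, ?_⟩
      linear_combination this - ih.1 + 2 * ih.2
  obtain ⟨n, rfl | rfl⟩ := Int.eq_nat_or_neg k
  · exact (key n).1
  · exact (key' n).1

/-- The slope of a nonnegative integer-valued quadratic is bounded. -/
lemma slope_sq_le {β c : ℤ} (h : ∀ k : ℤ, 0 ≤ k ^ 2 + β * k + c) : β ^ 2 ≤ 4 * c + 1 := by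
  rcases Int.even_or_odd' β with ⟨b, hb | hb⟩
  · have := h (-b); subst hb; nlinarith
  · have := h (-b); subst hb; nlinarith

/-- The degree of the numerator at the first step backwards controls the trace. -/
lemma trace_bound (h2 : (2 : F) ≠ 0) (hd : cubicDisc a₂ a₄ a₆ ≠ 0)
    (P Q : (twist a₂ a₄ a₆).toAffine.Point)
    (hQ : ∃ h, Q = .some (toRat (cubicPoly a₂ a₄ a₆ * X)) (toRat (cubicPoly a₂ a₄ a₆ ^ 2)) h)
    {q : ℕ} {y : RatFunc F} (hq : 0 < q)
    (hP : ∃ h, P = .some (toRat (cubicPoly a₂ a₄ a₆ * X ^ q)) y h) :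
    ((q : ℤ) + 1 - (ratPair (P - Q)).1.natDegree) ^ 2 ≤ 4 * q + 1 := by
  have h0 : ratPair P = (X ^ q, 1) := by
    obtain ⟨h, rfl⟩ := hP
    have : toRat (cubicPoly a₂ a₄ a₆ * X ^ q) / toRat (cubicPoly a₂ a₄ a₆) = toRat (X ^ q) := by
      have := cubic_ne_zero (a₂ := a₂) (a₄ := a₄) (a₆ := a₆)
      rw [toRat, map_mul]; field_simp
    simp only [ratPair, this]
    rw [toRat, RatFunc.num_algebraMap, RatFunc.denom_algebraMap]
  have hs : ∀ k : ℤ, P + k • Q - Q = P + (k - 1) • Q := fun k => by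
    rw [sub_smul, one_smul]; abel
  have ha : ∀ k : ℤ, P + k • Q + Q = P + (k + 1) • Q := fun k => by
    rw [add_zsmul, one_zsmul]; abel
  have hdeg : ∀ k : ℤ, (ratPair (P + k • Q)).2.degree < (ratPair (P + k • Q)).1.degree := by
    intro k
    induction k with
    | zero =>
      have hz : P + (0 : ℤ) • Q = P := by simp
      rw [hz, h0]
      simpa [degree_X_pow] using hq
    | succ k ih =>
      have := (ratPair_step h2 hd _ Q hQ ih).2.1
      rwa [ha] at this
    | pred k ih =>
      have := (ratPair_step h2 hd _ Q hQ ih).1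
      rwa [hs] at this
  have hrec := quadratic_of_second_diff (e := fun k => ((ratPair (P + k • Q)).1.natDegree : ℤ)) (by
    intro k
    have := (ratPair_step h2 hd _ Q hQ (hdeg k)).2.2
    rw [ha, hs] at this
    exact_mod_cast this)
  have e0 : ((ratPair (P + (0 : ℤ) • Q)).1.natDegree : ℤ) = q := by
    rw [zero_zsmul, add_zero, h0]; simp
  have e1 : P + (-1 : ℤ) • Q = P - Q := by rw [neg_one_zsmul, sub_eq_add_neg]
  simp only [e0, e1] at hrec
  refine slope_sq_le fun k => ?_
  rw [← hrec k]
  positivity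
end Twist

section Count
open Polynomial WeierstrassCurve
open scoped Classical
variable {F : Type} [Field F] [Fintype F]

lemma cubicPoly_pow_card (a₂ a₄ a₆ : F) : cubicPoly a₂ a₄ a₆ ^ Fintype.card F =
    (X ^ Fintype.card F) ^ 3 + C a₂ * (X ^ Fintype.card F) ^ 2 + C a₄ * X ^ Fintype.card F + C a₆ := by
  rw [← FiniteField.expand_card]
  simp [cubicPoly]

/-- Local multiplicity of the common factor at `a`. -/
noncomputable def defectAt (a₂ a₄ a₆ a : F) : ℕ :=
  2 - Finset.card {y : F | y ^ 2 = (cubicPoly a₂ a₄ a₆).eval a}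

lemma defectAt_dvd (h2 : (2 : F) ≠ 0) (a₂ a₄ a₆ a : F) :
    (X - C a) ^ defectAt a₂ a₄ a₆ a ∣
      cubicPoly a₂ a₄ a₆ * (cubicPoly a₂ a₄ a₆ ^ (Fintype.card F / 2) + 1) ^ 2 := by
  set g := cubicPoly a₂ a₄ a₆ with hg
  have hch : ringChar F ≠ 2 := by
    intro h
    apply h2
    have := CharP.cast_eq_zero F (ringChar F)
    rw [h] at this
    exact_mod_cast this
  by_cases h0 : g.eval a = 0
  · have hdv : X - C a ∣ g := dvd_iff_isRoot.2 h0
    have : defectAt a₂ a₄ a₆ a ≤ 1 := by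
      unfold defectAt
      have : 0 < Finset.card {y : F | y ^ 2 = (cubicPoly a₂ a₄ a₆).eval a} :=
        Finset.card_pos.2 ⟨0, by simp [← hg, h0]⟩
      omega
    exact ((pow_dvd_pow _ this).trans (by rwa [pow_one])).mul_right _
  · by_cases hs : IsSquare (g.eval a)
    · obtain ⟨y, hy⟩ := hs
      have hy0 : y ≠ 0 := by rintro rfl; simp [hy] at h0
      have : defectAt a₂ a₄ a₆ a = 0 := by
        unfold defectAt
        have : 2 ≤ Finset.card {y : F | y ^ 2 = (cubicPoly a₂ a₄ a₆).eval a} := by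
          have hne : y ≠ -y := by
            intro h
            exact mul_ne_zero h2 hy0 (by linear_combination h)
          refine (Finset.card_pair hne).ge.trans ?_
          apply Finset.card_le_card
          intro z hz
          simp only [Finset.mem_insert, Finset.mem_singleton] at hz
          simp only [Finset.mem_filter, Finset.mem_univ, true_and, ← hg, hy]
          rcases hz with rfl | rfl <;> ring
        omega
      rw [this, pow_zero]
      exact one_dvd _
    · have hm : g.eval a ^ (Fintype.card F / 2) = -1 := by
        rcases FiniteField.pow_dichotomy hch h0 with h | h
        · exact absurd ((FiniteField.isSquare_iff hch h0).2 h) hs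
        · exact h
      have hdv : X - C a ∣ g ^ (Fintype.card F / 2) + 1 := by
        rw [dvd_iff_isRoot]; simp [hm]
      have : defectAt a₂ a₄ a₆ a ≤ 2 := by unfold defectAt; omega
      exact ((pow_dvd_pow _ this).trans (pow_dvd_pow_of_dvd hdv 2)).mul_left _

lemma prod_X_sub_C_eq : ∏ a : F, (X - C a) = X ^ Fintype.card F - X := by
  have h1 : 1 < Fintype.card F := Fintype.one_lt_card
  have hm : (X ^ Fintype.card F - X : F[X]).Monic := by
    apply monic_X_pow_sub; simpa using h1
  have := prod_multiset_X_sub_C_of_monic_of_roots_card_eq hm (by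
    rw [FiniteField.roots_X_pow_card_sub_X, FiniteField.X_pow_card_sub_X_natDegree_eq F h1]
    rfl)
  rw [FiniteField.roots_X_pow_card_sub_X] at this
  exact this

/-- The numerator of the `x`-coordinate of `Frobenius - 1`. -/
noncomputable def frobNum (a₂ a₄ a₆ : F) : F[X] :=
  cubicPoly a₂ a₄ a₆ * (cubicPoly a₂ a₄ a₆ ^ (Fintype.card F / 2) + 1) ^ 2
    - (C a₂ + X ^ Fintype.card F + X) * (X ^ Fintype.card F - X) ^ 2

lemma frobNum_natDegree (hodd : Odd (Fintype.card F)) (h3 : 3 ≤ Fintype.card F) (a₂ a₄ a₆ : F) :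
    (frobNum a₂ a₄ a₆).natDegree ≤ 2 * Fintype.card F + 1 := by
  obtain ⟨k, hk⟩ := hodd
  have hk2 : Fintype.card F / 2 = k := by omega
  set g := cubicPoly a₂ a₄ a₆ with hg
  have hgq := cubicPoly_pow_card a₂ a₄ a₆
  rw [← hg] at hgq
  have hs : g * (g ^ k) ^ 2 = g ^ Fintype.card F := by rw [hk]; ring
  have e : frobNum a₂ a₄ a₆ = (X ^ Fintype.card F) ^ 2 * X +
      X ^ Fintype.card F * (C a₄ + C (2 * a₂) * X + X ^ 2) + C a₆ + C 2 * g ^ (k + 1) + g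
      - (C a₂ + X) * X ^ 2 := by
    rw [frobNum, ← hg, hk2]
    have : g * (g ^ k + 1) ^ 2 = g * (g ^ k) ^ 2 + C 2 * g ^ (k + 1) + g := by
      rw [map_ofNat]; ring
    rw [this, hs, hgq, map_mul, map_ofNat]
    ring
  have hg3 : g.natDegree ≤ 3 := (cubicPoly_natDegree a₂ a₄ a₆).le
  have hgk : (C 2 * g ^ (k + 1)).natDegree ≤ 2 * Fintype.card F + 1 :=
    (natDegree_C_mul_le _ _).trans ((natDegree_pow_le_of_le _ hg3).trans (by omega))
  rw [e]
  refine (natDegree_sub_le_of_le (n := 2 * Fintype.card F + 1) (natDegree_add_le_of_degree_le (natDegree_add_le_of_degree_le ?_ hgk)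
    (hg3.trans (by omega))) ?_).trans (max_self _).le
  · generalize Fintype.card F = q at *
    compute_degree
    omega
  · compute_degree
    omega

/-- The common factor of numerator and denominator. -/
noncomputable def frobGcd (a₂ a₄ a₆ : F) : F[X] := ∏ a : F, (X - C a) ^ defectAt a₂ a₄ a₆ a

lemma frobGcd_dvd_denom (a₂ a₄ a₆ : F) :
    frobGcd a₂ a₄ a₆ ∣ (X ^ Fintype.card F - X) ^ 2 := by
  rw [← prod_X_sub_C_eq, ← Finset.prod_pow]
  exact Finset.prod_dvd_prod_of_dvd _ _ fun a _ => pow_dvd_pow _ (by unfold defectAt; omega)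

lemma frobGcd_dvd_frobNum (h2 : (2 : F) ≠ 0) (a₂ a₄ a₆ : F) :
    frobGcd a₂ a₄ a₆ ∣ frobNum a₂ a₄ a₆ := by
  refine dvd_sub ?_ ((frobGcd_dvd_denom a₂ a₄ a₆).mul_left _)
  refine Finset.prod_dvd_of_coprime ?_ fun a _ => defectAt_dvd h2 a₂ a₄ a₆ a
  intro a _ b _ hab
  exact (pairwise_coprime_X_sub_C Function.injective_id hab).pow

lemma frobGcd_natDegree (a₂ a₄ a₆ : F) : 2 * Fintype.card F ≤ (frobGcd a₂ a₄ a₆).natDegree +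
    Finset.card {p : F × F | p.2 ^ 2 = (cubicPoly a₂ a₄ a₆).eval p.1} := by
  have e1 : (frobGcd a₂ a₄ a₆).natDegree = ∑ a : F, defectAt a₂ a₄ a₆ a := by
    rw [frobGcd, natDegree_prod_of_monic _ _ fun a _ => (monic_X_sub_C a).pow _]
    simp [natDegree_pow]
  have e2 : Finset.card {p : F × F | p.2 ^ 2 = (cubicPoly a₂ a₄ a₆).eval p.1}
      = ∑ a : F, Finset.card {y : F | y ^ 2 = (cubicPoly a₂ a₄ a₆).eval a} := by
    rw [Finset.card_filter, Fintype.sum_prod_type]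
    simp only [Finset.card_filter]
  rw [e1, e2, ← Finset.sum_add_distrib]
  calc 2 * Fintype.card F = ∑ _a : F, 2 := by simp [mul_comm]
    _ ≤ _ := Finset.sum_le_sum fun a _ => by unfold defectAt; omega

/-- A weak form of the Hasse bound. -/
lemma weak_hasse (hodd : Odd (Fintype.card F)) (h3 : 3 ≤ Fintype.card F) (h2 : (2 : F) ≠ 0)
    {a₂ a₄ a₆ : F} (hd : cubicDisc a₂ a₄ a₆ ≠ 0) : ∃ N : ℕ,
    N ≤ Finset.card {p : F × F | p.2 ^ 2 = (cubicPoly a₂ a₄ a₆).eval p.1} + 1 ∧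
    ((Fintype.card F : ℤ) + 1 - N) ^ 2 ≤ 4 * Fintype.card F + 1 := by
  set q := Fintype.card F with hq
  set g := cubicPoly a₂ a₄ a₆ with hg
  obtain ⟨k, hk⟩ := hodd
  have hk2 : q / 2 = k := by omega
  have hgq := cubicPoly_pow_card a₂ a₄ a₆
  rw [← hg, ← hq] at hgq
  have hQn : (twist a₂ a₄ a₆).toAffine.Nonsingular (toRat (g * X)) (toRat (g ^ 2)) :=
    twist_nonsingular h2 hd (by
      rw [← hg]
      have : g = X ^ 3 + C a₂ * X ^ 2 + C a₄ * X + C a₆ := rfl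
      linear_combination g ^ 3 * this)
  have hPn : (twist a₂ a₄ a₆).toAffine.Nonsingular (toRat (g * X ^ q)) (toRat (g ^ (k + 2))) :=
    twist_nonsingular h2 hd (by
      rw [← hg]
      have : (g ^ (k + 2)) ^ 2 = g ^ 3 * g ^ q := by rw [hk]; ring
      rw [this, hgq]; ring)
  have htb := trace_bound h2 hd (.some _ _ hPn) (.some _ _ hQn) ⟨hQn, rfl⟩ (by omega) ⟨hPn, rfl⟩
  refine ⟨_, ?_, htb⟩
  have hg0 := cubic_ne_zero (a₂ := a₂) (a₄ := a₄) (a₆ := a₆)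
  rw [← hg] at hg0
  have hXX0 : (X ^ q - X : F[X]) ≠ 0 := FiniteField.X_pow_card_sub_X_ne_zero F (by omega)
  have hXX : toRat (X ^ q - X) ≠ 0 := toRat_ne_zero hXX0
  obtain ⟨hQn', hQ'⟩ := short_neg hQn
  have hx : toRat (g * X ^ q) ≠ toRat (g * X) := by
    intro h
    apply mul_ne_zero hg0 hXX
    rw [toRat, toRat, ← map_mul, mul_sub, map_sub]
    exact sub_eq_zero.2 h
  obtain ⟨h', hsum⟩ := short_add hPn hQn' hx _ _ _ rfl rfl rfl
  rw [sub_eq_add_neg, hQ', hsum]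
  obtain ⟨N', hN'⟩ := frobGcd_dvd_frobNum h2 a₂ a₄ a₆
  obtain ⟨D', hD'⟩ := frobGcd_dvd_denom a₂ a₄ a₆
  have hh0 : frobGcd a₂ a₄ a₆ ≠ 0 := by
    intro h; rw [h, zero_mul] at hD'; exact pow_ne_zero 2 hXX0 hD'
  have hD0 : D' ≠ 0 := by
    rintro rfl; rw [mul_zero] at hD'; exact pow_ne_zero 2 hXX0 hD'
  simp only [ratPair]
  have key : ∀ z : RatFunc F, z = toRat N' / toRat D' → z.num.natDegree ≤ N'.natDegree := by
    rintro z rfl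
    by_cases hN0 : N' = 0
    · subst hN0; simp [toRat]
    · exact natDegree_le_of_dvd (RatFunc.num_div_dvd N' hD0) hN0
  refine (key _ ?_).trans ?_
  · have hhr := toRat_ne_zero hh0
    have hDr := toRat_ne_zero hD0
    have e1 : toRat (frobGcd a₂ a₄ a₆) * toRat N' = toRat (frobNum a₂ a₄ a₆) := by
      rw [hN', toRat, toRat, toRat, map_mul]
    have e2 : toRat (frobGcd a₂ a₄ a₆) * toRat D' = toRat (X ^ q - X) ^ 2 := by
      rw [toRat, toRat, toRat, ← map_mul, ← hD', map_pow]
    have e3 : toRat N' / toRat D' = toRat (frobNum a₂ a₄ a₆) / toRat (X ^ q - X) ^ 2 := by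
      rw [← e1, ← e2]; field_simp
    rw [e3, frobNum, ← hg, ← hq, hk2]
    simp only [toRat, map_mul, map_sub, map_add, map_pow, map_one] at hXX hg0 ⊢
    have hd1 : algebraMap F[X] (RatFunc F) g * algebraMap F[X] (RatFunc F) X ^ q
        - algebraMap F[X] (RatFunc F) g * algebraMap F[X] (RatFunc F) X
        = algebraMap F[X] (RatFunc F) g *
          (algebraMap F[X] (RatFunc F) X ^ q - algebraMap F[X] (RatFunc F) X) := by ring
    rw [hd1]
    field_simp
    ring
  · have h1 := frobNum_natDegree ⟨k, hk⟩ h3 a₂ a₄ a₆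
    have h4 := frobGcd_natDegree a₂ a₄ a₆
    rw [← hq] at h1 h4
    rw [← hg] at h4
    by_cases hN0 : N' = 0
    · simp [hN0]
    · rw [hN', natDegree_mul hh0 hN0] at h1
      omega

/-- The number of affine points is at least `10 (q - 11) / 11 - 1`. -/
lemma card_affine_ge (hodd : Odd (Fintype.card F)) (hq : 121 ≤ Fintype.card F) (h2 : (2 : F) ≠ 0)
    {a₂ a₄ a₆ : F} (hd : cubicDisc a₂ a₄ a₆ ≠ 0) : 10 * Fintype.card F ≤
      11 * (Finset.card {p : F × F | p.2 ^ 2 = (cubicPoly a₂ a₄ a₆).eval p.1} + 1) + 110 := by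
  obtain ⟨N, hN, hb⟩ := weak_hasse hodd (by omega) h2 hd
  suffices 10 * Fintype.card F ≤ 11 * N + 110 by omega
  by_contra hlt
  push Not at hlt
  zify at hlt hq
  generalize (Fintype.card F : ℤ) = q at *
  nlinarith
end Count

section Extension
variable {F : Type} [Field F] [Fintype F] [DecidableEq F]

lemma minDist_le {n : ℕ} {C : Submodule F (Fin n → F)} {x : Fin n → F} (hx : x ∈ C) (h0 : x ≠ 0) :
    minDist C ≤ hammingNorm x :=
  Nat.sInf_le ⟨x, hx, h0, rfl⟩

lemma hammingNorm_add_card_zeros {n : ℕ} (x : Fin n → F) :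
    hammingNorm x + Finset.card {j | x j = 0} = n := by
  have := Finset.card_filter_add_card_filter_not (s := (Finset.univ : Finset (Fin n)))
    (fun j => x j ≠ 0)
  simpa [hammingNorm] using this

/-- A `3`-extension of a length `n` code given by points of projective `4`-space, at most five of
them on a hyperplane, adds a point lying on no hyperplane through five of them. -/
lemma exists_extension_vector {n : ℕ} (M : Fin n → Fin 5 → F) (hn : 6 ≤ n)
    (hz : ∀ c : Fin 5 → F, c ≠ 0 → Finset.card {j | ∑ i, c i * M j i = 0} ≤ 5)
    (hext : IsHExtendable 3 (Submodule.span F (Set.range fun i : Fin 5 => fun j : Fin n => M j i))) :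
    ∃ v : Fin 5 → F, ∀ c : Fin 5 → F, c ≠ 0 → 5 ≤ Finset.card {j | ∑ i, c i * M j i = 0} →
      ∑ i, c i * v i ≠ 0 := by
  set C := Submodule.span F (Set.range fun i : Fin 5 => fun j : Fin n => M j i) with hC
  obtain ⟨C', hfr, hmd, hmap⟩ := hext
  set Φ : (Fin 5 → F) →ₗ[F] (Fin n → F) := Fintype.linearCombination F (fun i j => M j i) with hΦ
  have hΦa : ∀ c j, Φ c j = ∑ i, c i * M j i := by
    intro c j; simp [hΦ, Fintype.linearCombination_apply, Finset.sum_apply]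
  have hΦr : LinearMap.range Φ = C := by rw [hΦ, Fintype.range_linearCombination]
  have hΦ0 : ∀ c, c ≠ 0 → n ≤ hammingNorm (Φ c) + 5 := by
    intro c hc
    have h1 := hammingNorm_add_card_zeros (Φ c)
    have h2 := hz c hc
    simp only [hΦa] at h1
    omega
  have hΦi : ∀ c, c ≠ 0 → Φ c ≠ 0 := by
    intro c hc h
    have := hΦ0 c hc
    rw [h, hammingNorm_zero] at this
    omega
  have hmin : n ≤ minDist C + 5 := by
    have hne : {d | ∃ x ∈ C, x ≠ 0 ∧ hammingNorm x = d}.Nonempty :=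
      ⟨_, Φ 1, hΦr ▸ LinearMap.mem_range_self Φ 1, hΦi 1 one_ne_zero, rfl⟩
    obtain ⟨x, hx, hx0, hd⟩ := Nat.sInf_mem hne
    rw [minDist, ← hd]
    rw [← hΦr] at hx
    obtain ⟨c, rfl⟩ := hx
    exact hΦ0 c (by rintro rfl; simp at hx0)
  set π := LinearMap.funLeft F F (Fin.castAdd 3 : Fin n → Fin (n + 3)) with hπ
  have hmem : ∀ x ∈ C', π x ∈ C := fun x hx => hmap ▸ Submodule.mem_map_of_mem hx
  set ρ : C' →ₗ[F] C := π.restrict hmem with hρ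
  have hsurj : Function.Surjective ρ := by
    rintro ⟨y, hy⟩
    rw [← hmap] at hy
    obtain ⟨x, hx, rfl⟩ := hy
    exact ⟨⟨x, hx⟩, rfl⟩
  have hinj : Function.Injective ρ :=
    (LinearMap.injective_iff_surjective_of_finrank_eq_finrank hfr).2 hsurj
  set eqv := LinearEquiv.ofBijective ρ ⟨hinj, hsurj⟩ with heqv
  set L : (Fin 5 → F) →ₗ[F] (Fin (n + 3) → F) :=
    C'.subtype ∘ₗ eqv.symm.toLinearMap ∘ₗ
      (Φ.codRestrict C fun c => hΦr ▸ LinearMap.mem_range_self Φ c) with hL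
  have hLmem : ∀ c, L c ∈ C' := fun c => Subtype.coe_prop _
  have hLπ : ∀ c j, L c (Fin.castAdd 3 j) = Φ c j := by
    intro c j
    have := eqv.apply_symm_apply (Φ.codRestrict C (fun c => hΦr ▸ LinearMap.mem_range_self Φ c) c)
    have := congrFun (congrArg Subtype.val this) j
    exact this
  refine ⟨fun i => L (Pi.single i 1) (Fin.last (n + 2)), fun c hc h5 h0 => ?_⟩
  have hLl : L c (Fin.last (n + 2)) = 0 := by
    rw [← h0]
    conv_lhs => rw [LinearMap.pi_apply_eq_sum_univ L c]
    simp only [Finset.sum_apply, Pi.smul_apply, smul_eq_mul]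
    refine Finset.sum_congr rfl fun i _ => ?_
    have : (fun j => if i = j then (1 : F) else 0) = Pi.single i 1 := by
      funext j
      simp [Pi.single_apply, eq_comm]
    rw [this]
  have hL0 : L c ≠ 0 := by
    intro h
    apply hΦi c hc
    funext j
    rw [← hLπ, h]; rfl
  have h1 := minDist_le (hLmem c) hL0
  have h2 := hammingNorm_add_card_zeros (L c)
  have h3 : 6 ≤ Finset.card {j | L c j = 0} := by
    have hsub : insert (Fin.last (n + 2))
        ((Finset.univ.filter fun j : Fin n => ∑ i, c i * M j i = 0).map (Fin.castAddEmb 3))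
        ⊆ Finset.univ.filter fun j => L c j = 0 := by
      intro j hj
      simp only [Finset.mem_insert, Finset.mem_map, Finset.mem_filter, Finset.mem_univ,
        true_and] at hj ⊢
      rcases hj with rfl | ⟨j, hj, rfl⟩
      · exact hLl
      · rw [← hj, ← hΦa, ← hLπ]; rfl
    refine le_trans ?_ (Finset.card_le_card hsub)
    rw [Finset.card_insert_of_notMem, Finset.card_map]
    · omega
    · simp only [Finset.mem_map, not_exists, not_and]
      intro j _ h
      have := congrArg Fin.val h
      simp at this
      omega
  omega
end Extension

section Points
open Polynomial WeierstrassCurve Finset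
open scoped Classical
variable {F : Type} [Field F] [Fintype F] {a₂ a₄ a₆ : F}

/-- Affine coordinates of a point, `none` for the point at infinity. -/
def affineCoords : (shortCurve a₂ a₄ a₆).toAffine.Point → Option (F × F)
  | .zero => none
  | .some x y _ => some (x, y)

lemma affineCoords_injective :
    Function.Injective (affineCoords (a₂ := a₂) (a₄ := a₄) (a₆ := a₆)) := by
  rintro (_ | ⟨x, y, h⟩) (_ | ⟨x', y', h'⟩) e
  · rfl
  · simp [affineCoords] at e
  · simp [affineCoords] at e
  · simp only [affineCoords, Option.some.injEq, Prod.mk.injEq] at e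
    obtain ⟨rfl, rfl⟩ := e
    rfl

noncomputable instance : Fintype (shortCurve a₂ a₄ a₆).toAffine.Point :=
  Fintype.ofInjective _ affineCoords_injective

lemma card_point (h2 : (2 : F) ≠ 0) (hd : cubicDisc a₂ a₄ a₆ ≠ 0) :
    Fintype.card (shortCurve a₂ a₄ a₆).toAffine.Point =
      #{p : F × F | p.2 ^ 2 = (cubicPoly a₂ a₄ a₆).eval p.1} + 1 := by
  rw [← Finset.card_insertNone, ← Finset.card_univ, ← Finset.card_image_of_injective _
    affineCoords_injective]
  congr 1
  ext o
  simp only [mem_image, mem_univ, true_and, Finset.mem_insertNone]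
  constructor
  · rintro ⟨P, rfl⟩ p hp
    rcases P with _ | ⟨x, y, h⟩
    · simp [affineCoords] at hp
    · simp only [affineCoords, Option.mem_def, Option.some.injEq] at hp
      subst hp
      simp [cubicPoly_eval, shortCurve_equation.1 h.1]
  · intro h
    rcases o with _ | ⟨x, y⟩
    · exact ⟨.zero, rfl⟩
    · have := h _ rfl
      simp only [mem_filter, mem_univ, true_and, cubicPoly_eval] at this
      exact ⟨.some x y ((shortCurve_nonsingular h2 hd).2 this), rfl⟩

/-- The value of `c₀ + c₁ x + c₂ y + c₃ x² + c₄ x y` at a point, its leading coefficient at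
infinity. -/
def ev5 (c : Fin 5 → F) : (shortCurve a₂ a₄ a₆).toAffine.Point → F
  | .zero => c 4
  | .some x y _ => c 0 + c 1 * x + c 2 * y + c 3 * x ^ 2 + c 4 * (x * y)

/-- The value of `l₀ + l₁ x + l₂ y` at a point, its leading coefficient at infinity. -/
def ev3 (l : Fin 3 → F) : (shortCurve a₂ a₄ a₆).toAffine.Point → F
  | .zero => l 2
  | .some x y _ => l 0 + l 1 * x + l 2 * y

lemma card_filter_point_le {p : (shortCurve a₂ a₄ a₆).toAffine.Point → Prop} {A B : F[X]}
    (hAB : A ≠ 0 ∨ B ≠ 0)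
    (hp : ∀ x y h, p (.some x y h) → A.eval x + B.eval x * y = 0) :
    #{P | p P} ≤ (A ^ 2 - cubicPoly a₂ a₄ a₆ * B ^ 2).natDegree + if p .zero then 1 else 0 := by
  have hz := card_zeros_le (g := cubicPoly a₂ a₄ a₆) (A := A) (B := B)
    (by rw [cubicPoly_natDegree]; decide) hAB
  set Z : Finset (F × F) := {p | p.2 ^ 2 = (cubicPoly a₂ a₄ a₆).eval p.1 ∧
    A.eval p.1 + B.eval p.1 * p.2 = 0} with hZ
  have hmem : ∀ x y h, p (.some x y h) → (x, y) ∈ Z := by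
    intro x y h hpP
    simp only [hZ, mem_filter, mem_univ, true_and, cubicPoly_eval]
    exact ⟨shortCurve_equation.1 h.1, hp x y h hpP⟩
  rw [← Finset.card_image_of_injective _ affineCoords_injective]
  split_ifs with h0
  · refine le_trans (card_le_card (t := Finset.insertNone Z) ?_)
      (by rw [Finset.card_insertNone]; omega)
    intro o ho
    simp only [mem_image, mem_filter, mem_univ, true_and] at ho
    obtain ⟨P, hP, rfl⟩ := ho
    rcases P with _ | ⟨x, y, h⟩
    · simp [affineCoords]
    · simpa [affineCoords] using hmem x y h hP
  · refine le_trans (card_le_card (t := Z.map Function.Embedding.some) ?_)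
      (by rw [Finset.card_map]; omega)
    intro o ho
    simp only [mem_image, mem_filter, mem_univ, true_and] at ho
    obtain ⟨P, hP, rfl⟩ := ho
    rcases P with _ | ⟨x, y, h⟩
    · exact absurd hP h0
    · simpa [affineCoords] using hmem x y h hP

lemma ev5_zeros_le {c : Fin 5 → F} (hc : c ≠ 0) :
    #{P : (shortCurve a₂ a₄ a₆).toAffine.Point | ev5 c P = 0} ≤ 5 := by
  have hAB : (C (c 0) + C (c 1) * X + C (c 3) * X ^ 2 : F[X]) ≠ 0 ∨
      (C (c 2) + C (c 4) * X : F[X]) ≠ 0 := by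
    by_contra! h
    obtain ⟨hA, hB⟩ := h
    apply hc
    have a0 := congrArg (coeff · 0) hA
    have a1 := congrArg (coeff · 1) hA
    have a2 := congrArg (coeff · 2) hA
    have b0 := congrArg (coeff · 0) hB
    have b1 := congrArg (coeff · 1) hB
    simp [coeff_X, coeff_C, coeff_X_pow] at a0 a1 a2 b0 b1
    funext i
    fin_cases i <;> simpa
  refine (card_filter_point_le hAB fun x y h hP => ?_).trans ?_
  · simp only [ev5] at hP
    simp only [eval_add, eval_mul, eval_C, eval_X, eval_pow]
    linear_combination hP
  · have hg : (cubicPoly a₂ a₄ a₆).natDegree ≤ 3 := (cubicPoly_natDegree a₂ a₄ a₆).le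
    have hz : ev5 c (.zero : (shortCurve a₂ a₄ a₆).toAffine.Point) = c 4 := rfl
    by_cases h4 : c 4 = 0
    · rw [if_pos (hz.trans h4)]
      have : ((C (c 0) + C (c 1) * X + C (c 3) * X ^ 2) ^ 2 -
        cubicPoly a₂ a₄ a₆ * (C (c 2) + C (c 4) * X) ^ 2).natDegree ≤ 4 := by
        rw [h4, map_zero, zero_mul, add_zero]
        refine (natDegree_sub_le_of_le (n := 4) ?_ ?_).trans (max_self _).le
        · compute_degree
        · rw [← map_pow, mul_comm]
          exact (natDegree_C_mul_le _ _).trans (by omega)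
      omega
    · rw [if_neg (fun h => h4 (hz.symm.trans h)), add_zero]
      refine (natDegree_sub_le_of_le (n := 5) ?_ ?_).trans (max_self _).le
      · exact (natDegree_pow_le_of_le 2
          (show (C (c 0) + C (c 1) * X + C (c 3) * X ^ 2 : F[X]).natDegree ≤ 2 by
            compute_degree)).trans (by norm_num)
      · exact (natDegree_mul_le_of_le hg (natDegree_pow_le_of_le 2
          (show (C (c 2) + C (c 4) * X : F[X]).natDegree ≤ 1 by compute_degree))).trans (by norm_num)

lemma ev3_zeros_le {l : Fin 3 → F} (hl : l ≠ 0) :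
    #{P : (shortCurve a₂ a₄ a₆).toAffine.Point | ev3 l P = 0} ≤ 3 := by
  have hAB : (C (l 0) + C (l 1) * X : F[X]) ≠ 0 ∨ (C (l 2) : F[X]) ≠ 0 := by
    by_contra! h
    obtain ⟨hA, hB⟩ := h
    apply hl
    have a0 := congrArg (coeff · 0) hA
    have a1 := congrArg (coeff · 1) hA
    have b0 := congrArg (coeff · 0) hB
    simp [coeff_X, coeff_C] at a0 a1 b0
    funext i
    fin_cases i <;> simpa
  refine (card_filter_point_le hAB fun x y h hP => ?_).trans ?_
  · simp only [ev3] at hP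
    simp only [eval_add, eval_mul, eval_C, eval_X]
    linear_combination hP
  · have hg : (cubicPoly a₂ a₄ a₆).natDegree ≤ 3 := (cubicPoly_natDegree a₂ a₄ a₆).le
    have hz : ev3 l (.zero : (shortCurve a₂ a₄ a₆).toAffine.Point) = l 2 := rfl
    by_cases h4 : l 2 = 0
    · rw [if_pos (hz.trans h4)]
      have : ((C (l 0) + C (l 1) * X) ^ 2 -
        cubicPoly a₂ a₄ a₆ * (C (l 2)) ^ 2).natDegree ≤ 2 := by
        rw [h4]
        simp only [map_zero, ne_eq, OfNat.ofNat_ne_zero, not_false_eq_true, zero_pow, mul_zero,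
          sub_zero]
        compute_degree
      omega
    · rw [if_neg (fun h => h4 (hz.symm.trans h)), add_zero]
      refine (natDegree_sub_le_of_le (n := 3) ?_ ?_).trans (max_self _).le
      · exact (natDegree_pow_le_of_le 2
          (show (C (l 0) + C (l 1) * X : F[X]).natDegree ≤ 1 by compute_degree)).trans (by norm_num)
      · rw [← map_pow, mul_comm]
        exact (natDegree_C_mul_le _ _).trans hg
end Points

section ExtVec
open WeierstrassCurve Finset
variable {F : Type} [Field F]

/-- The vector `v` lies on no hyperplane meeting the image of the curve in five points. -/
def IsExtVec (a₂ a₄ a₆ : F) (v : Fin 5 → F) : Prop :=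
  ∀ c : Fin 5 → F, c ≠ 0 → ∀ s : Finset (shortCurve a₂ a₄ a₆).toAffine.Point, 5 ≤ #s →
    (∀ P ∈ s, ev5 c P = 0) → ∑ i, c i * v i ≠ 0

variable [Fintype F] [DecidableEq F]

lemma cubicDisc_completeSquare_ne_zero (h2 : (2 : F) ≠ 0) (W : WeierstrassCurve F) [W.IsElliptic] :
    cubicDisc (W.a₂ + W.a₁ ^ 2 / 4) (W.a₄ + W.a₁ * W.a₃ / 2) (W.a₆ + W.a₃ ^ 2 / 4) ≠ 0 := by
  have h4 : (4 : F) ≠ 0 := by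
    have : (4 : F) = 2 * 2 := by norm_num
    rw [this]; exact mul_ne_zero h2 h2
  intro h
  apply W.isUnit_Δ.ne_zero
  have : W.Δ = 16 * cubicDisc (W.a₂ + W.a₁ ^ 2 / 4) (W.a₄ + W.a₁ * W.a₃ / 2) (W.a₆ + W.a₃ ^ 2 / 4) := by
    simp only [WeierstrassCurve.Δ, WeierstrassCurve.b₂, WeierstrassCurve.b₄, WeierstrassCurve.b₆,
      WeierstrassCurve.b₈, cubicDisc]
    field_simp
    ring
  rw [this, h, mul_zero]

/-- Completing the square identifies the points of a Weierstrass curve with those of a short one. -/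
lemma completeSquare_bijective (h2 : (2 : F) ≠ 0) (W : WeierstrassCurve F) [W.IsElliptic] :
    ∃ f : W.toAffine.Point → (shortCurve (W.a₂ + W.a₁ ^ 2 / 4) (W.a₄ + W.a₁ * W.a₃ / 2)
      (W.a₆ + W.a₃ ^ 2 / 4)).toAffine.Point, Function.Bijective f ∧ f .zero = .zero ∧
      ∀ x y h, ∃ h', f (.some x y h) = .some x (y + (W.a₁ * x + W.a₃) / 2) h' := by
  have hd := cubicDisc_completeSquare_ne_zero h2 W
  have h4 : (4 : F) ≠ 0 := by
    have : (4 : F) = 2 * 2 := by norm_num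
    rw [this]; exact mul_ne_zero h2 h2
  have hiff : ∀ x y, W.toAffine.Nonsingular x y ↔ (shortCurve (W.a₂ + W.a₁ ^ 2 / 4)
      (W.a₄ + W.a₁ * W.a₃ / 2) (W.a₆ + W.a₃ ^ 2 / 4)).toAffine.Nonsingular x
        (y + (W.a₁ * x + W.a₃) / 2) := by
    intro x y
    rw [shortCurve_nonsingular h2 hd, ← Affine.equation_iff_nonsingular, Affine.equation_iff]
    constructor
    · intro h
      field_simp
      linear_combination 16 * h
    · intro h
      field_simp at h
      have : 4 * 4 * (y ^ 2 + W.a₁ * x * y + W.a₃ * y)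
        = 4 * 4 * (x ^ 3 + W.a₂ * x ^ 2 + W.a₄ * x + W.a₆) := by linear_combination h
      exact mul_left_cancel₀ (mul_ne_zero h4 h4) this
  refine ⟨fun P => match P with
    | .zero => .zero
    | .some x y h => .some x (y + (W.a₁ * x + W.a₃) / 2) ((hiff x y).1 h), ⟨?_, ?_⟩, rfl,
      fun x y h => ⟨_, rfl⟩⟩
  · rintro (_ | ⟨x, y, h⟩) (_ | ⟨x', y', h'⟩) e
    · rfl
    · simp at e
    · simp at e
    · simp only [Affine.Point.some.injEq] at e
      obtain ⟨rfl, e⟩ := e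
      obtain rfl := add_right_cancel e
      rfl
  · rintro (_ | ⟨x, y, h⟩)
    · exact ⟨.zero, rfl⟩
    · refine ⟨.some x (y - (W.a₁ * x + W.a₃) / 2) ((hiff _ _).2 (by simpa using h)), ?_⟩
      simp

/-- A `3`-extension of the elliptic code yields an extension vector for a short curve. -/
lemma exists_isExtVec (h2 : (2 : F) ≠ 0) (W : WeierstrassCurve F) [W.IsElliptic] {n : ℕ}
    (e : Fin n ≃ W.toAffine.Point) (hn : 6 ≤ n) (hext : IsHExtendable 3 (ellipticCode W 5 e)) :
    ∃ v, IsExtVec (W.a₂ + W.a₁ ^ 2 / 4) (W.a₄ + W.a₁ * W.a₃ / 2) (W.a₆ + W.a₃ ^ 2 / 4) v := by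
  obtain ⟨f, hf, hf0, hf1⟩ := completeSquare_bijective h2 W
  have hev : ∀ (c : Fin 5 → F) P, ∑ i, c i * phiVec W 5 P i =
      ev5 ![c 0 - c 2 * W.a₃ / 2, c 1 - c 2 * W.a₁ / 2 - c 4 * W.a₃ / 2, c 2, c 3 - c 4 * W.a₁ / 2,
        c 4] (f P) := by
    intro c P
    rcases P with _ | ⟨x, y, h⟩
    · rw [hf0]
      simp [ev5, phiVec, Fin.sum_univ_five]
    · obtain ⟨h', e⟩ := hf1 x y h
      rw [e]
      simp [ev5, phiVec, Fin.sum_univ_five, psi]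
      field_simp
      ring
  have hne : ∀ c : Fin 5 → F, c ≠ 0 → ![c 0 - c 2 * W.a₃ / 2, c 1 - c 2 * W.a₁ / 2 - c 4 * W.a₃ / 2,
      c 2, c 3 - c 4 * W.a₁ / 2, c 4] ≠ 0 := by
    intro c hc h
    apply hc
    have i0 := congrFun h 0
    have i1 := congrFun h 1
    have i2 := congrFun h 2
    have i3 := congrFun h 3
    have i4 := congrFun h 4
    simp at i0 i1 i2 i3 i4
    simp [i2, i4] at i0 i1 i3
    funext i
    fin_cases i <;> simpa
  obtain ⟨v, hv⟩ := exists_extension_vector (fun j => phiVec W 5 (e j)) hn (by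
    intro c hc
    have := ev5_zeros_le (a₂ := W.a₂ + W.a₁ ^ 2 / 4) (a₄ := W.a₄ + W.a₁ * W.a₃ / 2)
      (a₆ := W.a₆ + W.a₃ ^ 2 / 4) (hne c hc)
    refine le_trans (Finset.card_le_card_of_injOn (fun j => f (e j)) ?_ ?_) this
    · intro j hj
      simp only [coe_filter, mem_univ, true_and, Set.mem_ofPred_eq, hev] at hj
      simpa using hj
    · exact (hf.1.comp e.injective).injOn) hext
  refine ⟨![v 0, v 1, v 2 + (W.a₁ * v 1 + W.a₃ * v 0) / 2, v 3, v 4 + (W.a₁ * v 3 + W.a₃ * v 1) / 2],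
    ?_⟩
  intro c hc s hs hzero h0
  set c' : Fin 5 → F := ![c 0 + c 2 * W.a₃ / 2, c 1 + c 2 * W.a₁ / 2 + c 4 * W.a₃ / 2, c 2,
    c 3 + c 4 * W.a₁ / 2, c 4] with hc'
  have hcc : ![c' 0 - c' 2 * W.a₃ / 2, c' 1 - c' 2 * W.a₁ / 2 - c' 4 * W.a₃ / 2,
      c' 2, c' 3 - c' 4 * W.a₁ / 2, c' 4] = c := by
    funext i
    fin_cases i <;> (simp [hc']; try ring)
  have hc'0 : c' ≠ 0 := by
    intro h
    apply hc
    rw [← hcc, h]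
    funext i
    fin_cases i <;> simp
  refine hv c' hc'0 ?_ ?_
  · refine hs.trans (Finset.card_le_card_of_surjOn (fun j => f (e j)) ?_)
    intro P hP
    obtain ⟨P', rfl⟩ := hf.2 P
    refine ⟨e.symm P', ?_, by simp⟩
    simp only [coe_filter, mem_univ, true_and, Set.mem_ofPred_eq, hev, hcc, Equiv.apply_symm_apply]
    exact hzero _ hP
  · rw [← h0]
    simp [Fin.sum_univ_five, hc']
    field_simp
    ring
end ExtVec

section Lines
open Polynomial WeierstrassCurve Finset
open scoped Classical
variable {F : Type} [Field F] [Fintype F] {a₂ a₄ a₆ : F}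

/-- Homogeneous coordinates `(1, x, y)` of a point. -/
def vec3 : (shortCurve a₂ a₄ a₆).toAffine.Point → Fin 3 → F
  | .zero => ![0, 0, 1]
  | .some x y _ => ![1, x, y]

lemma ev3_eq_dot (l : Fin 3 → F) (P : (shortCurve a₂ a₄ a₆).toAffine.Point) :
    ev3 l P = l ⬝ᵥ vec3 P := by
  rcases P with _ | ⟨x, y, h⟩ <;> simp [ev3, vec3, dotProduct, Fin.sum_univ_three]

lemma third_point_on_line {l : Fin 3 → F} {A B : (shortCurve a₂ a₄ a₆).toAffine.Point}
    (hA : ev3 l A = 0) (hB : ev3 l B = 0) (hAB : A ≠ B) : ev3 l (-(A + B)) = 0 := by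
  have inf : ∀ {B : (shortCurve a₂ a₄ a₆).toAffine.Point},
      ev3 l (.zero : (shortCurve a₂ a₄ a₆).toAffine.Point) = 0 → ev3 l B = 0 → B ≠ .zero →
      ev3 l (-B) = 0 := by
    intro B h0 hB hne
    rcases B with _ | ⟨x, y, h⟩
    · exact absurd rfl hne
    · obtain ⟨h', e⟩ := short_neg h
      rw [e]
      simp only [ev3] at h0 hB ⊢
      rw [h0] at hB ⊢
      linear_combination hB
  rcases A with _ | ⟨x₁, y₁, h₁⟩
  · rw [← Affine.Point.zero_def, zero_add]
    exact inf hA hB (Ne.symm hAB)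
  · rcases B with _ | ⟨x₂, y₂, h₂⟩
    · rw [← Affine.Point.zero_def, add_zero]
      exact inf hB hA hAB
    · by_cases hx : x₁ = x₂
      · subst hx
        rcases short_eq_of_X_eq h₁ h₂ with rfl | hy
        · exact absurd rfl hAB
        · rw [short_add_neg h₁ h₂ hy, neg_zero, Affine.Point.zero_def]
          simp only [ev3] at hA hB ⊢
          have hne : y₁ - y₂ ≠ 0 := by
            intro h
            obtain rfl := sub_eq_zero.1 h
            exact hAB rfl
          have : l 2 * (y₁ - y₂) = 0 := by linear_combination hA - hB
          exact (mul_eq_zero.1 this).resolve_right hne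
      · obtain ⟨h₃, e⟩ := short_add h₁ h₂ hx _ _ _ rfl rfl rfl
        obtain ⟨h₄, e'⟩ := short_neg h₃
        rw [e, e']
        have hx' : x₁ - x₂ ≠ 0 := sub_ne_zero.2 hx
        simp only [ev3] at hA hB ⊢
        set m := (y₁ - y₂) / (x₁ - x₂) with hm
        have hm' : m * (x₁ - x₂) = y₁ - y₂ := by rw [hm]; field_simp
        have h1 : (x₁ - x₂) * (l 1 + l 2 * m) = 0 := by linear_combination hA - hB + l 2 * hm'
        have h2 := (mul_eq_zero.1 h1).resolve_left hx'
        linear_combination hA + (m ^ 2 - a₂ - x₁ - x₂ - x₁) * h2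

lemma exists_line (u w : Fin 3 → F) : ∃ l : Fin 3 → F, l ≠ 0 ∧ l ⬝ᵥ u = 0 ∧ l ⬝ᵥ w = 0 := by
  let φ : (Fin 3 → F) →ₗ[F] (Fin 2 → F) := (Matrix.of ![u, w]).mulVecLin
  have hker : LinearMap.ker φ ≠ ⊥ := LinearMap.ker_ne_bot_of_finrank_lt (by simp)
  obtain ⟨l, hl, h0⟩ := Submodule.exists_mem_ne_zero_of_ne_bot hker
  have hl' : φ l = 0 := hl
  exact ⟨l, h0, (dotProduct_comm _ _).trans (congrFun hl' 0),
    (dotProduct_comm _ _).trans (congrFun hl' 1)⟩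

lemma card_two_torsion (h2 : (2 : F) ≠ 0) :
    #{T : (shortCurve a₂ a₄ a₆).toAffine.Point | T + T = 0} ≤ 4 := by
  have key := card_filter_point_le
    (p := fun T : (shortCurve a₂ a₄ a₆).toAffine.Point => T + T = 0) (A := (0 : F[X])) (B := 1)
    (Or.inr one_ne_zero) fun x y h hT => by
      by_contra hy
      simp only [eval_zero, eval_one, one_mul, zero_add] at hy
      obtain ⟨h', e⟩ := short_double h2 h hy _ _ _ rfl rfl rfl
      rw [e] at hT
      exact Affine.Point.some_ne_zero _ hT
  have hdeg : ((0 : F[X]) ^ 2 - cubicPoly a₂ a₄ a₆ * 1 ^ 2).natDegree = 3 := by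
    simp [cubicPoly_natDegree]
  rw [hdeg] at key
  refine (le_of_eq (by congr)).trans (key.trans ?_)
  split_ifs <;> norm_num

lemma card_halves (h2 : (2 : F) ≠ 0) (c : (shortCurve a₂ a₄ a₆).toAffine.Point) :
    #{T | T + T = c} ≤ 4 := by
  by_cases hne : ∃ T₀, T₀ + T₀ = c
  · obtain ⟨T₀, rfl⟩ := hne
    refine le_trans (card_le_card_of_injOn (fun T => T - T₀) ?_ ?_)
      (card_two_torsion (a₂ := a₂) (a₄ := a₄) (a₆ := a₆) h2)
    · intro T hT
      simp only [coe_filter, mem_univ, true_and, Set.mem_ofPred_eq] at hT ⊢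
      have : T - T₀ + (T - T₀) = (T + T) - (T₀ + T₀) := by abel
      rw [this, hT, sub_self]
    · exact (sub_left_injective).injOn
  · push Not at hne
    rw [Finset.filter_eq_empty_iff.2 fun T _ => hne T]
    simp

/-- An extension vector is not proportional to the image of a point. -/
lemma IsExtVec.not_point (h2 : (2 : F) ≠ 0)
    (hn : 20 ≤ Fintype.card (shortCurve a₂ a₄ a₆).toAffine.Point) {v : Fin 5 → F}
    (hv : IsExtVec a₂ a₄ a₆ v) (t : F) (P : (shortCurve a₂ a₄ a₆).toAffine.Point) :
    ¬ ∀ c : Fin 5 → F, ∑ i, c i * v i = t * ev5 c P := by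
  intro hP
  obtain ⟨T, hT⟩ : ∃ T, T ∉ insert P (insert (-(P + P)) (univ.filter fun T => T + T = -P)) := by
    refine Finset.exists_mem_notMem_of_card_lt_card (s := _) (t := univ) ?_ |>.imp fun T h => h.2
    rw [Finset.card_univ]
    have h1 := card_halves h2 (-P)
    have h3 := card_insert_le (-(P + P)) (univ.filter fun T => T + T = -P)
    have h4 := card_insert_le P (insert (-(P + P)) (univ.filter fun T => T + T = -P))
    omega
  simp only [mem_insert, mem_filter, mem_univ, true_and, not_or] at hT
  obtain ⟨hT1, hT2, hT3⟩ := hT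
  obtain ⟨S, hS⟩ : ∃ S, S = -(P + T) := ⟨_, rfl⟩
  have hSP : S ≠ P := by
    intro h
    apply hT2
    have : P + T = -P := by rw [← neg_eq_iff_eq_neg]; exact hS.symm.trans h
    rw [eq_sub_of_add_eq' this]
    abel
  have hST : S ≠ T := by
    intro h
    apply hT3
    have : P + T = -T := by nth_rewrite 2 [← h]; rw [hS, neg_neg]
    rw [eq_sub_of_add_eq this]
    abel
  obtain ⟨R, hR⟩ : ∃ R, R ∉ (({P, T, S, -P, -T, -S} : Finset _) ∪ univ.filter fun T => T + T = 0) := by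
    refine Finset.exists_mem_notMem_of_card_lt_card (s := _) (t := univ) ?_ |>.imp fun T h => h.2
    rw [Finset.card_univ]
    have h1 := card_two_torsion (a₂ := a₂) (a₄ := a₄) (a₆ := a₆) h2
    have h3 := card_union_le ({P, T, S, -P, -T, -S} : Finset _) (univ.filter fun T => T + T = 0)
    have h4 := card_le_six (a := P) (b := T) (c := S) (d := -P) (e := -T) (f := -S)
    omega
  simp only [mem_union, mem_insert, mem_singleton, mem_filter, mem_univ, true_and, not_or] at hR
  obtain ⟨⟨hRP, hRT, hRS, hRP', hRT', hRS'⟩, hRR⟩ := hR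
  obtain ⟨l, hl0, hlP, hlT⟩ := exists_line (vec3 P) (vec3 T)
  rw [← ev3_eq_dot] at hlP hlT
  have hlS : ev3 l S = 0 := hS ▸ third_point_on_line hlP hlT (Ne.symm hT1)
  rcases hR0 : R with _ | ⟨k, y, h⟩
  · rw [hR0] at hRR
    exact hRR (add_zero (0 : (shortCurve a₂ a₄ a₆).toAffine.Point))
  set c : Fin 5 → F := ![-k * l 0, l 0 - k * l 1, -k * l 2, l 1, l 2] with hc
  have hev : ∀ Z : (shortCurve a₂ a₄ a₆).toAffine.Point, ev3 l Z = 0 → ev5 c Z = 0 := by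
    intro Z hZ
    rcases Z with _ | ⟨x, y, h⟩
    · simpa [ev3, ev5, hc] using hZ
    · simp only [ev3] at hZ
      simp [ev5, hc]
      linear_combination (x - k) * hZ
  have hevR : ev5 c R = 0 := by
    rw [hR0]; simp [ev5, hc]; ring
  have hevR' : ev5 c (-R) = 0 := by
    obtain ⟨h', e⟩ := short_neg h
    rw [hR0, e]; simp [ev5, hc]; ring
  have hc0 : c ≠ 0 := by
    intro h
    apply hl0
    have i1 := congrFun h 1
    have i3 := congrFun h 3
    have i4 := congrFun h 4
    simp [hc] at i1 i3 i4
    simp [i3] at i1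
    funext i
    fin_cases i <;> simpa
  refine hv c hc0 {P, T, S, R, -R} ?_ ?_ (by rw [hP, hev P hlP, mul_zero])
  · have hRR' : R ≠ -R := fun h => hRR (by nth_rewrite 2 [h]; simp)
    have hn1 : ∀ {Z}, R ≠ -Z → Z ≠ -R := fun h h' => h (by rw [h', neg_neg])
    rw [card_insert_of_notMem, card_insert_of_notMem, card_insert_of_notMem, card_pair hRR']
    · simp [Ne.symm hRS, hn1 hRS']
    · simp [Ne.symm hRT, hn1 hRT', hST.symm]
    · simp [Ne.symm hRP, hn1 hRP', Ne.symm hT1, hSP.symm]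
  · intro Z hZ
    simp only [mem_insert, mem_singleton] at hZ
    rcases hZ with rfl | rfl | rfl | rfl | rfl
    · exact hev _ hlP
    · exact hev _ hlT
    · exact hev _ hlS
    · exact hevR
    · exact hevR'

/-- An extension vector does not satisfy all the quadrics through the image of the curve. -/
lemma IsExtVec.quadrics (h2 : (2 : F) ≠ 0) (hd : cubicDisc a₂ a₄ a₆ ≠ 0)
    (hn : 20 ≤ Fintype.card (shortCurve a₂ a₄ a₆).toAffine.Point) {v : Fin 5 → F}
    (hv : IsExtVec a₂ a₄ a₆ v) (h₁ : v 0 * v 3 - v 1 ^ 2 = 0) (h₂ : v 0 * v 4 - v 1 * v 2 = 0)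
    (h₃ : v 2 ^ 2 - (v 1 * v 3 + a₂ * v 0 * v 3 + a₄ * v 0 * v 1 + a₆ * v 0 ^ 2) = 0)
    (h₅ : v 2 * v 4 - (v 3 ^ 2 + a₂ * v 1 * v 3 + a₄ * v 1 ^ 2 + a₆ * v 0 * v 1) = 0) : False := by
  by_cases h0 : v 0 = 0
  · have v1 : v 1 = 0 := by simpa [h0] using h₁
    have v2 : v 2 = 0 := by simpa [h0, v1] using h₃
    have v3 : v 3 = 0 := by simpa [h0, v1, v2] using h₅
    refine hv.not_point h2 hn (v 4) .zero fun c => ?_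
    simp [Fin.sum_univ_five, ev5, h0, v1, v2, v3, mul_comm]
  · have hns : (shortCurve a₂ a₄ a₆).toAffine.Nonsingular (v 1 / v 0) (v 2 / v 0) := by
      rw [shortCurve_nonsingular h2 hd]
      field_simp
      linear_combination v 0 * h₃ + v 1 * h₁ + a₂ * v 0 * h₁
    refine hv.not_point h2 hn (v 0) (.some _ _ hns) fun c => ?_
    simp only [Fin.sum_univ_five, ev5]
    field_simp
    linear_combination c 3 * h₁ + c 4 * h₂
end Lines

section Pencil
open Polynomial WeierstrassCurve Finset
variable {F : Type} [Field F]

/-- The values on `v` of the monomials `1, X, Y, X², XY` in the coordinates `X = x - a`,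
`Y = y - b - m X`, where `v` lists the values of `1, x, y, x², xy`. -/
def shift (a b m : F) (v : Fin 5 → F) : Fin 5 → F :=
  ![v 0, v 1 - a * v 0, v 2 - b * v 0 - m * (v 1 - a * v 0), v 3 - 2 * a * v 1 + a ^ 2 * v 0,
    v 4 - b * v 1 - a * v 2 + a * b * v 0 - m * (v 3 - 2 * a * v 1 + a ^ 2 * v 0)]

/-- The vector of values of `XY · (1, x, y)(R - τ)`, with `τ = (a, b)` and `m` the slope of the
tangent at `τ`. -/
def pencil₁ (a₂ a b m : F) (v : Fin 5 → F) : Fin 3 → F :=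
  let V := shift a b m v
  let A := 3 * a + a₂ - m ^ 2
  let p := 2 * b * (V 3 + A * V 1)
  ![V 4, a * V 4 + p, b * V 4 + m * p
    - 2 * b * (V 4 + 2 * m * V 3 + (2 * b + 2 * m * A) * V 1 + A * V 2 + A * (2 * b) * V 0)]

/-- The vector of values of `(A X² - 2 b Y) · (1, x, y)(R - τ)`, where `A = 3 a + a₂ - m²`. -/
def pencil₂ (a₂ a b m : F) (v : Fin 5 → F) : Fin 3 → F :=
  let V := shift a b m v
  let A := 3 * a + a₂ - m ^ 2
  let u := A * V 3 - 2 * b * V 2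
  let p := 2 * b * (A * V 2 + (2 * m * A - 2 * b) * V 1)
  ![u, a * u + p, b * u + m * p
    - 2 * b * (A * V 3 + A ^ 2 * V 1 + (2 * m * A - 2 * b) * (V 2 + 2 * m * V 1 + 2 * b * V 0))]

/-- The pencil spanned by `pencil₁` and `pencil₂`. -/
def pencil (a₂ a b m σ : F) (v : Fin 5 → F) : Fin 3 → F :=
  pencil₂ a₂ a b m v + σ • pencil₁ a₂ a b m v

/-- Values of the monomials `1, x, y, x², xy` at a point. -/
def vec5 {a₂ a₄ a₆ : F} : (shortCurve a₂ a₄ a₆).toAffine.Point → Fin 5 → F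
  | .zero => ![0, 0, 0, 0, 1]
  | .some x y _ => ![1, x, y, x ^ 2, x * y]

/-- The coefficients of the linear form `l ⬝ᵥ pencil a₂ a b m σ v` in `v`. -/
def pencilCoeff (a₂ a b m σ : F) (l : Fin 3 → F) (i : Fin 5) : F :=
  l ⬝ᵥ pencil a₂ a b m σ (Pi.single i 1)

lemma sum_pencilCoeff_mul (a₂ a b m σ : F) (l : Fin 3 → F) (v : Fin 5 → F) :
    ∑ i, pencilCoeff a₂ a b m σ l i * v i = l ⬝ᵥ pencil a₂ a b m σ v := by
  simp [pencilCoeff, dotProduct, Fin.sum_univ_three, Fin.sum_univ_five, pencil, pencil₁, pencil₂,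
    shift, Pi.single_apply]
  ring

variable {a₂ a₄ a₆ : F}

lemma ev5_eq_sum (c : Fin 5 → F) (P : (shortCurve a₂ a₄ a₆).toAffine.Point) :
    ev5 c P = ∑ i, c i * vec5 P i := by
  rcases P with _ | ⟨x, y, h⟩ <;> simp [ev5, vec5, Fin.sum_univ_five]

lemma ev5_pencilCoeff (a b m σ : F) (l : Fin 3 → F) (P : (shortCurve a₂ a₄ a₆).toAffine.Point) :
    ev5 (pencilCoeff a₂ a b m σ l) P = l ⬝ᵥ pencil a₂ a b m σ (vec5 P) := by
  rw [ev5_eq_sum, sum_pencilCoeff_mul]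

/-- The relation between the `X`-coordinate and the slope of the chord through the base point. -/
lemma chord_relation {a b m s X : F} (hm : 2 * b * m = 3 * a ^ 2 + 2 * a₂ * a + a₄)
    (hτ : b ^ 2 = a ^ 3 + a₂ * a ^ 2 + a₄ * a + a₆) (hX : X ≠ 0)
    (hT : (s * X + b + m * X) ^ 2 = (a + X) ^ 3 + a₂ * (a + X) ^ 2 + a₄ * (a + X) + a₆) :
    3 * a + a₂ - m ^ 2 = s ^ 2 + 2 * m * s - X + 2 * b * s / X := by
  field_simp
  apply mul_left_cancel₀ hX
  linear_combination hτ - hT + X * hm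

open scoped Classical

lemma pencil_generic {a b m s X : F} (σ : F) (hX : X ≠ 0)
    (hA : 3 * a + a₂ - m ^ 2 = s ^ 2 + 2 * m * s - X + 2 * b * s / X) {x y : F}
    (hx : x = a - 2 * b * s / X)
    (hy : y = -b - (m + s) * (x - a)) :
    pencil a₂ a b m σ ![1, x, y, x ^ 2, x * y] =
      pencil a₂ a b m σ ![1, x, y, x ^ 2, x * y] 0 • ![1, a + X, s * X + b + m * X] := by
  subst hx hy
  funext i
  fin_cases i
  · simp
  · simp [pencil, pencil₁, pencil₂, shift, hA]
    field_simp
    ring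
  · simp [pencil, pencil₁, pencil₂, shift, hA]
    field_simp
    ring

/-- On the curve translated by the base point the pencil vector is a multiple of `(1, x, y)`. -/
lemma exists_pencil_eq_smul (h2 : (2 : F) ≠ 0) {a b m : F}
    (hm : 2 * b * m = 3 * a ^ 2 + 2 * a₂ * a + a₄) (hb : b ≠ 0)
    (hτ : (shortCurve a₂ a₄ a₆).toAffine.Nonsingular a b) (σ : F)
    (T : (shortCurve a₂ a₄ a₆).toAffine.Point) :
    ∃ k : F, pencil a₂ a b m σ (vec5 (T + .some a b hτ)) = k • vec3 T ∧
      (T ≠ 0 → k = pencil a₂ a b m σ (vec5 (T + .some a b hτ)) 0) := by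
  rcases T with _ | ⟨x, y, h⟩
  · refine ⟨pencil a₂ a b m σ ![1, a, b, a ^ 2, a * b] 2, ?_, fun h => absurd rfl h⟩
    rw [← Affine.Point.zero_def, zero_add]
    funext i
    fin_cases i <;> simp [pencil, pencil₁, pencil₂, shift, vec5, vec3] <;> ring
  refine ⟨_, ?_, fun _ => rfl⟩
  by_cases hx : x = a
  · subst hx
    rcases short_eq_of_X_eq h hτ with rfl | hy
    · obtain ⟨h', e⟩ := short_double h2 h hb m _ _ (by rw [← hm]; field_simp) rfl rfl
      rw [e]
      funext i
      fin_cases i <;> simp [pencil, pencil₁, pencil₂, shift, vec5, vec3] <;> ring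
    · rw [short_add_neg h hτ hy]
      subst hy
      funext i
      fin_cases i <;> simp [pencil, pencil₁, pencil₂, shift, vec5, vec3] <;> ring
  · have hX : x - a ≠ 0 := sub_ne_zero.2 hx
    obtain ⟨X, hXe⟩ : ∃ X, X = x - a := ⟨_, rfl⟩
    obtain ⟨s, hs⟩ : ∃ s, s = (y - b) / (x - a) - m := ⟨_, rfl⟩
    rw [← hXe] at hX hs
    have hx' : x = a + X := by rw [hXe]; ring
    have hy' : y = s * X + b + m * X := by rw [hs]; field_simp; ring
    have hA := chord_relation hm (shortCurve_equation.1 hτ.1) hX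
      (by rw [← hx', ← hy']; exact shortCurve_equation.1 h.1)
    obtain ⟨h', e⟩ := short_add h hτ hx (s + m) (a - 2 * b * s / X) _
      (by rw [← hXe, hs]; ring) (by rw [hx']; linear_combination hA) rfl
    rw [e]
    simp only [vec5, vec3]
    rw [hx', hy']
    refine pencil_generic σ hX hA rfl ?_
    field_simp
    ring

/-- The two residual zeros of the pencil. -/
lemma pencil_residual {a b m : F}
    (hm : 2 * b * m = 3 * a ^ 2 + 2 * a₂ * a + a₄)
    (hτ : (shortCurve a₂ a₄ a₆).toAffine.Nonsingular a b) {x y : F}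
    (hS : (shortCurve a₂ a₄ a₆).toAffine.Nonsingular x y) (hx : x ≠ a) :
    pencil a₂ a b m ((y - b) / (x - a) - m) (vec5 (.some x y hS - .some a b hτ)) = 0 := by
  have hX : x - a ≠ 0 := sub_ne_zero.2 hx
  obtain ⟨X, hXe⟩ : ∃ X, X = x - a := ⟨_, rfl⟩
  obtain ⟨s, hs⟩ : ∃ s, s = (y - b) / (x - a) - m := ⟨_, rfl⟩
  rw [← hs]
  rw [← hXe] at hX hs
  have hx' : x = a + X := by rw [hXe]; ring
  have hy' : y = s * X + b + m * X := by rw [hs]; field_simp; ring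
  have hA := chord_relation hm (shortCurve_equation.1 hτ.1) hX
    (by rw [← hx', ← hy']; exact shortCurve_equation.1 hS.1)
  obtain ⟨h₀, e₀⟩ := short_neg hτ
  obtain ⟨z, hz⟩ : ∃ z, z = s + m + 2 * b / X := ⟨_, rfl⟩
  obtain ⟨h', e⟩ := short_add hS h₀ hx z (a + 2 * b / X * (s + 2 * b / X + 2 * m)) _
      (by rw [← hXe, hy', hz]; field_simp; ring)
      (by rw [hx', hz]; linear_combination hA) rfl
  rw [sub_eq_add_neg, e₀, e]
  simp only [vec5]
  rw [hx', hy', hz]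
  funext i
  fin_cases i <;> simp [pencil, pencil₁, pencil₂, shift, hA] <;> field_simp <;> ring
end Pencil

section Slopes
open Polynomial WeierstrassCurve Finset
open scoped Classical
variable {F : Type} [Field F] [Fintype F] {a₂ a₄ a₆ : F}

lemma pencilCoeff_ne_zero (h2 : (2 : F) ≠ 0)
    (hn : 20 ≤ Fintype.card (shortCurve a₂ a₄ a₆).toAffine.Point) {a b m : F}
    (hm : 2 * b * m = 3 * a ^ 2 + 2 * a₂ * a + a₄) (hb : b ≠ 0)
    (hτ : (shortCurve a₂ a₄ a₆).toAffine.Nonsingular a b) (σ : F) {l : Fin 3 → F} (hl : l ≠ 0) :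
    pencilCoeff a₂ a b m σ l ≠ 0 := by
  intro hc
  set τ : (shortCurve a₂ a₄ a₆).toAffine.Point := .some a b hτ with hτe
  have he : pencilCoeff a₂ a b m σ ![1, 0, 0] ≠ 0 := by
    intro h
    have i2 := congrFun h 2
    have i4 := congrFun h 4
    simp [pencilCoeff, dotProduct, Fin.sum_univ_three, pencil, pencil₁, pencil₂, shift]
      at i2 i4
    simp [i4, h2, hb] at i2
  have hz := ev5_zeros_le (a₂ := a₂) (a₄ := a₄) (a₆ := a₆) he
  have hz' : #{T : (shortCurve a₂ a₄ a₆).toAffine.Point |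
      ev5 (pencilCoeff a₂ a b m σ ![1, 0, 0]) (T + τ) = 0} ≤ 5 := by
    refine le_trans (card_le_card_of_injOn (· + τ) ?_ ((add_left_injective τ).injOn)) hz
    intro T hT
    simpa using hT
  have hl3 := ev3_zeros_le (a₂ := a₂) (a₄ := a₄) (a₆ := a₆) hl
  obtain ⟨T, hT⟩ : ∃ T : (shortCurve a₂ a₄ a₆).toAffine.Point,
      T ∉ insert 0 ((univ.filter fun T => ev3 l T = 0) ∪
        univ.filter fun T => ev5 (pencilCoeff a₂ a b m σ ![1, 0, 0]) (T + τ) = 0) := by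
    refine Finset.exists_mem_notMem_of_card_lt_card (s := _) (t := univ) ?_ |>.imp fun T h => h.2
    rw [Finset.card_univ]
    refine lt_of_le_of_lt (card_insert_le _ _) ?_
    refine lt_of_le_of_lt (Nat.add_le_add_right (card_union_le _ _) 1) ?_
    omega
  simp only [mem_insert, mem_union, mem_filter, mem_univ, true_and, not_or] at hT
  obtain ⟨hT0, hT1, hT2⟩ := hT
  obtain ⟨k, hk, hk0⟩ := exists_pencil_eq_smul h2 hm hb hτ σ T
  have : ev5 (pencilCoeff a₂ a b m σ l) (T + τ) = 0 := by
    rw [hc, ev5_eq_sum]; simp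
  rw [ev5_pencilCoeff, hk, dotProduct_smul, ← ev3_eq_dot, smul_eq_mul] at this
  rcases mul_eq_zero.1 this with h | h
  · apply hT2
    rw [ev5_pencilCoeff, hτe]
    rw [hk0 hT0] at h
    simpa [dotProduct, Fin.sum_univ_three] using h
  · exact hT1 h

/-- The slope, relative to `m`, of the chord from `(a, b)`. -/
def chordSlope (a b m : F) : (shortCurve a₂ a₄ a₆).toAffine.Point → F
  | .zero => 0
  | .some x y _ => (y - b) / (x - a) - m

lemma ev3_chord {a b m : F} (hτ : (shortCurve a₂ a₄ a₆).toAffine.Nonsingular a b)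
    {S : (shortCurve a₂ a₄ a₆).toAffine.Point} (h0 : S ≠ 0) (h1 : S ≠ .some a b hτ)
    (h2 : S ≠ -.some a b hτ) {σ : F} :
    ev3 ![-b + (m + σ) * a, -(m + σ), 1] S = 0 ↔ chordSlope a b m S = σ := by
  rcases S with _ | ⟨x, y, h⟩
  · exact absurd rfl h0
  have hx : x ≠ a := by
    rintro rfl
    rcases short_eq_of_X_eq h hτ with rfl | hy
    · exact h1 rfl
    · obtain ⟨h', e⟩ := short_neg hτ
      subst hy
      exact h2 e.symm
  have hX := sub_ne_zero.2 hx
  simp [ev3, chordSlope]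
  rw [sub_eq_iff_eq_add, div_eq_iff hX]
  constructor <;> intro h <;> linear_combination h

lemma pencil_residual_chordSlope {a b m : F} (hm : 2 * b * m = 3 * a ^ 2 + 2 * a₂ * a + a₄)
    (hτ : (shortCurve a₂ a₄ a₆).toAffine.Nonsingular a b)
    {S : (shortCurve a₂ a₄ a₆).toAffine.Point} (h0 : S ≠ 0) (h1 : S ≠ .some a b hτ)
    (h2 : S ≠ -.some a b hτ) :
    pencil a₂ a b m (chordSlope a b m S) (vec5 (S - .some a b hτ)) = 0 := by
  rcases S with _ | ⟨x, y, h⟩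
  · exact absurd rfl h0
  refine pencil_residual hm hτ h ?_
  rintro rfl
  rcases short_eq_of_X_eq h hτ with rfl | hy
  · exact h1 rfl
  · obtain ⟨h', e⟩ := short_neg hτ
    subst hy
    exact h2 e.symm

lemma exists_slopes (h2 : (2 : F) ≠ 0)
    (hn : 20 ≤ Fintype.card (shortCurve a₂ a₄ a₆).toAffine.Point) {v : Fin 5 → F}
    (hv : IsExtVec a₂ a₄ a₆ v) {a b m : F}
    (hm : 2 * b * m = 3 * a ^ 2 + 2 * a₂ * a + a₄) (hb : b ≠ 0)
    (hτ : (shortCurve a₂ a₄ a₆).toAffine.Nonsingular a b) :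
    ∃ s : Finset F, Fintype.card (shortCurve a₂ a₄ a₆).toAffine.Point ≤ 2 * #s + 8 ∧
      ∀ σ ∈ s, ∃ P₁ P₂ : (shortCurve a₂ a₄ a₆).toAffine.Point, ∀ l : Fin 3 → F, l ≠ 0 →
        l ⬝ᵥ pencil a₂ a b m σ v = 0 →
        #{T : (shortCurve a₂ a₄ a₆).toAffine.Point | ev3 l T = 0} = 3 →
        ev3 l P₁ = 0 ∨ ev3 l P₂ = 0 := by
  obtain ⟨τ, hτe⟩ : ∃ τ : (shortCurve a₂ a₄ a₆).toAffine.Point, τ = .some a b hτ := ⟨_, rfl⟩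
  set bad : Finset (shortCurve a₂ a₄ a₆).toAffine.Point :=
    {0, τ, -τ, -(τ + τ)} ∪ univ.filter fun S => S + S = -τ with hbad
  have hbadc : #bad ≤ 8 := (card_union_le _ _).trans (Nat.add_le_add card_le_four (card_halves h2 (-τ)))
  refine ⟨(univ \ bad).image (chordSlope a b m), ?_, ?_⟩
  · have h1 : #(univ \ bad) ≤ 2 * #((univ \ bad).image (chordSlope a b m)) := by
      refine card_le_mul_card_image _ _ fun σ _ => ?_
      have hl : (![-b + (m + σ) * a, -(m + σ), 1] : Fin 3 → F) ≠ 0 := fun h => by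
        simpa using congrFun h 2
      have h3 := ev3_zeros_le (a₂ := a₂) (a₄ := a₄) (a₆ := a₆) hl
      have hsub : insert τ ({S ∈ univ \ bad | chordSlope a b m S = σ}) ⊆
          univ.filter fun S : (shortCurve a₂ a₄ a₆).toAffine.Point =>
            ev3 ![-b + (m + σ) * a, -(m + σ), 1] S = 0 := by
        intro S hS
        simp only [mem_insert, mem_filter, mem_sdiff, mem_univ, true_and] at hS ⊢
        rcases hS with rfl | ⟨hS, hσ⟩
        · rw [hτe]; simp [ev3]; ring
        · simp only [hbad, mem_union, mem_insert, mem_singleton, mem_filter, mem_univ, true_and,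
            not_or] at hS
          exact (ev3_chord hτ hS.1.1 (hτe ▸ hS.1.2.1) (hτe ▸ hS.1.2.2.1)).2 hσ
      have h4 := (card_le_card hsub).trans h3
      rw [card_insert_of_notMem (by simp [hbad])] at h4
      omega
    have h5 := le_card_sdiff bad univ
    rw [card_univ] at h5
    omega
  · intro σ hσ
    obtain ⟨S, hS, hSσ⟩ := mem_image.1 hσ
    simp only [hbad, mem_union, mem_insert, mem_singleton, mem_filter, mem_univ, true_and,
      not_or, mem_sdiff] at hS
    obtain ⟨⟨hS0, hS1, hS2, hS3⟩, hS4⟩ := hS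
    obtain ⟨S', hS'⟩ : ∃ S', S' = -(τ + S) := ⟨_, rfl⟩
    have hSS' : S + τ + S' = 0 := by rw [hS']; abel
    have k0 : S' ≠ 0 := fun h => hS2 (by rw [h, add_zero] at hSS'; exact eq_neg_of_add_eq_zero_left hSS')
    have k1 : S' ≠ τ := fun h => hS3 (by
      rw [h, add_assoc] at hSS'; exact eq_neg_of_add_eq_zero_left hSS')
    have k2 : S' ≠ -τ := fun h => hS0 (by rw [h, add_assoc, add_neg_cancel, add_zero] at hSS'; exact hSS')
    have k3 : S ≠ S' := fun h => hS4 (by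
      rw [← h, add_right_comm] at hSS'; exact eq_neg_of_add_eq_zero_left hSS')
    have hS'σ : chordSlope a b m S' = σ := by
      rw [← ev3_chord hτ k0 (hτe ▸ k1) (hτe ▸ k2), hS']
      refine third_point_on_line ?_ ?_ (Ne.symm hS1)
      · rw [hτe]; simp [ev3]; ring
      · exact (ev3_chord hτ hS0 (hτe ▸ hS1) (hτe ▸ hS2)).2 hSσ
    refine ⟨S - τ - τ, S' - τ - τ, fun l hl hlv hl3 => ?_⟩
    by_contra! hcon
    refine hv _ (pencilCoeff_ne_zero h2 hn hm hb hτ σ hl)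
      (insert (S - τ) (insert (S' - τ) ((univ.filter fun T => ev3 l T = 0).image (· + τ)))) ?_ ?_
      ((sum_pencilCoeff_mul _ _ _ _ _ _ _).trans hlv)
    · rw [card_insert_of_notMem, card_insert_of_notMem,
        card_image_of_injective _ (add_left_injective τ), hl3]
      · simp only [mem_image, mem_filter, mem_univ, true_and, not_exists, not_and]
        intro T hT h
        exact hcon.2 (by rwa [← h, add_sub_cancel_right])
      · simp only [mem_insert, mem_image, mem_filter, mem_univ, true_and, not_exists, not_and,
          not_or]
        refine ⟨fun h => k3 (sub_left_injective h), ?_⟩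
        intro T hT h
        exact hcon.1 (by rwa [← h, add_sub_cancel_right])
    · intro P hP
      rw [ev5_pencilCoeff]
      simp only [mem_insert, mem_image, mem_filter, mem_univ, true_and] at hP
      rcases hP with rfl | rfl | ⟨T, hT, rfl⟩
      · rw [← hSσ, hτe, pencil_residual_chordSlope hm hτ hS0 (hτe ▸ hS1) (hτe ▸ hS2),
          dotProduct_zero]
      · rw [← hS'σ, hτe, pencil_residual_chordSlope hm hτ k0 (hτe ▸ k1) (hτe ▸ k2),
          dotProduct_zero]
      · obtain ⟨k, hk, -⟩ := exists_pencil_eq_smul h2 hm hb hτ σ T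
        rw [hτe, hk, dotProduct_smul, ← ev3_eq_dot, hT, smul_zero]
end Slopes

section PencilDet
variable {R : Type*} [CommRing R]

/-- Coefficients of the part of the pencil determinant even in `b`. -/
def evenCoeff (a₂ a₄ a₆ : R) (z : Fin 8 → R) : Fin 8 → R :=
  ![(16 * a₂ ^ 3 * a₆ ^ 2 - 8 * a₂ ^ 2 * a₄ ^ 2 * a₆ + a₂ * a₄ ^ 4 - 28 * a₂ * a₄ * a₆ ^ 2 + 7 *
      a₄ ^ 3 * a₆ + 48 * a₆ ^ 3) * z 0 + (16 * a₂ ^ 2 * a₆ ^ 2 - 8 * a₂ * a₄ ^ 2 * a₆ + a₄ ^ 4) *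
      z 1 + (8 * a₂ * a₆ ^ 2 - 2 * a₄ ^ 2 * a₆) * z 2 + (8 * a₂ ^ 2 * a₆ ^ 2 - 6 * a₂ * a₄ ^ 2 *
      a₆ + a₄ ^ 4 + 8 * a₄ * a₆ ^ 2) * z 3 + (16 * a₂ * a₆ ^ 2 - 4 * a₄ ^ 2 * a₆) * z 4 + (4 * a₂
      * a₄ * a₆ - a₄ ^ 3) * z 5 + (-8 * a₂ * a₆ ^ 2 + 2 * a₄ ^ 2 * a₆) * z 6 + (4 * a₂ * a₄ * a₆
      - a₄ ^ 3 - 16 * a₆ ^ 2) * z 7,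
    (48 * a₂ ^ 2 * a₆ ^ 2 - 40 * a₂ * a₄ ^ 2 * a₆ + 7 * a₄ ^ 4 + 52 * a₄ * a₆ ^ 2) * z 0 + (72 *
      a₂ * a₆ ^ 2 - 18 * a₄ ^ 2 * a₆) * z 1 + (4 * a₂ * a₄ * a₆ - a₄ ^ 3 + 24 * a₆ ^ 2) * z 2 +
      (-8 * a₂ ^ 2 * a₄ * a₆ + 2 * a₂ * a₄ ^ 3 + 32 * a₂ * a₆ ^ 2 + 6 * a₄ ^ 2 * a₆) * z 3 + (12
      * a₂ * a₄ * a₆ - 3 * a₄ ^ 3 + 48 * a₆ ^ 2) * z 4 + (8 * a₂ ^ 2 * a₆ - 2 * a₂ * a₄ ^ 2 + 12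
      * a₄ * a₆) * z 5 + (-12 * a₂ * a₄ * a₆ + 3 * a₄ ^ 3 - 8 * a₆ ^ 2) * z 6 + (8 * a₂ ^ 2 * a₆
      - 2 * a₂ * a₄ ^ 2 - 20 * a₄ * a₆) * z 7,
    (-28 * a₂ ^ 2 * a₄ * a₆ + 7 * a₂ * a₄ ^ 3 + 108 * a₂ * a₆ ^ 2 + 7 * a₄ ^ 2 * a₆) * z 0 + (28
      * a₂ * a₄ * a₆ - 7 * a₄ ^ 3 + 72 * a₆ ^ 2) * z 1 + 24 * a₄ * a₆ * z 2 + (-8 * a₂ ^ 3 * a₆ +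
      2 * a₂ ^ 2 * a₄ ^ 2 + 8 * a₂ * a₄ * a₆ + 9 * a₄ ^ 3) * z 3 + (8 * a₂ ^ 2 * a₆ - 2 * a₂ * a₄
      ^ 2 + 60 * a₄ * a₆) * z 4 + (36 * a₂ * a₆ + 3 * a₄ ^ 2) * z 5 + (-16 * a₂ ^ 2 * a₆ + 4 * a₂
      * a₄ ^ 2 - 16 * a₄ * a₆) * z 6 + (4 * a₂ * a₆ - 13 * a₄ ^ 2) * z 7,
    (-16 * a₂ ^ 3 * a₆ + 4 * a₂ ^ 2 * a₄ ^ 2 + 4 * a₂ * a₄ * a₆ + 11 * a₄ ^ 3 + 60 * a₆ ^ 2) * z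
      0 + (16 * a₂ ^ 2 * a₆ - 4 * a₂ * a₄ ^ 2 + 48 * a₄ * a₆) * z 1 + (4 * a₂ * a₆ + 7 * a₄ ^ 2)
      * z 2 + (-24 * a₂ ^ 2 * a₆ + 26 * a₂ * a₄ ^ 2 - 32 * a₄ * a₆) * z 3 + (44 * a₂ * a₆ + 17 *
      a₄ ^ 2) * z 4 + (16 * a₂ * a₄ + 36 * a₆) * z 5 + (-44 * a₂ * a₆ + 3 * a₄ ^ 2) * z 6 + (-16
      * a₂ * a₄ + 4 * a₆) * z 7,
    (-36 * a₂ ^ 2 * a₆ + 19 * a₂ * a₄ ^ 2 + 17 * a₄ * a₆) * z 0 + (36 * a₂ * a₆ + 3 * a₄ ^ 2) * z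
      1 + (4 * a₂ * a₄ - 6 * a₆) * z 2 + (20 * a₂ ^ 2 * a₄ - 74 * a₂ * a₆ + 3 * a₄ ^ 2) * z 3 +
      (24 * a₂ * a₄ + 24 * a₆) * z 4 + (8 * a₂ ^ 2 + 21 * a₄) * z 5 + (-4 * a₂ * a₄ - 34 * a₆) *
      z 6 + (-8 * a₂ ^ 2 - 11 * a₄) * z 7,
    (4 * a₂ ^ 2 * a₄ - 36 * a₂ * a₆ + 13 * a₄ ^ 2) * z 0 + (4 * a₂ * a₄ + 18 * a₆) * z 1 - 3 * a₄
      * z 2 + (8 * a₂ ^ 3 + 2 * a₂ * a₄ - 54 * a₆) * z 3 + (8 * a₂ ^ 2 + 15 * a₄) * z 4 + 18 * a₂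
      * z 5 - 7 * a₄ * z 6 - 14 * a₂ * z 7,
    (5 * a₂ * a₄ - 15 * a₆) * z 0 + 3 * a₄ * z 1 - 4 * a₂ * z 2 + (10 * a₂ ^ 2 - 13 * a₄) * z 3 +
      10 * a₂ * z 4 + 9 * z 5 - 7 * z 7,
    a₄ * z 0 - 3 * z 2 + 2 * a₂ * z 3 + 3 * z 4 + z 6]

/-- Coefficients of the part of the pencil determinant odd in `b`. -/
def oddCoeff (a₂ a₄ a₆ : R) (z : Fin 7 → R) : Fin 7 → R :=
  ![(-8 * a₂ * a₆ ^ 2 + 2 * a₄ ^ 2 * a₆) * z 0 + (4 * a₂ * a₄ * a₆ - a₄ ^ 3 - 16 * a₆ ^ 2) * z 1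
      + (12 * a₂ * a₄ * a₆ - 3 * a₄ ^ 3 - 32 * a₆ ^ 2) * z 2 + (8 * a₂ ^ 2 * a₆ - 2 * a₂ * a₄ ^ 2
      - 8 * a₄ * a₆) * z 3 + (4 * a₂ * a₄ * a₆ - a₄ ^ 3 - 16 * a₆ ^ 2) * z 4 + (8 * a₂ * a₆ - 2 *
      a₄ ^ 2) * z 6,
    (-24 * a₂ * a₄ * a₆ + 6 * a₄ ^ 3 + 24 * a₆ ^ 2) * z 0 - 12 * a₄ * a₆ * z 1 + (16 * a₂ ^ 2 *
      a₆ - 4 * a₂ * a₄ ^ 2 - 20 * a₄ * a₆) * z 2 + (32 * a₂ * a₆ - 14 * a₄ ^ 2) * z 3 + (8 * a₂ ^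
      2 * a₆ - 2 * a₂ * a₄ ^ 2 - 20 * a₄ * a₆) * z 4 + (-8 * a₂ * a₆ + 2 * a₄ ^ 2) * z 5 + 24 *
      a₆ * z 6,
    (-32 * a₂ ^ 2 * a₆ + 8 * a₂ * a₄ ^ 2 + 4 * a₄ * a₆) * z 0 + (-28 * a₂ * a₆ + a₄ ^ 2) * z 1 +
      (12 * a₂ * a₆ - 9 * a₄ ^ 2) * z 2 + (-12 * a₂ * a₄ + 48 * a₆) * z 3 + (12 * a₂ * a₆ - 15 *
      a₄ ^ 2) * z 4 - 24 * a₆ * z 5 + 12 * a₄ * z 6,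
    (-56 * a₂ * a₆ + 12 * a₄ ^ 2) * z 0 + (-4 * a₂ * a₄ - 44 * a₆) * z 1 + (-4 * a₂ * a₄ - 4 *
      a₆) * z 2 + (-8 * a₂ ^ 2 + 4 * a₄) * z 3 + (-16 * a₂ * a₄ + 28 * a₆) * z 4 - 12 * a₄ * z 5
      + 8 * a₂ * z 6,
    -30 * a₆ * z 0 - 15 * a₄ * z 1 - 5 * a₄ * z 2 - 10 * a₂ * z 3 + (-8 * a₂ ^ 2 + a₄) * z 4 - 8
      * a₂ * z 5 + 6 * z 6,
    -2 * a₄ * z 0 - 4 * a₂ * z 1 - 6 * z 3 - 6 * a₂ * z 4 - 6 * z 5,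
    -z 1 + z 2 - z 4]

lemma evenCoeff_injective {K : Type*} [Field K] (h2 : (2 : K) ≠ 0) {a₂ a₄ a₆ : K}
    (hd : cubicDisc a₂ a₄ a₆ ≠ 0) {z : Fin 8 → K} (h : ∀ d, evenCoeff a₂ a₄ a₆ z d = 0) (i : Fin 8) :
    z i = 0 := by
  have e0 := h 0
  have e1 := h 1
  have e2 := h 2
  have e3 := h 3
  have e4 := h 4
  have e5 := h 5
  have e6 := h 6
  have e7 := h 7
  simp only [evenCoeff, Matrix.cons_val] at e0 e1 e2 e3 e4 e5 e6 e7
  have hne (k : ℕ) : (2 : K) ^ k * cubicDisc a₂ a₄ a₆ ^ 2 ≠ 0 :=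
    mul_ne_zero (pow_ne_zero _ h2) (pow_ne_zero _ hd)
  fin_cases i
  · refine (mul_eq_zero.1 (?_ : (2 : K) ^ 3 * cubicDisc a₂ a₄ a₆ ^ 2 * z 0 = 0)).resolve_left (hne 3)
    simp only [cubicDisc]
    linear_combination
      (4 * a₂ ^ 3 - 18 * a₂ * a₄ + 54 * a₆) * e0 + (-2 * a₂ ^ 2 * a₄ - 18 * a₂ * a₆ + 12 * a₄ ^
        2) * e1 + (12 * a₂ ^ 2 * a₆ - 2 * a₂ * a₄ ^ 2 - 18 * a₄ * a₆) * e2 + (-4 * a₂ ^ 3 * a₆ +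
        a₂ ^ 2 * a₄ ^ 2 + 27 * a₆ ^ 2) * e3 + (8 * a₂ ^ 2 * a₄ * a₆ - 2 * a₂ * a₄ ^ 3 - 36 * a₂ *
        a₆ ^ 2 + 6 * a₄ ^ 2 * a₆) * e4 + (24 * a₂ ^ 2 * a₆ ^ 2 - 22 * a₂ * a₄ ^ 2 * a₆ + 4 * a₄ ^
        4 + 18 * a₄ * a₆ ^ 2) * e5 + (-32 * a₂ ^ 3 * a₆ ^ 2 + 16 * a₂ ^ 2 * a₄ ^ 2 * a₆ - 2 * a₂
        * a₄ ^ 4 + 72 * a₂ * a₄ * a₆ ^ 2 - 18 * a₄ ^ 3 * a₆ - 108 * a₆ ^ 3) * e6 + (48 * a₂ ^ 4 *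
        a₆ ^ 2 - 24 * a₂ ^ 3 * a₄ ^ 2 * a₆ + 3 * a₂ ^ 2 * a₄ ^ 4 - 176 * a₂ ^ 2 * a₄ * a₆ ^ 2 +
        76 * a₂ * a₄ ^ 3 * a₆ + 252 * a₂ * a₆ ^ 3 - 8 * a₄ ^ 5 - 51 * a₄ ^ 2 * a₆ ^ 2) * e7
  · refine (mul_eq_zero.1 (?_ : (2 : K) ^ 3 * cubicDisc a₂ a₄ a₆ ^ 2 * z 1 = 0)).resolve_left (hne 3)
    simp only [cubicDisc]
    linear_combination
      (4 * a₂ ^ 4 - 28 * a₂ ^ 2 * a₄ - 36 * a₂ * a₆ + 60 * a₄ ^ 2) * e0 + (-2 * a₂ ^ 3 * a₄ + 42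
        * a₂ ^ 2 * a₆ + 2 * a₂ * a₄ ^ 2 - 90 * a₄ * a₆) * e1 + (-16 * a₂ ^ 3 * a₆ + 5 * a₂ ^ 2 *
        a₄ ^ 2 + 18 * a₂ * a₄ * a₆ - 8 * a₄ ^ 3 + 81 * a₆ ^ 2) * e2 + (4 * a₂ ^ 4 * a₆ - a₂ ^ 3 *
        a₄ ^ 2 + 4 * a₂ ^ 2 * a₄ * a₆ - 2 * a₂ * a₄ ^ 3 - 99 * a₂ * a₆ ^ 2 + 30 * a₄ ^ 2 * a₆) *
        e3 + (-8 * a₂ ^ 3 * a₄ * a₆ + 2 * a₂ ^ 2 * a₄ ^ 3 + 84 * a₂ ^ 2 * a₆ ^ 2 - 32 * a₂ * a₄ ^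
        2 * a₆ + 4 * a₄ ^ 4 - 18 * a₄ * a₆ ^ 2) * e4 + (-56 * a₂ ^ 3 * a₆ ^ 2 + 38 * a₂ ^ 2 * a₄
        ^ 2 * a₆ - 6 * a₂ * a₄ ^ 4 + 18 * a₂ * a₄ * a₆ ^ 2 - 10 * a₄ ^ 3 * a₆) * e5 + (48 * a₂ ^
        4 * a₆ ^ 2 - 24 * a₂ ^ 3 * a₄ ^ 2 * a₆ + 3 * a₂ ^ 2 * a₄ ^ 4 - 88 * a₂ ^ 2 * a₄ * a₆ ^ 2
        + 22 * a₂ * a₄ ^ 3 * a₆ + 72 * a₂ * a₆ ^ 3 + 15 * a₄ ^ 2 * a₆ ^ 2) * e6 + (-48 * a₂ ^ 5 *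
        a₆ ^ 2 + 24 * a₂ ^ 4 * a₄ ^ 2 * a₆ - 3 * a₂ ^ 3 * a₄ ^ 4 + 144 * a₂ ^ 3 * a₄ * a₆ ^ 2 -
        60 * a₂ ^ 2 * a₄ ^ 3 * a₆ - 156 * a₂ ^ 2 * a₆ ^ 3 + 6 * a₂ * a₄ ^ 5 + 35 * a₂ * a₄ ^ 2 *
        a₆ ^ 2 - 2 * a₄ ^ 4 * a₆ - 36 * a₄ * a₆ ^ 3) * e7
  · refine (mul_eq_zero.1 (?_ : (2 : K) ^ 4 * cubicDisc a₂ a₄ a₆ ^ 2 * z 2 = 0)).resolve_left (hne 4)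
    simp only [cubicDisc]
    linear_combination
      (-4 * a₂ ^ 3 * a₄ + 60 * a₂ ^ 2 * a₆ + 8 * a₂ * a₄ ^ 2 - 144 * a₄ * a₆) * e0 + (-12 * a₂ ^
        3 * a₆ + 5 * a₂ ^ 2 * a₄ ^ 2 - 18 * a₂ * a₄ * a₆ - 4 * a₄ ^ 3 + 189 * a₆ ^ 2) * e1 + (28
        * a₂ ^ 2 * a₄ * a₆ - 8 * a₂ * a₄ ^ 3 - 180 * a₂ * a₆ ^ 2 + 48 * a₄ ^ 2 * a₆) * e2 + (-4 *
        a₂ ^ 3 * a₄ * a₆ + a₂ ^ 2 * a₄ ^ 3 + 120 * a₂ ^ 2 * a₆ ^ 2 - 74 * a₂ * a₄ ^ 2 * a₆ + 12 *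
        a₄ ^ 4 + 9 * a₄ * a₆ ^ 2) * e3 + (-96 * a₂ ^ 3 * a₆ ^ 2 + 56 * a₂ ^ 2 * a₄ ^ 2 * a₆ - 8 *
        a₂ * a₄ ^ 4 + 108 * a₂ * a₄ * a₆ ^ 2 - 32 * a₄ ^ 3 * a₆ - 108 * a₆ ^ 3) * e4 + (80 * a₂ ^
        4 * a₆ ^ 2 - 40 * a₂ ^ 3 * a₄ ^ 2 * a₆ + 5 * a₂ ^ 2 * a₄ ^ 4 - 184 * a₂ ^ 2 * a₄ * a₆ ^ 2
        + 62 * a₂ * a₄ ^ 3 * a₆ + 180 * a₂ * a₆ ^ 3 - 4 * a₄ ^ 5 - 3 * a₄ ^ 2 * a₆ ^ 2) * e5 +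
        (-64 * a₂ ^ 5 * a₆ ^ 2 + 32 * a₂ ^ 4 * a₄ ^ 2 * a₆ - 4 * a₂ ^ 3 * a₄ ^ 4 + 192 * a₂ ^ 3 *
        a₄ * a₆ ^ 2 - 80 * a₂ ^ 2 * a₄ ^ 3 * a₆ - 192 * a₂ ^ 2 * a₆ ^ 3 + 8 * a₂ * a₄ ^ 5 + 32 *
        a₂ * a₄ ^ 2 * a₆ ^ 2 - 36 * a₄ * a₆ ^ 3) * e6 + (272 * a₂ ^ 4 * a₄ * a₆ ^ 2 - 136 * a₂ ^
        3 * a₄ ^ 3 * a₆ - 480 * a₂ ^ 3 * a₆ ^ 3 + 17 * a₂ ^ 2 * a₄ ^ 5 - 864 * a₂ ^ 2 * a₄ ^ 2 *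
        a₆ ^ 2 + 454 * a₂ * a₄ ^ 4 * a₆ + 2988 * a₂ * a₄ * a₆ ^ 3 - 52 * a₄ ^ 6 - 679 * a₄ ^ 3 *
        a₆ ^ 2 - 2160 * a₆ ^ 4) * e7
  · refine (mul_eq_zero.1 (?_ : (2 : K) ^ 3 * cubicDisc a₂ a₄ a₆ ^ 2 * z 3 = 0)).resolve_left (hne 3)
    simp only [cubicDisc]
    linear_combination
      (-2 * a₂ ^ 2 * a₄ - 18 * a₂ * a₆ + 12 * a₄ ^ 2) * e0 + (12 * a₂ ^ 2 * a₆ - 2 * a₂ * a₄ ^ 2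
        - 18 * a₄ * a₆) * e1 + (-4 * a₂ ^ 3 * a₆ + a₂ ^ 2 * a₄ ^ 2 + 27 * a₆ ^ 2) * e2 + (8 * a₂
        ^ 2 * a₄ * a₆ - 2 * a₂ * a₄ ^ 3 - 36 * a₂ * a₆ ^ 2 + 6 * a₄ ^ 2 * a₆) * e3 + (24 * a₂ ^ 2
        * a₆ ^ 2 - 22 * a₂ * a₄ ^ 2 * a₆ + 4 * a₄ ^ 4 + 18 * a₄ * a₆ ^ 2) * e4 + (-32 * a₂ ^ 3 *
        a₆ ^ 2 + 16 * a₂ ^ 2 * a₄ ^ 2 * a₆ - 2 * a₂ * a₄ ^ 4 + 72 * a₂ * a₄ * a₆ ^ 2 - 18 * a₄ ^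
        3 * a₆ - 108 * a₆ ^ 3) * e5 + (48 * a₂ ^ 4 * a₆ ^ 2 - 24 * a₂ ^ 3 * a₄ ^ 2 * a₆ + 3 * a₂
        ^ 2 * a₄ ^ 4 - 176 * a₂ ^ 2 * a₄ * a₆ ^ 2 + 76 * a₂ * a₄ ^ 3 * a₆ + 252 * a₂ * a₆ ^ 3 - 8
        * a₄ ^ 5 - 51 * a₄ ^ 2 * a₆ ^ 2) * e6 + (-64 * a₂ ^ 5 * a₆ ^ 2 + 32 * a₂ ^ 4 * a₄ ^ 2 *
        a₆ - 4 * a₂ ^ 3 * a₄ ^ 4 + 288 * a₂ ^ 3 * a₄ * a₆ ^ 2 - 128 * a₂ ^ 2 * a₄ ^ 3 * a₆ - 384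
        * a₂ ^ 2 * a₆ ^ 3 + 14 * a₂ * a₄ ^ 5 - 8 * a₂ * a₄ ^ 2 * a₆ ^ 2 + 22 * a₄ ^ 4 * a₆ + 144
        * a₄ * a₆ ^ 3) * e7
  · refine (mul_eq_zero.1 (?_ : (2 : K) ^ 3 * cubicDisc a₂ a₄ a₆ ^ 2 * z 4 = 0)).resolve_left (hne 3)
    simp only [cubicDisc]
    linear_combination
      (-2 * a₂ ^ 3 * a₄ + 42 * a₂ ^ 2 * a₆ + 2 * a₂ * a₄ ^ 2 - 90 * a₄ * a₆) * e0 + (-16 * a₂ ^ 3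
        * a₆ + 5 * a₂ ^ 2 * a₄ ^ 2 + 18 * a₂ * a₄ * a₆ - 8 * a₄ ^ 3 + 81 * a₆ ^ 2) * e1 + (4 * a₂
        ^ 4 * a₆ - a₂ ^ 3 * a₄ ^ 2 + 4 * a₂ ^ 2 * a₄ * a₆ - 2 * a₂ * a₄ ^ 3 - 99 * a₂ * a₆ ^ 2 +
        30 * a₄ ^ 2 * a₆) * e2 + (-8 * a₂ ^ 3 * a₄ * a₆ + 2 * a₂ ^ 2 * a₄ ^ 3 + 84 * a₂ ^ 2 * a₆
        ^ 2 - 32 * a₂ * a₄ ^ 2 * a₆ + 4 * a₄ ^ 4 - 18 * a₄ * a₆ ^ 2) * e3 + (-56 * a₂ ^ 3 * a₆ ^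
        2 + 38 * a₂ ^ 2 * a₄ ^ 2 * a₆ - 6 * a₂ * a₄ ^ 4 + 18 * a₂ * a₄ * a₆ ^ 2 - 10 * a₄ ^ 3 *
        a₆) * e4 + (48 * a₂ ^ 4 * a₆ ^ 2 - 24 * a₂ ^ 3 * a₄ ^ 2 * a₆ + 3 * a₂ ^ 2 * a₄ ^ 4 - 88 *
        a₂ ^ 2 * a₄ * a₆ ^ 2 + 22 * a₂ * a₄ ^ 3 * a₆ + 72 * a₂ * a₆ ^ 3 + 15 * a₄ ^ 2 * a₆ ^ 2) *
        e5 + (-48 * a₂ ^ 5 * a₆ ^ 2 + 24 * a₂ ^ 4 * a₄ ^ 2 * a₆ - 3 * a₂ ^ 3 * a₄ ^ 4 + 144 * a₂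
        ^ 3 * a₄ * a₆ ^ 2 - 60 * a₂ ^ 2 * a₄ ^ 3 * a₆ - 156 * a₂ ^ 2 * a₆ ^ 3 + 6 * a₂ * a₄ ^ 5 +
        35 * a₂ * a₄ ^ 2 * a₆ ^ 2 - 2 * a₄ ^ 4 * a₆ - 36 * a₄ * a₆ ^ 3) * e6 + (64 * a₂ ^ 6 * a₆
        ^ 2 - 32 * a₂ ^ 5 * a₄ ^ 2 * a₆ + 4 * a₂ ^ 4 * a₄ ^ 4 - 320 * a₂ ^ 4 * a₄ * a₆ ^ 2 + 144
        * a₂ ^ 3 * a₄ ^ 3 * a₆ + 416 * a₂ ^ 3 * a₆ ^ 3 - 16 * a₂ ^ 2 * a₄ ^ 5 + 216 * a₂ ^ 2 * a₄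
        ^ 2 * a₆ ^ 2 - 124 * a₂ * a₄ ^ 4 * a₆ - 864 * a₂ * a₄ * a₆ ^ 3 + 12 * a₄ ^ 6 + 172 * a₄ ^
        3 * a₆ ^ 2 + 648 * a₆ ^ 4) * e7
  · refine (mul_eq_zero.1 (?_ : (2 : K) ^ 4 * cubicDisc a₂ a₄ a₆ ^ 2 * z 5 = 0)).resolve_left (hne 4)
    simp only [cubicDisc]
    linear_combination
      (-60 * a₂ ^ 3 * a₆ + 17 * a₂ ^ 2 * a₄ ^ 2 + 198 * a₂ * a₄ * a₆ - 52 * a₄ ^ 3 - 135 * a₆ ^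
        2) * e0 + (16 * a₂ ^ 4 * a₆ - 4 * a₂ ^ 3 * a₄ ^ 2 - 44 * a₂ ^ 2 * a₄ * a₆ + 8 * a₂ * a₄ ^
        3 - 72 * a₂ * a₆ ^ 2 + 48 * a₄ ^ 2 * a₆) * e1 + (-20 * a₂ ^ 3 * a₄ * a₆ + 5 * a₂ ^ 2 * a₄
        ^ 3 + 120 * a₂ ^ 2 * a₆ ^ 2 - 2 * a₂ * a₄ ^ 2 * a₆ - 4 * a₄ ^ 4 - 99 * a₄ * a₆ ^ 2) * e2
        + (-48 * a₂ ^ 3 * a₆ ^ 2 + 44 * a₂ ^ 2 * a₄ ^ 2 * a₆ - 8 * a₂ * a₄ ^ 4 - 108 * a₂ * a₄ *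
        a₆ ^ 2 + 16 * a₄ ^ 3 * a₆ + 216 * a₆ ^ 3) * e3 + (16 * a₂ ^ 4 * a₆ ^ 2 - 8 * a₂ ^ 3 * a₄
        ^ 2 * a₆ + a₂ ^ 2 * a₄ ^ 4 + 104 * a₂ ^ 2 * a₄ * a₆ ^ 2 - 74 * a₂ * a₄ ^ 3 * a₆ - 252 *
        a₂ * a₆ ^ 3 + 12 * a₄ ^ 5 + 105 * a₄ ^ 2 * a₆ ^ 2) * e4 + (-128 * a₂ ^ 3 * a₄ * a₆ ^ 2 +
        64 * a₂ ^ 2 * a₄ ^ 3 * a₆ + 240 * a₂ ^ 2 * a₆ ^ 3 - 8 * a₂ * a₄ ^ 5 + 68 * a₂ * a₄ ^ 2 *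
        a₆ ^ 2 - 32 * a₄ ^ 4 * a₆ - 252 * a₄ * a₆ ^ 3) * e5 + (80 * a₂ ^ 4 * a₄ * a₆ ^ 2 - 40 *
        a₂ ^ 3 * a₄ ^ 3 * a₆ - 96 * a₂ ^ 3 * a₆ ^ 3 + 5 * a₂ ^ 2 * a₄ ^ 5 - 96 * a₂ ^ 2 * a₄ ^ 2
        * a₆ ^ 2 + 46 * a₂ * a₄ ^ 4 * a₆ - 36 * a₂ * a₄ * a₆ ^ 3 - 4 * a₄ ^ 6 + 29 * a₄ ^ 3 * a₆
        ^ 2 + 432 * a₆ ^ 4) * e6 + (-64 * a₂ ^ 5 * a₄ * a₆ ^ 2 + 32 * a₂ ^ 4 * a₄ ^ 3 * a₆ - 4 *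
        a₂ ^ 3 * a₄ ^ 5 + 192 * a₂ ^ 3 * a₄ ^ 2 * a₆ ^ 2 - 80 * a₂ ^ 2 * a₄ ^ 4 * a₆ + 160 * a₂ ^
        2 * a₄ * a₆ ^ 3 + 8 * a₂ * a₄ ^ 6 - 184 * a₂ * a₄ ^ 3 * a₆ ^ 2 - 720 * a₂ * a₆ ^ 4 + 32 *
        a₄ ^ 5 * a₆ + 228 * a₄ ^ 2 * a₆ ^ 3) * e7
  · refine (mul_eq_zero.1 (?_ : (2 : K) ^ 4 * cubicDisc a₂ a₄ a₆ ^ 2 * z 6 = 0)).resolve_left (hne 4)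
    simp only [cubicDisc]
    linear_combination
      (12 * a₂ ^ 3 * a₆ - 3 * a₂ ^ 2 * a₄ ^ 2 - 54 * a₂ * a₄ * a₆ + 12 * a₄ ^ 3 + 81 * a₆ ^ 2) *
        e1 + (-8 * a₂ ^ 4 * a₆ + 2 * a₂ ^ 3 * a₄ ^ 2 + 36 * a₂ ^ 2 * a₄ * a₆ - 8 * a₂ * a₄ ^ 3 -
        54 * a₂ * a₆ ^ 2) * e2 + (12 * a₂ ^ 3 * a₄ * a₆ - 3 * a₂ ^ 2 * a₄ ^ 3 - 54 * a₂ * a₄ ^ 2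
        * a₆ + 12 * a₄ ^ 4 + 81 * a₄ * a₆ ^ 2) * e3 + (-48 * a₂ ^ 3 * a₆ ^ 2 + 12 * a₂ ^ 2 * a₄ ^
        2 * a₆ + 216 * a₂ * a₄ * a₆ ^ 2 - 48 * a₄ ^ 3 * a₆ - 324 * a₆ ^ 3) * e4 + (80 * a₂ ^ 4 *
        a₆ ^ 2 - 40 * a₂ ^ 3 * a₄ ^ 2 * a₆ + 5 * a₂ ^ 2 * a₄ ^ 4 - 360 * a₂ ^ 2 * a₄ * a₆ ^ 2 +
        170 * a₂ * a₄ ^ 3 * a₆ + 540 * a₂ * a₆ ^ 3 - 20 * a₄ ^ 5 - 135 * a₄ ^ 2 * a₆ ^ 2) * e5 +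
        (-96 * a₂ ^ 5 * a₆ ^ 2 + 48 * a₂ ^ 4 * a₄ ^ 2 * a₆ - 6 * a₂ ^ 3 * a₄ ^ 4 + 480 * a₂ ^ 3 *
        a₄ * a₆ ^ 2 - 216 * a₂ ^ 2 * a₄ ^ 3 * a₆ - 648 * a₂ ^ 2 * a₆ ^ 3 + 24 * a₂ * a₄ ^ 5 - 54
        * a₂ * a₄ ^ 2 * a₆ ^ 2 + 48 * a₄ ^ 4 * a₆ + 324 * a₄ * a₆ ^ 3) * e6 + (128 * a₂ ^ 6 * a₆
        ^ 2 - 64 * a₂ ^ 5 * a₄ ^ 2 * a₆ + 8 * a₂ ^ 4 * a₄ ^ 4 - 816 * a₂ ^ 4 * a₄ * a₆ ^ 2 + 376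
        * a₂ ^ 3 * a₄ ^ 3 * a₆ + 1056 * a₂ ^ 3 * a₆ ^ 3 - 43 * a₂ ^ 2 * a₄ ^ 5 + 816 * a₂ ^ 2 *
        a₄ ^ 2 * a₆ ^ 2 - 438 * a₂ * a₄ ^ 4 * a₆ - 2484 * a₂ * a₄ * a₆ ^ 3 + 44 * a₄ ^ 6 + 489 *
        a₄ ^ 3 * a₆ ^ 2 + 1296 * a₆ ^ 4) * e7
  · refine (mul_eq_zero.1 (?_ : (2 : K) ^ 4 * cubicDisc a₂ a₄ a₆ ^ 2 * z 7 = 0)).resolve_left (hne 4)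
    simp only [cubicDisc]
    linear_combination
      (-60 * a₂ ^ 3 * a₆ + 15 * a₂ ^ 2 * a₄ ^ 2 + 270 * a₂ * a₄ * a₆ - 60 * a₄ ^ 3 - 405 * a₆ ^
        2) * e0 + (16 * a₂ ^ 4 * a₆ - 4 * a₂ ^ 3 * a₄ ^ 2 - 72 * a₂ ^ 2 * a₄ * a₆ + 16 * a₂ * a₄
        ^ 3 + 108 * a₂ * a₆ ^ 2) * e1 + (-12 * a₂ ^ 3 * a₄ * a₆ + 3 * a₂ ^ 2 * a₄ ^ 3 + 54 * a₂ *
        a₄ ^ 2 * a₆ - 12 * a₄ ^ 4 - 81 * a₄ * a₆ ^ 2) * e2 + (24 * a₂ ^ 3 * a₆ ^ 2 - 6 * a₂ ^ 2 *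
        a₄ ^ 2 * a₆ - 108 * a₂ * a₄ * a₆ ^ 2 + 24 * a₄ ^ 3 * a₆ + 162 * a₆ ^ 3) * e3 + (-16 * a₂
        ^ 4 * a₆ ^ 2 + 8 * a₂ ^ 3 * a₄ ^ 2 * a₆ - a₂ ^ 2 * a₄ ^ 4 + 72 * a₂ ^ 2 * a₄ * a₆ ^ 2 -
        34 * a₂ * a₄ ^ 3 * a₆ - 108 * a₂ * a₆ ^ 3 + 4 * a₄ ^ 5 + 27 * a₄ ^ 2 * a₆ ^ 2) * e4 + (48
        * a₂ ^ 4 * a₄ * a₆ ^ 2 - 24 * a₂ ^ 3 * a₄ ^ 3 * a₆ - 96 * a₂ ^ 3 * a₆ ^ 3 + 3 * a₂ ^ 2 *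
        a₄ ^ 5 - 192 * a₂ ^ 2 * a₄ ^ 2 * a₆ ^ 2 + 102 * a₂ * a₄ ^ 4 * a₆ + 756 * a₂ * a₄ * a₆ ^ 3
        - 12 * a₄ ^ 6 - 177 * a₄ ^ 3 * a₆ ^ 2 - 648 * a₆ ^ 4) * e6 + (-64 * a₂ ^ 5 * a₄ * a₆ ^ 2
        + 32 * a₂ ^ 4 * a₄ ^ 3 * a₆ + 160 * a₂ ^ 4 * a₆ ^ 3 - 4 * a₂ ^ 3 * a₄ ^ 5 + 240 * a₂ ^ 3
        * a₄ ^ 2 * a₆ ^ 2 - 134 * a₂ ^ 2 * a₄ ^ 4 * a₆ - 1152 * a₂ ^ 2 * a₄ * a₆ ^ 3 + 16 * a₂ *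
        a₄ ^ 6 + 304 * a₂ * a₄ ^ 3 * a₆ ^ 2 + 1080 * a₂ * a₆ ^ 4 - 8 * a₄ ^ 5 * a₆ - 54 * a₄ ^ 2
        * a₆ ^ 3) * e7

lemma oddCoeff_injective {K : Type*} [Field K] (h2 : (2 : K) ≠ 0) {a₂ a₄ a₆ : K}
    (hd : cubicDisc a₂ a₄ a₆ ≠ 0) {z : Fin 7 → K} (h : ∀ d, oddCoeff a₂ a₄ a₆ z d = 0) (i : Fin 7) :
    z i = 0 := by
  have e0 := h 0
  have e1 := h 1
  have e2 := h 2
  have e3 := h 3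
  have e4 := h 4
  have e5 := h 5
  have e6 := h 6
  simp only [oddCoeff, Matrix.cons_val] at e0 e1 e2 e3 e4 e5 e6
  have hne (k : ℕ) : (2 : K) ^ k * cubicDisc a₂ a₄ a₆ ≠ 0 :=
    mul_ne_zero (pow_ne_zero _ h2) hd
  fin_cases i
  · refine (mul_eq_zero.1 (?_ : (2 : K) ^ 4 * cubicDisc a₂ a₄ a₆ * z 0 = 0)).resolve_left (hne 4)
    simp only [cubicDisc]
    linear_combination
      -3 * e1 + 2 * a₂ * e2 - 3 * a₄ * e3 + 12 * a₆ * e4 + (-20 * a₂ * a₆ + 5 * a₄ ^ 2) * e5 +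
        (24 * a₂ ^ 2 * a₆ - 6 * a₂ * a₄ ^ 2 - 12 * a₄ * a₆) * e6
  · refine (mul_eq_zero.1 (?_ : (2 : K) ^ 4 * cubicDisc a₂ a₄ a₆ * z 1 = 0)).resolve_left (hne 4)
    simp only [cubicDisc]
    linear_combination
      3 * e0 - a₄ * e2 + 6 * a₆ * e3 + (-12 * a₂ * a₆ + 3 * a₄ ^ 2) * e4 + (16 * a₂ ^ 2 * a₆ - 4
        * a₂ * a₄ ^ 2 - 8 * a₄ * a₆) * e5 + (-60 * a₂ * a₄ * a₆ + 15 * a₄ ^ 3 + 120 * a₆ ^ 2) *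
        e6
  · refine (mul_eq_zero.1 (?_ : (2 : K) ^ 4 * cubicDisc a₂ a₄ a₆ * z 2 = 0)).resolve_left (hne 4)
    simp only [cubicDisc]
    linear_combination
      9 * e0 - 2 * a₂ * e1 + a₄ * e2 + (-4 * a₂ * a₆ + a₄ ^ 2) * e4 + (8 * a₂ ^ 2 * a₆ - 2 * a₂ *
        a₄ ^ 2 - 4 * a₄ * a₆) * e5 + (-32 * a₂ ^ 3 * a₆ + 8 * a₂ ^ 2 * a₄ ^ 2 + 108 * a₂ * a₄ *
        a₆ - 23 * a₄ ^ 3 - 144 * a₆ ^ 2) * e6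
  · refine (mul_eq_zero.1 (?_ : (2 : K) ^ 4 * cubicDisc a₂ a₄ a₆ * z 3 = 0)).resolve_left (hne 4)
    simp only [cubicDisc]
    linear_combination
      -4 * a₂ * e0 + 3 * a₄ * e1 - 6 * a₆ * e2 + (4 * a₂ * a₆ - a₄ ^ 2) * e3 + (-12 * a₂ * a₄ *
        a₆ + 3 * a₄ ^ 3 + 24 * a₆ ^ 2) * e5 + (16 * a₂ ^ 2 * a₄ * a₆ - 4 * a₂ * a₄ ^ 3 - 40 * a₂
        * a₆ ^ 2 + 2 * a₄ ^ 2 * a₆) * e6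
  · refine (mul_eq_zero.1 (?_ : (2 : K) ^ 3 * cubicDisc a₂ a₄ a₆ * z 4 = 0)).resolve_left (hne 3)
    simp only [cubicDisc]
    linear_combination
      3 * e0 - a₂ * e1 + a₄ * e2 - 3 * a₆ * e3 + (4 * a₂ * a₆ - a₄ ^ 2) * e4 + (-4 * a₂ ^ 2 * a₆
        + a₂ * a₄ ^ 2 + 2 * a₄ * a₆) * e5 + (16 * a₂ ^ 3 * a₆ - 4 * a₂ ^ 2 * a₄ ^ 2 - 60 * a₂ *
        a₄ * a₆ + 13 * a₄ ^ 3 + 84 * a₆ ^ 2) * e6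
  · refine (mul_eq_zero.1 (?_ : (2 : K) ^ 3 * cubicDisc a₂ a₄ a₆ * z 5 = 0)).resolve_left (hne 3)
    simp only [cubicDisc]
    linear_combination
      -2 * a₂ * e0 + (a₂ ^ 2 - a₄) * e1 + (-a₂ * a₄ + 3 * a₆) * e2 + (-a₂ * a₆ + a₄ ^ 2) * e3 - 2
        * a₄ * a₆ * e4 + (4 * a₂ ^ 3 * a₆ - a₂ ^ 2 * a₄ ^ 2 - 14 * a₂ * a₄ * a₆ + 3 * a₄ ^ 3 + 24
        * a₆ ^ 2) * e5 + (-16 * a₂ ^ 4 * a₆ + 4 * a₂ ^ 3 * a₄ ^ 2 + 68 * a₂ ^ 2 * a₄ * a₆ - 15 *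
        a₂ * a₄ ^ 3 - 104 * a₂ * a₆ ^ 2 + a₄ ^ 2 * a₆) * e6
  · refine (mul_eq_zero.1 (?_ : (2 : K) ^ 4 * cubicDisc a₂ a₄ a₆ * z 6 = 0)).resolve_left (hne 4)
    simp only [cubicDisc]
    linear_combination
      (-4 * a₂ ^ 2 + 14 * a₄) * e0 + (a₂ * a₄ - 15 * a₆) * e1 + (8 * a₂ * a₆ - 2 * a₄ ^ 2) * e2 +
        (-4 * a₂ ^ 2 * a₆ + a₂ * a₄ ^ 2 + a₄ * a₆) * e3 + (8 * a₂ * a₄ * a₆ - 2 * a₄ ^ 3 - 12 *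
        a₆ ^ 2) * e4 + (-4 * a₂ ^ 2 * a₄ * a₆ + a₂ * a₄ ^ 3 + 4 * a₂ * a₆ ^ 2 + a₄ ^ 2 * a₆) * e5
        + (16 * a₂ ^ 3 * a₄ * a₆ - 4 * a₂ ^ 2 * a₄ ^ 3 - 64 * a₂ * a₄ ^ 2 * a₆ + 14 * a₄ ^ 4 + 92
        * a₄ * a₆ ^ 2) * e6

/-- The quadrics through the image of the curve. -/
def quadrics (a₂ a₄ a₆ : R) (v : Fin 5 → R) : Fin 5 → R :=
  ![v 0 * v 3 - v 1 ^ 2, v 0 * v 4 - v 1 * v 2,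
    v 2 ^ 2 - (v 1 * v 3 + a₂ * v 0 * v 3 + a₄ * v 0 * v 1 + a₆ * v 0 ^ 2),
    v 1 * v 4 - v 2 * v 3,
    v 2 * v 4 - (v 3 ^ 2 + a₂ * v 1 * v 3 + a₄ * v 1 ^ 2 + a₆ * v 0 * v 1)]

/-- Products of `w` and the quadrics entering the even part of the pencil determinant. -/
def evenProducts (w : Fin 3 → R) (Q : Fin 5 → R) : Fin 8 → R :=
  ![w 0 * Q 0, w 0 * Q 2, w 0 * Q 4, w 1 * Q 0, w 1 * Q 2, w 1 * Q 4, w 2 * Q 1, w 2 * Q 3]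

/-- Products of `w` and the quadrics entering the odd part of the pencil determinant. -/
def oddProducts (w : Fin 3 → R) (Q : Fin 5 → R) : Fin 7 → R :=
  ![w 0 * Q 1, w 0 * Q 3, w 1 * Q 1, w 1 * Q 3, w 2 * Q 0, w 2 * Q 2, w 2 * Q 4]

open Matrix in
lemma pencil_det {F : Type} [Field F] {a₂ a₄ a₆ a b m : F}
    (hm : 2 * b * m = 3 * a ^ 2 + 2 * a₂ * a + a₄)
    (hτ : b ^ 2 = a ^ 3 + a₂ * a ^ 2 + a₄ * a + a₆) (v : Fin 5 → F) (w : Fin 3 → F) :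
    4 * b ^ 2 * (w ⬝ᵥ (pencil₁ a₂ a b m v ⨯₃ pencil₂ a₂ a b m v)) =
      ∑ d, evenCoeff a₂ a₄ a₆ (evenProducts w (quadrics a₂ a₄ a₆ v)) d * a ^ (d : ℕ) +
      (∑ d, oddCoeff a₂ a₄ a₆ (oddProducts w (quadrics a₂ a₄ a₆ v)) d * a ^ (d : ℕ)) * b := by
  obtain rfl : a₄ = 2 * b * m - 3 * a ^ 2 - 2 * a₂ * a := by linear_combination -hm
  obtain rfl : a₆ = b ^ 2 - a ^ 3 - a₂ * a ^ 2 - (2 * b * m - 3 * a ^ 2 - 2 * a₂ * a) * a := by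
    linear_combination -hτ
  simp [cross_apply, dotProduct, Fin.sum_univ_succ, pencil₁, pencil₂, shift, evenCoeff, oddCoeff,
    evenProducts, oddProducts, quadrics]
  ring

end PencilDet

section Normal
open Polynomial WeierstrassCurve Finset Matrix
open scoped Classical LinearAlgebra.Projectivization
variable {F : Type} [Field F] [Fintype F] {a₂ a₄ a₆ : F}

/-- The slope of the tangent at a point. -/
def tangentSlope (a₂ a₄ x y : F) : F := (3 * x ^ 2 + 2 * a₂ * x + a₄) / (2 * y)

/-- The normal vector of the plane containing the pencil based at a point. -/
def normal (v : Fin 5 → F) : (shortCurve a₂ a₄ a₆).toAffine.Point → Fin 3 → F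
  | .zero => 0
  | .some x y _ => pencil₁ a₂ x y (tangentSlope a₂ a₄ x y) v ⨯₃
      pencil₂ a₂ x y (tangentSlope a₂ a₄ x y) v

lemma two_mul_tangentSlope (h2 : (2 : F) ≠ 0) {x y : F} (hy : y ≠ 0) :
    2 * y * tangentSlope a₂ a₄ x y = 3 * x ^ 2 + 2 * a₂ * x + a₄ := by
  rw [tangentSlope]; field_simp

lemma exists_eq_some_of_add_self_ne_zero {P : (shortCurve a₂ a₄ a₆).toAffine.Point}
    (hP : P + P ≠ 0) : ∃ x y h, P = .some x y h ∧ y ≠ 0 := by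
  rcases P with _ | ⟨x, y, h⟩
  · exact absurd (add_zero (0 : (shortCurve a₂ a₄ a₆).toAffine.Point)) hP
  · refine ⟨x, y, h, rfl, ?_⟩
    rintro rfl
    exact hP (short_add_neg h h (by simp))

lemma natDegree_sum_le {n : ℕ} (c : Fin n → F) :
    (∑ d, C (c d) * X ^ (d : ℕ) : F[X]).natDegree ≤ n - 1 := by
  refine natDegree_sum_le_of_forall_le _ _ fun d _ => ?_
  exact (natDegree_C_mul_X_pow_le _ _).trans (Nat.le_sub_one_of_lt d.2)

lemma coeff_sum_fin {n : ℕ} (c : Fin n → F) (d : Fin n) :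
    (∑ i, C (c i) * X ^ (i : ℕ) : F[X]).coeff d = c d := by
  simp [finsetSum_coeff, coeff_X_pow, Fin.val_inj]

lemma card_normal_le (h2 : (2 : F) ≠ 0) (hd : cubicDisc a₂ a₄ a₆ ≠ 0)
    (hn : 20 ≤ Fintype.card (shortCurve a₂ a₄ a₆).toAffine.Point) {v : Fin 5 → F}
    (hv : IsExtVec a₂ a₄ a₆ v) {w : Fin 3 → F} (hw : w ≠ 0) :
    #{P : (shortCurve a₂ a₄ a₆).toAffine.Point | P + P ≠ 0 ∧ w ⬝ᵥ normal v P = 0} ≤ 15 := by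
  set E := evenCoeff a₂ a₄ a₆ (evenProducts w (quadrics a₂ a₄ a₆ v)) with hE
  set O := oddCoeff a₂ a₄ a₆ (oddProducts w (quadrics a₂ a₄ a₆ v)) with hO
  have key := card_filter_point_le
    (p := fun P : (shortCurve a₂ a₄ a₆).toAffine.Point => P + P ≠ 0 ∧ w ⬝ᵥ normal v P = 0)
    (A := ∑ d, C (E d) * X ^ (d : ℕ)) (B := ∑ d, C (O d) * X ^ (d : ℕ)) ?_ ?_
  · have h0 : ¬ ((.zero : (shortCurve a₂ a₄ a₆).toAffine.Point) + .zero ≠ 0 ∧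
        w ⬝ᵥ normal v (.zero : (shortCurve a₂ a₄ a₆).toAffine.Point) = 0) := fun h =>
      h.1 (add_zero (0 : (shortCurve a₂ a₄ a₆).toAffine.Point))
    rw [if_neg h0, add_zero] at key
    refine (le_of_eq (by congr)).trans (key.trans ?_)
    refine (natDegree_sub_le _ _).trans (max_le ?_ ?_)
    · refine natDegree_pow_le.trans ?_
      have := natDegree_sum_le E
      omega
    · refine natDegree_mul_le.trans ?_
      have h1 := natDegree_pow_le (p := ∑ d, C (O d) * X ^ (d : ℕ)) (n := 2)
      have h2 := natDegree_sum_le O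
      rw [cubicPoly_natDegree]
      omega
  · by_contra! h
    have hE0 : ∀ d, E d = 0 := fun d => by rw [← coeff_sum_fin E d, h.1, coeff_zero]
    have hO0 : ∀ d, O d = 0 := fun d => by rw [← coeff_sum_fin O d, h.2, coeff_zero]
    have e := evenCoeff_injective h2 hd hE0
    have o := oddCoeff_injective h2 hd hO0
    have hall : ∀ i j, w i * quadrics a₂ a₄ a₆ v j = 0 := by
      intro i j
      fin_cases i <;> fin_cases j
      exacts [e 0, o 0, e 1, o 1, e 2, e 3, o 2, e 4, o 3, e 5, o 4, e 6, o 5, e 7, o 6]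
    obtain ⟨i, hi⟩ := Function.ne_iff.1 hw
    have hq : ∀ j, quadrics a₂ a₄ a₆ v j = 0 := fun j => (mul_eq_zero.1 (hall i j)).resolve_left hi
    exact hv.quadrics h2 hd hn (hq 0) (hq 1) (hq 2) (hq 4)
  · intro x y h hp
    obtain ⟨x', y', h', he, hy⟩ := exists_eq_some_of_add_self_ne_zero hp.1
    obtain ⟨rfl, rfl⟩ : x = x' ∧ y = y' := by simpa using he
    have hdet := pencil_det (two_mul_tangentSlope h2 hy) (shortCurve_equation.1 h.1) v w
    have h3 : w ⬝ᵥ (pencil₁ a₂ x y (tangentSlope a₂ a₄ x y) v ⨯₃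
      pencil₂ a₂ x y (tangentSlope a₂ a₄ x y) v) = 0 := hp.2
    rw [h3, mul_zero] at hdet
    simp only [eval_finsetSum, eval_mul, eval_C, eval_pow, eval_X]
    exact hdet.symm

lemma dot_eq_zero_of_cross {u w N : Fin 3 → F} (hu : u ≠ 0) (hwu : w ⬝ᵥ u = 0)
    (h : u ⨯₃ N = 0) : w ⬝ᵥ N = 0 := by
  have c0 := congrFun h 0
  have c1 := congrFun h 1
  have c2 := congrFun h 2
  simp [cross_apply] at c0 c1 c2
  simp only [dotProduct, Fin.sum_univ_three] at hwu ⊢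
  obtain ⟨i, hi⟩ := Function.ne_iff.1 hu
  refine (mul_eq_zero.1 (?_ : u i * _ = 0)).resolve_left hi
  fin_cases i
  · simp only [Fin.zero_eta]
    linear_combination N 0 * hwu + w 1 * c2 - w 2 * c1
  · simp only [Fin.mk_one]
    linear_combination N 1 * hwu - w 0 * c2 + w 2 * c0
  · simp only [Fin.reduceFinMk]
    linear_combination N 2 * hwu + w 0 * c1 - w 1 * c0

lemma card_parallel_le {ι : Type*} {G : Finset ι} {N : ι → Fin 3 → F} {B : ℕ}
    (hN : ∀ w : Fin 3 → F, w ≠ 0 → #{P ∈ G | w ⬝ᵥ N P = 0} ≤ B) (k : ℕ) :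
    ∀ S : Finset (Fin 3 → F), (∀ u ∈ S, u ≠ 0) → #S ≤ 2 * k →
      #{P ∈ G | ∃ u ∈ S, u ⨯₃ N P = 0} ≤ B * k := by
  induction k with
  | zero =>
    intro S _ hS
    obtain rfl : S = ∅ := card_eq_zero.1 (by omega)
    simp
  | succ k ih =>
    intro S hS0 hS
    rcases S.eq_empty_or_nonempty with rfl | ⟨u₁, hu₁⟩
    · simp
    have hc1 := card_erase_of_mem hu₁
    obtain ⟨u₂, hu₂S, hu₂⟩ : ∃ u₂ ∈ S, #((S.erase u₁).erase u₂) ≤ 2 * k := by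
      rcases (S.erase u₁).eq_empty_or_nonempty with h | ⟨u₂, hu₂⟩
      · exact ⟨u₁, hu₁, by simp [h]⟩
      · refine ⟨u₂, mem_of_mem_erase hu₂, ?_⟩
        rw [card_erase_of_mem hu₂]
        omega
    obtain ⟨w, hw0, hw1, hw2⟩ := exists_line u₁ u₂
    have hsub : {P ∈ G | ∃ u ∈ S, u ⨯₃ N P = 0} ⊆ {P ∈ G | w ⬝ᵥ N P = 0} ∪
        {P ∈ G | ∃ u ∈ (S.erase u₁).erase u₂, u ⨯₃ N P = 0} := by
      intro P hP
      simp only [mem_filter, mem_union, mem_erase] at hP ⊢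
      obtain ⟨hPG, u, hu, hcross⟩ := hP
      by_cases h1 : u = u₁
      · exact Or.inl ⟨hPG, dot_eq_zero_of_cross (hS0 u hu) (h1 ▸ hw1) hcross⟩
      by_cases h2 : u = u₂
      · exact Or.inl ⟨hPG, dot_eq_zero_of_cross (hS0 u hu) (h2 ▸ hw2) hcross⟩
      exact Or.inr ⟨hPG, u, ⟨h2, h1, hu⟩, hcross⟩
    have h1 := hN w hw0
    have h2 := ih ((S.erase u₁).erase u₂)
      (fun u hu => hS0 u (mem_of_mem_erase (mem_of_mem_erase hu))) hu₂
    calc _ ≤ _ := card_le_card hsub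
      _ ≤ _ := card_union_le _ _
      _ ≤ B + B * k := Nat.add_le_add h1 h2
      _ = B * (k + 1) := by ring

lemma exists_independent_normals {ι : Type*} {G : Finset ι} {N : ι → Fin 3 → F}
    (hN : ∀ w : Fin 3 → F, w ≠ 0 → #{P ∈ G | w ⬝ᵥ N P = 0} ≤ 15) (hG : 91 ≤ #G) :
    ∃ (t : Fin 12 → ι) (h0 : ∀ i, N (t i) ≠ 0), (∀ i, t i ∈ G) ∧
      Function.Injective fun i => Projectivization.mk F (N (t i)) (h0 i) := by
  have : Fintype (ℙ F (Fin 3 → F)) := Fintype.ofFinite _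
  set I : Finset (ℙ F (Fin 3 → F)) :=
    univ.filter fun x => ∃ P ∈ G, ∃ h : N P ≠ 0, Projectivization.mk F (N P) h = x with hI
  have hI12 : 12 ≤ #I := by
    by_contra! hlt
    have hcard := card_parallel_le hN 6 (insert ![1, 0, 0] (I.image Projectivization.rep)) ?_ ?_
    · have hall : ∀ P ∈ G, ∃ u ∈ insert ![1, 0, 0] (I.image Projectivization.rep),
          u ⨯₃ N P = 0 := by
        intro P hP
        by_cases h0 : N P = 0
        · exact ⟨_, mem_insert_self _ _, by rw [h0, map_zero]⟩
        · refine ⟨(Projectivization.mk F (N P) h0).rep, mem_insert_of_mem (mem_image_of_mem _ ?_), ?_⟩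
          · simp only [hI, mem_filter, mem_univ, true_and]
            exact ⟨P, hP, h0, rfl⟩
          · obtain ⟨c, hc⟩ := Projectivization.exists_smul_eq_mk_rep F (N P) h0
            rw [← hc, Units.smul_def, map_smul, LinearMap.smul_apply, cross_self, smul_zero]
      rw [filter_true_of_mem hall] at hcard
      omega
    · intro u hu
      rcases mem_insert.1 hu with rfl | hu
      · exact fun h => by simpa using congrFun h 0
      · obtain ⟨x, -, rfl⟩ := mem_image.1 hu
        exact x.rep_nonzero
    · have h1 := card_insert_le ![1, 0, 0] (I.image Projectivization.rep)
      have h2 := card_image_le (s := I) (f := Projectivization.rep)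
      omega
  have hemb : Nonempty (Fin 12 ↪ I) := by
    rw [Function.Embedding.nonempty_iff_card_le]
    simpa using hI12
  obtain ⟨f⟩ := hemb
  have hf : ∀ i, ∃ P ∈ G, ∃ h : N P ≠ 0, Projectivization.mk F (N P) h = (f i : ℙ F (Fin 3 → F)) :=
    fun i => (mem_filter.1 (f i).2).2
  choose t htG ht0 ht using hf
  refine ⟨t, ht0, htG, fun i j hij => f.injective (Subtype.ext ?_)⟩
  rw [← ht i, ← ht j]
  exact hij
end Normal

section Incidence
open WeierstrassCurve Finset Matrix Configuration Configuration.ofField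
open scoped Classical LinearAlgebra.Projectivization
variable {F : Type} [Field F] [Fintype F] {a₂ a₄ a₆ : F}

noncomputable instance : Fintype (ℙ F (Fin 3 → F)) := Fintype.ofFinite _

lemma order_ofField :
    ProjectivePlane.order (ℙ F (Fin 3 → F)) (ℙ F (Fin 3 → F)) = Fintype.card F := by
  have h1 := ProjectivePlane.card_points (ℙ F (Fin 3 → F)) (ℙ F (Fin 3 → F))
  have h2 := Projectivization.card_of_finrank F (Fin 3 → F) (n := 3) (by simp)
  rw [Nat.card_eq_fintype_card, h1, Nat.card_eq_fintype_card] at h2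
  simp only [sum_range_succ, sum_range_zero, pow_zero, pow_one] at h2
  generalize ProjectivePlane.order (ℙ F (Fin 3 → F)) (ℙ F (Fin 3 → F)) = r at h2 ⊢
  rcases lt_trichotomy r (Fintype.card F) with h | h | h
  · nlinarith
  · exact h
  · nlinarith

lemma vec3_ne_zero (T : (shortCurve a₂ a₄ a₆).toAffine.Point) : vec3 T ≠ 0 := by
  rcases T with _ | ⟨x, y, h⟩
  · exact fun h => one_ne_zero (congrFun h 2)
  · exact fun h => one_ne_zero (congrFun h 0)

/-- The projective point attached to a point of the curve. -/
noncomputable def planePoint (T : (shortCurve a₂ a₄ a₆).toAffine.Point) : ℙ F (Fin 3 → F) :=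
  Projectivization.mk F (vec3 T) (vec3_ne_zero T)

lemma planePoint_injective :
    Function.Injective (planePoint : (shortCurve a₂ a₄ a₆).toAffine.Point → ℙ F (Fin 3 → F)) := by
  intro S T h
  obtain ⟨c, hc⟩ := (Projectivization.mk_eq_mk_iff' F _ _ _ _).1 h
  have e0 := congrFun hc 0
  have e1 := congrFun hc 1
  have e2 := congrFun hc 2
  rcases S with _ | ⟨x, y, hS⟩ <;> rcases T with _ | ⟨x', y', hT⟩
  · rfl
  · simp [vec3] at e0 e1 e2
    simp [e0] at e2
  · simp [vec3] at e0
  · simp only [vec3, Pi.smul_apply, smul_eq_mul, cons_val_zero, cons_val_one, Matrix.cons_val] at e0 e1 e2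
    obtain rfl : c = 1 := by simpa using e0
    obtain rfl : x' = x := by simpa using e1
    obtain rfl : y' = y := by simpa using e2
    rfl

lemma planePoint_mem_mk {l : Fin 3 → F} (hl : l ≠ 0) (T : (shortCurve a₂ a₄ a₆).toAffine.Point) :
    planePoint T ∈ (Projectivization.mk F l hl : ℙ F (Fin 3 → F)) ↔ ev3 l T = 0 := by
  rw [mem_iff, planePoint, Projectivization.orthogonal_mk, ev3_eq_dot, dotProduct_comm]

variable (a₂ a₄ a₆) in
/-- The points of the cubic in the projective plane. -/
noncomputable def planeCurve : Finset (ℙ F (Fin 3 → F)) :=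
  univ.image (planePoint : (shortCurve a₂ a₄ a₆).toAffine.Point → ℙ F (Fin 3 → F))

lemma card_planeCurve :
    #(planeCurve a₂ a₄ a₆) = Fintype.card (shortCurve a₂ a₄ a₆).toAffine.Point := by
  rw [planeCurve, card_image_of_injective _ planePoint_injective, card_univ]

lemma hits_planeCurve {l : Fin 3 → F} (hl : l ≠ 0) :
    hits (planeCurve a₂ a₄ a₆) (Projectivization.mk F l hl : ℙ F (Fin 3 → F)) =
      #{T : (shortCurve a₂ a₄ a₆).toAffine.Point | ev3 l T = 0} := by
  rw [hits_eq_card, planeCurve, filter_image, card_image_of_injective _ planePoint_injective]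
  simp only [planePoint_mem_mk]

lemma hits_planeCurve_le (l : ℙ F (Fin 3 → F)) : hits (planeCurve a₂ a₄ a₆) l ≤ 3 := by
  induction l with | h l hl =>
  rw [hits_planeCurve]
  exact_mod_cast ev3_zeros_le hl

lemma exists_tangent_of_hits_eq_two {l : ℙ F (Fin 3 → F)} (h : hits (planeCurve a₂ a₄ a₆) l = 2) :
    ∃ A : (shortCurve a₂ a₄ a₆).toAffine.Point,
      A ≠ -(A + A) ∧ planePoint A ∈ l ∧ planePoint (-(A + A)) ∈ l := by
  induction l with | h l hl =>
  rw [hits_planeCurve] at h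
  obtain ⟨A, B, hAB, hset⟩ := card_eq_two.1 (by exact_mod_cast h)
  have hmem : ∀ T : (shortCurve a₂ a₄ a₆).toAffine.Point, ev3 l T = 0 ↔ T = A ∨ T = B := by
    intro T
    have := Finset.ext_iff.1 hset T
    simpa using this
  have hA := (hmem A).2 (Or.inl rfl)
  have hB := (hmem B).2 (Or.inr rfl)
  simp only [planePoint_mem_mk]
  rcases (hmem _).1 (third_point_on_line hA hB hAB) with h3 | h3
  · have : B = -(A + A) := (eq_sub_of_add_eq' (neg_eq_iff_eq_neg.1 h3)).trans (by abel)
    exact ⟨A, this ▸ hAB, hA, this ▸ hB⟩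
  · have : A = -(B + B) := (eq_sub_of_add_eq (neg_eq_iff_eq_neg.1 h3)).trans (by abel)
    exact ⟨B, this ▸ hAB.symm, hB, this ▸ hA⟩

lemma card_hits_eq_two_le :
    #{l : ℙ F (Fin 3 → F) | hits (planeCurve a₂ a₄ a₆) l = 2} ≤ #(planeCurve a₂ a₄ a₆) := by
  have hex : ∀ l : ℙ F (Fin 3 → F), ∃ A : (shortCurve a₂ a₄ a₆).toAffine.Point,
      hits (planeCurve a₂ a₄ a₆) l = 2 →
        A ≠ -(A + A) ∧ planePoint A ∈ l ∧ planePoint (-(A + A)) ∈ l := by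
    intro l
    by_cases h : hits (planeCurve a₂ a₄ a₆) l = 2
    · exact (exists_tangent_of_hits_eq_two h).imp fun A hA _ => hA
    · exact ⟨0, fun h' => absurd h' h⟩
  choose g hg using hex
  rw [card_planeCurve, ← card_univ]
  refine card_le_card_of_injOn g (fun _ _ => mem_coe.2 (mem_univ _)) fun l hl l' hl' hgg => ?_
  obtain ⟨h1, h2, h3⟩ := hg l (by simpa using hl)
  obtain ⟨-, h2', h3'⟩ := hg l' (by simpa using hl')
  rw [← hgg] at h2' h3'
  exact (Nondegenerate.eq_or_eq h2 h3 h2' h3').resolve_left fun h => h1 (planePoint_injective h)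

lemma card_lines_through_le {p p₁ p₂ : ℙ F (Fin 3 → F)} {s : Finset (ℙ F (Fin 3 → F))}
    (h₁ : p ≠ p₁) (h₂ : p ≠ p₂) (hp : ∀ l ∈ s, p ∈ l) (hs : ∀ l ∈ s, p₁ ∈ l ∨ p₂ ∈ l) :
    #s ≤ 2 := by
  refine (card_le_card (t := {HasLines.mkLine (L := ℙ F (Fin 3 → F)) h₁,
    HasLines.mkLine (L := ℙ F (Fin 3 → F)) h₂}) fun l hl => ?_).trans card_le_two
  rw [mem_insert, mem_singleton]
  rcases hs l hl with h | h
  · exact Or.inl ((Nondegenerate.eq_or_eq (hp l hl) h (HasLines.mkLine_ax h₁).1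
      (HasLines.mkLine_ax h₁).2).resolve_left h₁)
  · exact Or.inr ((Nondegenerate.eq_or_eq (hp l hl) h (HasLines.mkLine_ax h₂).1
      (HasLines.mkLine_ax h₂).2).resolve_left h₂)

lemma exists_poor_points (h2 : (2 : F) ≠ 0)
    (hn : 20 ≤ Fintype.card (shortCurve a₂ a₄ a₆).toAffine.Point) {v : Fin 5 → F}
    (hv : IsExtVec a₂ a₄ a₆ v) {T : (shortCurve a₂ a₄ a₆).toAffine.Point} (hT : T + T ≠ 0)
    (h0 : normal v T ≠ 0) :
    ∃ A : Finset (ℙ F (Fin 3 → F)), (∀ p ∈ A, p ∈ Projectivization.mk F (normal v T) h0) ∧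
      Disjoint A (planeCurve a₂ a₄ a₆) ∧
      #A = (Fintype.card (shortCurve a₂ a₄ a₆).toAffine.Point - 13) / 2 ∧
      ∀ p ∈ A, #{l : ℙ F (Fin 3 → F) | p ∈ l ∧ hits (planeCurve a₂ a₄ a₆) l = 3} ≤ 2 := by
  obtain ⟨a, b, hab, rfl, hb⟩ := exists_eq_some_of_add_self_ne_zero hT
  set m := tangentSlope a₂ a₄ a b with hm
  obtain ⟨s, hs, hpoor⟩ := exists_slopes h2 hn hv (two_mul_tangentSlope h2 hb) hb hab
  have hN : normal v (.some a b hab : (shortCurve a₂ a₄ a₆).toAffine.Point) =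
    pencil₁ a₂ a b m v ⨯₃ pencil₂ a₂ a b m v := rfl
  have hcross : ∀ σ τ : F, pencil a₂ a b m σ v ⨯₃ pencil a₂ a b m τ v = (σ - τ) •
      normal v (.some a b hab : (shortCurve a₂ a₄ a₆).toAffine.Point) := by
    intro σ τ
    rw [hN, pencil, pencil]
    simp only [map_add, map_smul, LinearMap.add_apply, LinearMap.smul_apply, cross_self, smul_zero,
      add_zero, zero_add]
    rw [← cross_anticomm (pencil₁ a₂ a b m v) (pencil₂ a₂ a b m v)]
    module
  have hp0 : ∀ σ, pencil a₂ a b m σ v ≠ 0 := by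
    intro σ h
    have := hcross σ (σ - 1)
    rw [h, map_zero, LinearMap.zero_apply, sub_sub_cancel, one_smul] at this
    exact h0 this.symm
  set pp : F → ℙ F (Fin 3 → F) := fun σ => Projectivization.mk F _ (hp0 σ) with hpp
  have hinj : Function.Injective pp := by
    intro σ τ h
    have := (Projectivization.mk_eq_mk_iff_crossProduct_eq_zero (hp0 σ) (hp0 τ)).1 h
    rw [hcross] at this
    exact sub_eq_zero.1 ((smul_eq_zero.1 this).resolve_right h0)
  have hon : ∀ σ, pp σ ∈ (Projectivization.mk F _ h0 : ℙ F (Fin 3 → F)) := by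
    intro σ
    rw [mem_iff, hpp, Projectivization.orthogonal_mk, hN, pencil, add_dotProduct, smul_dotProduct,
      dot_self_cross, dot_cross_self]
    simp
  have hcard : (Fintype.card (shortCurve a₂ a₄ a₆).toAffine.Point - 13) / 2 ≤
      #(s.image pp \ planeCurve a₂ a₄ a₆) := by
    have h3 : #(s.image pp ∩ planeCurve a₂ a₄ a₆) ≤ 3 := by
      have h := hits_planeCurve_le (a₂ := a₂) (a₄ := a₄) (a₆ := a₆) (Projectivization.mk F _ h0)
      rw [hits_eq_card] at h
      refine (card_le_card fun p hp => ?_).trans (Int.ofNat_le.1 h)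
      rw [mem_inter, mem_image] at hp
      obtain ⟨⟨σ, -, rfl⟩, hp⟩ := hp
      exact mem_filter.2 ⟨hp, hon σ⟩
    have h4 := card_sdiff_add_card_inter (s.image pp) (planeCurve a₂ a₄ a₆)
    rw [card_image_of_injective _ hinj] at h4
    omega
  obtain ⟨A, hA, hAm⟩ := exists_subset_card_eq hcard
  refine ⟨A, fun p hp => ?_, ?_, hAm, fun p hp => ?_⟩
  · obtain ⟨σ, -, rfl⟩ := mem_image.1 (mem_sdiff.1 (hA hp)).1
    exact hon σ
  · exact disjoint_of_subset_left hA sdiff_disjoint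
  · obtain ⟨hp1, hp2⟩ := mem_sdiff.1 (hA hp)
    obtain ⟨σ, hσ, rfl⟩ := mem_image.1 hp1
    obtain ⟨P₁, P₂, hP⟩ := hpoor σ hσ
    have hne : ∀ S : (shortCurve a₂ a₄ a₆).toAffine.Point, pp σ ≠ planePoint S :=
      fun S h => hp2 (h ▸ mem_image_of_mem _ (mem_univ S))
    refine card_lines_through_le (hne P₁) (hne P₂) (fun l hl => (mem_filter.1 hl).2.1)
      fun l hl => ?_
    obtain ⟨-, hl1, hl2⟩ := mem_filter.1 hl
    induction l with | h l hl0 =>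
    rw [hits_planeCurve] at hl2
    rw [planePoint_mem_mk, planePoint_mem_mk]
    rw [mem_iff, hpp, Projectivization.orthogonal_mk, dotProduct_comm] at hl1
    exact hP l hl0 hl1 (by exact_mod_cast hl2)

theorem not_isExtVec (hq : 121 ≤ Fintype.card F) (hodd : Odd (Fintype.card F)) (h2 : (2 : F) ≠ 0)
    (hd : cubicDisc a₂ a₄ a₆ ≠ 0) (v : Fin 5 → F) : ¬ IsExtVec a₂ a₄ a₆ v := by
  intro hv
  have hcard := card_affine_ge hodd hq h2 hd
  rw [← card_point h2 hd] at hcard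
  set n := Fintype.card (shortCurve a₂ a₄ a₆).toAffine.Point with hn
  have hG : 91 ≤ #{T : (shortCurve a₂ a₄ a₆).toAffine.Point | T + T ≠ 0} := by
    have h4 := card_two_torsion (a₂ := a₂) (a₄ := a₄) (a₆ := a₆) h2
    have := card_filter_add_card_filter_not (s := (univ : Finset (shortCurve a₂ a₄ a₆).toAffine.Point))
      (fun T => T + T = 0)
    simp only [card_univ, ← hn, ← ne_eq] at this
    omega
  obtain ⟨t, h0, htG, hinj⟩ := exists_independent_normals (N := normal v)
    (fun w hw => by
      rw [filter_filter]
      exact card_normal_le h2 hd (by omega) hv hw) hG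
  have hpts := fun i => exists_poor_points h2 (by omega) hv (mem_filter.1 (htG i)).2 (h0 i)
  choose A hA hAE hAm hA3 using hpts
  refine trisecant_moment (planeCurve a₂ a₄ a₆) hits_planeCurve_le card_hits_eq_two_le _ hinj A hA hAE
    ((n - 13) / 2) hAm hA3 ?_ ?_ ?_ ?_
  · rw [card_planeCurve]; omega
  · rw [card_planeCurve]; omega
  · rwa [order_ofField]
  · rw [order_ofField]; omega
end Incidence

section Length
variable {F : Type} [Field F] [Fintype F] [DecidableEq F]

lemma six_le_length (hq : 121 ≤ Fintype.card F) (hodd : Odd (Fintype.card F)) (h2 : (2 : F) ≠ 0)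
    (W : WeierstrassCurve F) [W.IsElliptic] {n : ℕ} (e : Fin n ≃ W.toAffine.Point) : 6 ≤ n := by
  classical
  have hd := cubicDisc_completeSquare_ne_zero h2 W
  obtain ⟨f, hf, -⟩ := completeSquare_bijective h2 W
  have h := card_affine_ge hodd hq h2 hd
  rw [← card_point h2 hd, ← Fintype.card_of_bijective (hf.comp e.bijective), Fintype.card_fin] at h
  omega

end Length

/-- Let `q ≥ 121` be an odd prime power and `E/F_q` an elliptic curve with
`j(E) ≠ 0`. Then the `5`-elliptic code associated to `E` is not `3`-extendable. -/
theorem statement14 (hq : 121 ≤ Fintype.card F) (hodd : Odd (Fintype.card F))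
    (W : WeierstrassCurve F) [W.IsElliptic] (hj : W.j ≠ 0) {n : ℕ}
    (hn : n = Nat.card W.toAffine.Point) (e : Fin n ≃ W.toAffine.Point) :
    ¬ IsHExtendable 3 (ellipticCode W 5 e) := by
  have h2 : (2 : F) ≠ 0 := by
    intro h
    have hchar : ringChar F = 2 := CharP.ringChar_of_prime_eq_zero Nat.prime_two (by exact_mod_cast h)
    exact Nat.not_even_iff_odd.2 hodd (Nat.even_iff.2 (FiniteField.even_card_of_char_two hchar))
  intro hext
  obtain ⟨v, hv⟩ := exists_isExtVec h2 W e (six_le_length hq hodd h2 W e) hext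
  exact not_isExtVec hq hodd h2 (cubicDisc_completeSquare_ne_zero h2 W) v hv

end NMDS
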